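/- arXiv:0804.0657 — 2 statements merged into one kernel-verified Lean document; each statement's English description precedes it below -/
import Mathlib

section
/- Every simple polygon in the plane has an inscribed square: there exist four distinct points on the polygon that are the vertices of a nondegenerate square. -/
open scoped RealInnerProductSpace

noncomputable section

/-- The Euclidean plane. -/
abbrev Pt := EuclideanSpace ℝ (Fin 2)

/-- Counterclockwise rotation of a vector by `π/2`: `(x, y) ↦ (-y, x)`. -/
def rotCCW (w : Pt) : Pt := (WithLp.equiv 2 (Fin 2 → ℝ)).symm ![-w 1, w 0]

/-- Clockwise rotation of a vector by `π/2`: `(x, y) ↦ (y, -x)`. -/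
def rotCW (w : Pt) : Pt := (WithLp.equiv 2 (Fin 2 → ℝ)).symm ![w 1, -w 0]

/-- `v : ZMod n → Pt` (with `3 ≤ n`) is a simple polygon: consecutive vertices are
distinct, consecutive edges meet exactly in their common vertex, and
non-consecutive edges are disjoint. -/
def IsSimplePolygon {n : ℕ} (v : ZMod n → Pt) : Prop :=
  3 ≤ n ∧
  (∀ i, v i ≠ v (i + 1)) ∧
  (∀ i : ZMod n,
    segment ℝ (v i) (v (i + 1)) ∩ segment ℝ (v (i + 1)) (v (i + 2)) = {v (i + 1)}) ∧
  (∀ i j : ZMod n, i ≠ j → i ≠ j + 1 → j ≠ i + 1 →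
    segment ℝ (v i) (v (i + 1)) ∩ segment ℝ (v j) (v (j + 1)) = ∅)

/-- The polygon itself: the union of its edges. -/
def polygonSet {n : ℕ} (v : ZMod n → Pt) : Set Pt :=
  ⋃ i : ZMod n, segment ℝ (v i) (v (i + 1))

/-- Four distinct points of `P` forming the vertices of a (nondegenerate) square:
`a₂ - a₁ = a₃ - a₄` and `a₃ - a₂` is the rotation of `a₂ - a₁` by `π/2`. -/
def InscribedSquare (P : Set Pt) (a₁ a₂ a₃ a₄ : Pt) : Prop :=
  a₁ ∈ P ∧ a₂ ∈ P ∧ a₃ ∈ P ∧ a₄ ∈ P ∧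
  a₂ - a₁ = a₃ - a₄ ∧ a₃ - a₂ = rotCCW (a₂ - a₁) ∧
  a₁ ≠ a₂ ∧ a₁ ≠ a₃ ∧ a₁ ≠ a₄ ∧ a₂ ≠ a₃ ∧ a₂ ≠ a₄ ∧ a₃ ≠ a₄

/-- The boundary sum of `h` over the facets of the cubical cell `x`; a point of `ℤ⁴` encodes the
cell whose open directions are the odd coordinates. -/
def facetSum (h : (Fin 4 → ℤ) → ZMod 2) (x : Fin 4 → ℤ) : ZMod 2 :=
  ∑ i, if Odd (x i) then h (x + Pi.single i 1) + h (x - Pi.single i 1) else 0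

theorem sum_sum_eq_zero_of_symm {ι : Type*} [Fintype ι] [LinearOrder ι] (g : ι → ι → ZMod 2)
    (hs : ∀ i j, g i j = g j i) (hd : ∀ i, g i i = 0) : ∑ i, ∑ j, g i j = 0 := by
  rw [← Finset.sum_product']
  refine Finset.sum_involution (fun p _ => (p.2, p.1)) ?_ ?_ ?_ ?_
  · rintro ⟨i, j⟩ _
    simp only
    rw [hs j i]
    exact CharTwo.add_self_eq_zero _
  · rintro ⟨i, j⟩ _ h heq
    simp only [Prod.mk.injEq] at heq
    obtain ⟨rfl, _⟩ := heq
    exact h (hd _)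
  · simp
  · simp

theorem facetSum_facetSum (h : (Fin 4 → ℤ) → ZMod 2) (x : Fin 4 → ℤ) :
    facetSum (facetSum h) x = 0 := by
  have key : facetSum (facetSum h) x = ∑ i, ∑ j, if i = j then 0 else
      if Odd (x i) ∧ Odd (x j) then
        (h (x + Pi.single i 1 + Pi.single j 1) + h (x + Pi.single i 1 - Pi.single j 1)) +
        (h (x - Pi.single i 1 + Pi.single j 1) + h (x - Pi.single i 1 - Pi.single j 1)) else 0 := by
    unfold facetSum
    refine Finset.sum_congr rfl fun i _ => ?_
    by_cases hi : Odd (x i)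
    · rw [if_pos hi, ← Finset.sum_add_distrib]
      refine Finset.sum_congr rfl fun j _ => ?_
      by_cases hij : i = j
      · subst hij
        have h1 : ¬ Odd (x i + 1) := by grind
        have h2 : ¬ Odd (x i - 1) := by grind
        simp [h1, h2]
      · have hji : j ≠ i := fun e => hij e.symm
        by_cases hj : Odd (x j) <;> simp [hij, hi, hj, hji]
    · simp [hi]
  rw [key]
  refine sum_sum_eq_zero_of_symm _ (fun i j => ?_) (by simp)
  by_cases hij : i = j
  · simp [hij]
  · have hji : j ≠ i := fun e => hij e.symm
    rw [if_neg hij, if_neg hji]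
    by_cases hi : Odd (x i) <;> by_cases hj : Odd (x j) <;>
      simp only [hi, hj, and_self, and_true, and_false, if_true, if_false]
    · have e1 : x + Pi.single i 1 + Pi.single j 1 = x + Pi.single j 1 + Pi.single i 1 := by abel
      have e2 : x + Pi.single i 1 - Pi.single j 1 = x - Pi.single j 1 + Pi.single i 1 := by abel
      have e3 : x - Pi.single i 1 + Pi.single j 1 = x + Pi.single j 1 - Pi.single i 1 := by abel
      have e4 : x - Pi.single i 1 - Pi.single j 1 = x - Pi.single j 1 - Pi.single i 1 := by abel
      rw [e1, e2, e3, e4]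
      ring

/-- The parity of the number of common zeros, in the cell `x`, of the functions whose signs are
recorded by `a 0, …, a (j - 1)`. -/
def zeroParity (a : ℕ → (Fin 4 → ℤ) → ZMod 2) : ℕ → (Fin 4 → ℤ) → ZMod 2
  | 0 => fun _ => 1
  | j + 1 => facetSum fun y => zeroParity a j y * a j y

theorem facetSum_zeroParity (a : ℕ → (Fin 4 → ℤ) → ZMod 2) (j : ℕ) (x : Fin 4 → ℤ) :
    facetSum (zeroParity a j) x = 0 := by
  cases j with
  | zero =>
    simp only [facetSum, zeroParity]
    refine Finset.sum_eq_zero fun i _ => ?_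
    split_ifs
    · exact CharTwo.add_self_eq_zero _
    · rfl
  | succ j => exact facetSum_facetSum _ x

theorem exists_facet_of_zeroParity_ne_zero (a : ℕ → (Fin 4 → ℤ) → ZMod 2) (j : ℕ) (x : Fin 4 → ℤ)
    (hx : zeroParity a (j + 1) x ≠ 0) :
    ∃ i, Odd (x i) ∧ ∃ y, (y = x + Pi.single i 1 ∨ y = x - Pi.single i 1) ∧
      zeroParity a j y ≠ 0 ∧ a j y ≠ a j x := by
  by_contra! hcon
  refine hx ?_
  have h1 : zeroParity a (j + 1) x = zeroParity a (j + 1) x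
      + facetSum (zeroParity a j) x * a j x := by
    rw [facetSum_zeroParity]; simp
  rw [h1]
  simp only [zeroParity, facetSum]
  rw [Finset.sum_mul, ← Finset.sum_add_distrib]
  refine Finset.sum_eq_zero fun i _ => ?_
  split_ifs with ho
  · have t : ∀ y, (y = x + Pi.single i 1 ∨ y = x - Pi.single i 1) →
        zeroParity a j y * a j y + zeroParity a j y * a j x = 0 := by
      intro y hy
      by_cases h0 : zeroParity a j y = 0
      · simp [h0]
      · rw [hcon i ho y hy h0]
        exact CharTwo.add_self_eq_zero _
    have t1 := t _ (Or.inl rfl)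
    have t2 := t _ (Or.inr rfl)
    linear_combination t1 + t2
  · simp

theorem exists_sign_change (a : ℕ → (Fin 4 → ℤ) → ZMod 2) (M : ℤ) (hM : Even M) (j : ℕ) :
    ∀ x : Fin 4 → ℤ, (∀ l, 0 ≤ x l ∧ x l ≤ M) → zeroParity a j x ≠ 0 → ∀ i < j, ∃ y y' : Fin 4 → ℤ,
      (∀ l, 0 ≤ y l ∧ y l ≤ M ∧ |y l - x l| ≤ j) ∧ (∀ l, 0 ≤ y' l ∧ y' l ≤ M ∧ |y' l - x l| ≤ j) ∧
      a i y ≠ a i y' := by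
  induction j with
  | zero => intro x _ _ i hi; omega
  | succ j ih =>
    intro x hx hS i hi
    obtain ⟨l, hl, y, hy, hSy, hay⟩ := exists_facet_of_zeroParity_ne_zero a j x hS
    have hyx : ∀ m, 0 ≤ y m ∧ y m ≤ M ∧ |y m - x m| ≤ 1 := by
      intro m
      obtain ⟨h0, h1⟩ := hx m
      by_cases hm : m = l
      · subst hm
        rcases hy with rfl | rfl <;> simp <;> grind
      · rcases hy with rfl | rfl <;> simp [hm, h0, h1]
    rcases Nat.lt_succ_iff_lt_or_eq.mp hi with h | rfl
    · obtain ⟨y1, y2, h1, h2, h3⟩ := ih y (fun m => ⟨(hyx m).1, (hyx m).2.1⟩) hSy i h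
      refine ⟨y1, y2, fun m => ⟨(h1 m).1, (h1 m).2.1, ?_⟩, fun m => ⟨(h2 m).1, (h2 m).2.1, ?_⟩, h3⟩
      · have := abs_le.mp (h1 m).2.2; have := abs_le.mp (hyx m).2.2
        rw [abs_le]; push_cast; constructor <;> linarith
      · have := abs_le.mp (h2 m).2.2; have := abs_le.mp (hyx m).2.2
        rw [abs_le]; push_cast; constructor <;> linarith
    · refine ⟨y, x, fun m => ⟨(hyx m).1, (hyx m).2.1, ?_⟩, fun m => ⟨(hx m).1, (hx m).2, ?_⟩, hay⟩
      · have := (hyx m).2.2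
        push_cast; linarith [Int.natCast_nonneg i]
      · simp; positivity

theorem facetSum_vec (h : (Fin 4 → ℤ) → ZMod 2) (p q r s : ℤ) :
    facetSum h ![p, q, r, s] =
      (if Odd p then h ![p + 1, q, r, s] + h ![p - 1, q, r, s] else 0) +
      (if Odd q then h ![p, q + 1, r, s] + h ![p, q - 1, r, s] else 0) +
      (if Odd r then h ![p, q, r + 1, s] + h ![p, q, r - 1, s] else 0) +
      (if Odd s then h ![p, q, r, s + 1] + h ![p, q, r, s - 1] else 0) := by
  have e : ∀ (v : Fin 4 → ℤ) (i : Fin 4) (t : ℤ), v + Pi.single i t = Function.update v i (v i + t) := by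
    intro v i t; ext m; by_cases hm : m = i
    · subst hm; simp
    · simp [hm]
  have e' : ∀ (v : Fin 4 → ℤ) (i : Fin 4) (t : ℤ), v - Pi.single i t = Function.update v i (v i - t) := by
    intro v i t; ext m; by_cases hm : m = i
    · subst hm; simp
    · simp [hm]
  have u0 : ∀ t : ℤ, Function.update ![p, q, r, s] 0 t = ![t, q, r, s] := by
    intro t; ext m; fin_cases m <;> rfl
  have u1 : ∀ t : ℤ, Function.update ![p, q, r, s] 1 t = ![p, t, r, s] := by
    intro t; ext m; fin_cases m <;> rfl
  have u2 : ∀ t : ℤ, Function.update ![p, q, r, s] 2 t = ![p, q, t, s] := by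
    intro t; ext m; fin_cases m <;> rfl
  have u3 : ∀ t : ℤ, Function.update ![p, q, r, s] 3 t = ![p, q, r, t] := by
    intro t; ext m; fin_cases m <;> rfl
  simp only [facetSum, Fin.sum_univ_four, e, e', u0, u1, u2, u3]
  rfl

theorem sum_range_facets (f : ℤ → ZMod 2) (n : ℕ) :
    ∑ i ∈ Finset.range n, (f (2 * (i : ℤ) + 1 + 1) + f (2 * (i : ℤ) + 1 - 1)) = f (2 * n) + f 0 := by
  induction n with
  | zero => simp [CharTwo.add_self_eq_zero]
  | succ n ih =>
    rw [Finset.sum_range_succ, ih]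
    have e1 : (2 * (n : ℤ) + 1 + 1) = 2 * ((n + 1 : ℕ) : ℤ) := by push_cast; ring
    have e2 : (2 * (n : ℤ) + 1 - 1) = 2 * n := by ring
    rw [e1, e2]
    have := CharTwo.add_self_eq_zero (f (2 * n))
    linear_combination this

theorem facetSum_comp (h : (Fin 4 → ℤ) → ZMod 2) (M : ℤ) (hM : Even M) (p q r s : ℤ) :
    facetSum h ![M - q, p, M - r, s + M] =
      facetSum (fun y => h ![M - y 1, y 0, M - y 2, y 3 + M]) ![p, q, r, s] := by
  simp only [facetSum_vec]
  have o1 : Odd (M - q) ↔ Odd q := by grind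
  have o2 : Odd (M - r) ↔ Odd r := by grind
  have o3 : Odd (s + M) ↔ Odd s := by grind
  simp only [o1, o2, o3, Matrix.cons_val_zero, Matrix.cons_val_one, Matrix.cons_val]
  have a1 : M - q + 1 = M - (q - 1) := by ring
  have a2 : M - q - 1 = M - (q + 1) := by ring
  have a3 : M - r + 1 = M - (r - 1) := by ring
  have a4 : M - r - 1 = M - (r + 1) := by ring
  have a5 : s + M + 1 = s + 1 + M := by ring
  have a6 : s + M - 1 = s - 1 + M := by ring
  rw [a1, a2, a3, a4, a5, a6]
  split_ifs <;> ring

theorem zeroParity_comp (a : ℕ → (Fin 4 → ℤ) → ZMod 2) (M : ℤ) (hM : Even M) (j : ℕ)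
    (ha : ∀ i < j, ∀ p q r, 0 ≤ p → p ≤ M → 0 ≤ q → q ≤ M → 0 ≤ r → r ≤ M →
      a i ![M - q, p, M - r, M] = a i ![p, q, r, 0] + 1) :
    ∀ p q r, 0 ≤ p → p ≤ M → 0 ≤ q → q ≤ M → 0 ≤ r → r ≤ M →
      zeroParity a j ![M - q, p, M - r, M] = zeroParity a j ![p, q, r, 0] := by
  induction j with
  | zero => intros; rfl
  | succ j ih =>
    intro p q r hp hp' hq hq' hr hr'
    have ih' := ih fun i hi => ha i (by omega)
    have e := facetSum_comp (fun y => zeroParity a j y * a j y) M hM p q r 0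
    rw [zero_add] at e
    have c := facetSum_zeroParity a j ![p, q, r, 0]
    rw [facetSum_vec] at c
    simp only [zeroParity]
    rw [e]
    simp only [facetSum_vec, Matrix.cons_val_zero, Matrix.cons_val_one, Matrix.cons_val, zero_add]
    have hne : ¬ Odd (0 : ℤ) := by decide
    simp only [hne, if_false, add_zero] at c ⊢
    have t : ∀ p q r, 0 ≤ p → p ≤ M → 0 ≤ q → q ≤ M → 0 ≤ r → r ≤ M →
        zeroParity a j ![M - q, p, M - r, M] * a j ![M - q, p, M - r, M] =
        zeroParity a j ![p, q, r, 0] * a j ![p, q, r, 0] + zeroParity a j ![p, q, r, 0] := by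
      intro p q r h1 h2 h3 h4 h5 h6
      rw [ih' p q r h1 h2 h3 h4 h5 h6, ha j (by omega) p q r h1 h2 h3 h4 h5 h6]
      ring
    have b : ∀ m, 0 ≤ m → m ≤ M → Odd m → 0 ≤ m + 1 ∧ m + 1 ≤ M ∧ 0 ≤ m - 1 ∧ m - 1 ≤ M := by
      intro m h0 h1 h2
      grind
    have split : ∀ {P : Prop} [Decidable P] {A B C : ZMod 2}, (P → A = B + C) →
        (if P then A else 0) = (if P then B else 0) + (if P then C else 0) := by
      intro P _ A B C h
      split_ifs with hP
      · exact h hP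
      · simp
    have d1 := split (P := Odd p) fun h => by
      obtain ⟨k1, k2, k3, k4⟩ := b p hp hp' h
      exact congrArg₂ (· + ·) (t (p + 1) q r k1 k2 hq hq' hr hr') (t (p - 1) q r k3 k4 hq hq' hr hr')
        |>.trans (add_add_add_comm _ _ _ _)
    have d2 := split (P := Odd q) fun h => by
      obtain ⟨k1, k2, k3, k4⟩ := b q hq hq' h
      exact congrArg₂ (· + ·) (t p (q + 1) r hp hp' k1 k2 hr hr') (t p (q - 1) r hp hp' k3 k4 hr hr')
        |>.trans (add_add_add_comm _ _ _ _)
    have d3 := split (P := Odd r) fun h => by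
      obtain ⟨k1, k2, k3, k4⟩ := b r hr hr' h
      exact congrArg₂ (· + ·) (t p q (r + 1) hp hp' hq hq' k1 k2) (t p q (r - 1) hp hp' hq hq' k3 k4)
        |>.trans (add_add_add_comm _ _ _ _)
    rw [d1, d2, d3]
    linear_combination c

theorem odd_two_mul_add_one_int (i : ℕ) : Odd (2 * (i : ℤ) + 1) := ⟨i, rfl⟩

/-- Reversing the order of the odd numbers in `(0, 2 * n)`. -/
theorem sum_range_odd_reflect (f : ℤ → ZMod 2) (n : ℕ) :
    ∑ i ∈ Finset.range n, f (2 * n - (2 * (i : ℤ) + 1)) =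
      ∑ i ∈ Finset.range n, f (2 * (i : ℤ) + 1) := by
  rw [← Finset.sum_range_reflect (fun i : ℕ => f (2 * (i : ℤ) + 1))]
  refine Finset.sum_congr rfl fun i hi => ?_
  have := Finset.mem_range.mp hi
  congr 1
  omega

theorem sum_facetSum_square (h : (Fin 4 → ℤ) → ZMod 2) (n : ℕ) (r s : ℤ) (hr : ¬ Odd r)
    (hs : ¬ Odd s) :
    ∑ i ∈ Finset.range n, ∑ j ∈ Finset.range n,
      facetSum h ![2 * (i : ℤ) + 1, 2 * (j : ℤ) + 1, r, s] =
    ∑ j ∈ Finset.range n, (h ![2 * (n : ℤ), 2 * (j : ℤ) + 1, r, s] + h ![0, 2 * (j : ℤ) + 1, r, s]) +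
    ∑ i ∈ Finset.range n,
      (h ![2 * (i : ℤ) + 1, 2 * (n : ℤ), r, s] + h ![2 * (i : ℤ) + 1, 0, r, s]) := by
  simp only [facetSum_vec, odd_two_mul_add_one_int, hr, hs, if_true, if_false, add_zero]
  rw [Finset.sum_congr rfl fun i _ => Finset.sum_add_distrib, Finset.sum_add_distrib]
  congr 1
  · rw [Finset.sum_comm]
    exact Finset.sum_congr rfl fun j _ => sum_range_facets (fun x => h ![x, 2 * (j : ℤ) + 1, r, s]) n
  · exact Finset.sum_congr rfl fun i _ => sum_range_facets (fun x => h ![2 * (i : ℤ) + 1, x, r, s]) n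

theorem sum_facetSum_cube (h : (Fin 4 → ℤ) → ZMod 2) (n : ℕ) (s : ℤ) (hs : ¬ Odd s) :
    ∑ k ∈ Finset.range n, ∑ i ∈ Finset.range n, ∑ j ∈ Finset.range n,
      facetSum h ![2 * (i : ℤ) + 1, 2 * (j : ℤ) + 1, 2 * (k : ℤ) + 1, s] =
    ∑ k ∈ Finset.range n, (∑ j ∈ Finset.range n,
      (h ![2 * (n : ℤ), 2 * (j : ℤ) + 1, 2 * (k : ℤ) + 1, s] +
        h ![0, 2 * (j : ℤ) + 1, 2 * (k : ℤ) + 1, s]) +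
      ∑ i ∈ Finset.range n, (h ![2 * (i : ℤ) + 1, 2 * (n : ℤ), 2 * (k : ℤ) + 1, s] +
        h ![2 * (i : ℤ) + 1, 0, 2 * (k : ℤ) + 1, s])) +
    ∑ i ∈ Finset.range n, ∑ j ∈ Finset.range n,
      (h ![2 * (i : ℤ) + 1, 2 * (j : ℤ) + 1, 2 * (n : ℤ), s] +
        h ![2 * (i : ℤ) + 1, 2 * (j : ℤ) + 1, 0, s]) := by
  have e : ∀ i j k : ℕ, facetSum h ![2 * (i : ℤ) + 1, 2 * (j : ℤ) + 1, 2 * (k : ℤ) + 1, s] =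
      ((h ![2 * (i : ℤ) + 1 + 1, 2 * (j : ℤ) + 1, 2 * (k : ℤ) + 1, s] +
        h ![2 * (i : ℤ) + 1 - 1, 2 * (j : ℤ) + 1, 2 * (k : ℤ) + 1, s]) +
      (h ![2 * (i : ℤ) + 1, 2 * (j : ℤ) + 1 + 1, 2 * (k : ℤ) + 1, s] +
        h ![2 * (i : ℤ) + 1, 2 * (j : ℤ) + 1 - 1, 2 * (k : ℤ) + 1, s])) +
      (h ![2 * (i : ℤ) + 1, 2 * (j : ℤ) + 1, 2 * (k : ℤ) + 1 + 1, s] +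
        h ![2 * (i : ℤ) + 1, 2 * (j : ℤ) + 1, 2 * (k : ℤ) + 1 - 1, s]) := by
    intro i j k
    simp only [facetSum_vec, odd_two_mul_add_one_int, hs, if_true, if_false, add_zero]
  simp only [e]
  rw [Finset.sum_congr rfl fun k _ => Finset.sum_congr rfl fun i _ => Finset.sum_add_distrib,
    Finset.sum_congr rfl fun k _ => Finset.sum_add_distrib, Finset.sum_add_distrib]
  congr 1
  · refine Finset.sum_congr rfl fun k _ => ?_
    rw [Finset.sum_congr rfl fun i _ => Finset.sum_add_distrib, Finset.sum_add_distrib]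
    congr 1
    · rw [Finset.sum_comm]
      exact Finset.sum_congr rfl fun j _ =>
        sum_range_facets (fun x => h ![x, 2 * (j : ℤ) + 1, 2 * (k : ℤ) + 1, s]) n
    · exact Finset.sum_congr rfl fun i _ =>
        sum_range_facets (fun x => h ![2 * (i : ℤ) + 1, x, 2 * (k : ℤ) + 1, s]) n
  · rw [Finset.sum_comm]
    refine Finset.sum_congr rfl fun i _ => ?_
    rw [Finset.sum_comm]
    exact Finset.sum_congr rfl fun j _ =>
      sum_range_facets (fun x => h ![2 * (i : ℤ) + 1, 2 * (j : ℤ) + 1, x, s]) n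

theorem sum_facetSum_hypercube (h : (Fin 4 → ℤ) → ZMod 2) (n : ℕ) :
    ∑ l ∈ Finset.range n, ∑ k ∈ Finset.range n, ∑ i ∈ Finset.range n, ∑ j ∈ Finset.range n,
      facetSum h ![2 * (i : ℤ) + 1, 2 * (j : ℤ) + 1, 2 * (k : ℤ) + 1, 2 * (l : ℤ) + 1] =
    ∑ l ∈ Finset.range n,
      (∑ k ∈ Finset.range n, (∑ j ∈ Finset.range n,
        (h ![2 * (n : ℤ), 2 * (j : ℤ) + 1, 2 * (k : ℤ) + 1, 2 * (l : ℤ) + 1] +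
          h ![0, 2 * (j : ℤ) + 1, 2 * (k : ℤ) + 1, 2 * (l : ℤ) + 1]) +
        ∑ i ∈ Finset.range n,
          (h ![2 * (i : ℤ) + 1, 2 * (n : ℤ), 2 * (k : ℤ) + 1, 2 * (l : ℤ) + 1] +
          h ![2 * (i : ℤ) + 1, 0, 2 * (k : ℤ) + 1, 2 * (l : ℤ) + 1])) +
      ∑ i ∈ Finset.range n, ∑ j ∈ Finset.range n,
        (h ![2 * (i : ℤ) + 1, 2 * (j : ℤ) + 1, 2 * (n : ℤ), 2 * (l : ℤ) + 1] +
          h ![2 * (i : ℤ) + 1, 2 * (j : ℤ) + 1, 0, 2 * (l : ℤ) + 1])) +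
    ∑ k ∈ Finset.range n, ∑ i ∈ Finset.range n, ∑ j ∈ Finset.range n,
      (h ![2 * (i : ℤ) + 1, 2 * (j : ℤ) + 1, 2 * (k : ℤ) + 1, 2 * (n : ℤ)] +
        h ![2 * (i : ℤ) + 1, 2 * (j : ℤ) + 1, 2 * (k : ℤ) + 1, 0]) := by
  have e : ∀ i j k l : ℕ,
      facetSum h ![2 * (i : ℤ) + 1, 2 * (j : ℤ) + 1, 2 * (k : ℤ) + 1, 2 * (l : ℤ) + 1] =
      (((h ![2 * (i : ℤ) + 1 + 1, 2 * (j : ℤ) + 1, 2 * (k : ℤ) + 1, 2 * (l : ℤ) + 1] +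
        h ![2 * (i : ℤ) + 1 - 1, 2 * (j : ℤ) + 1, 2 * (k : ℤ) + 1, 2 * (l : ℤ) + 1]) +
      (h ![2 * (i : ℤ) + 1, 2 * (j : ℤ) + 1 + 1, 2 * (k : ℤ) + 1, 2 * (l : ℤ) + 1] +
        h ![2 * (i : ℤ) + 1, 2 * (j : ℤ) + 1 - 1, 2 * (k : ℤ) + 1, 2 * (l : ℤ) + 1])) +
      (h ![2 * (i : ℤ) + 1, 2 * (j : ℤ) + 1, 2 * (k : ℤ) + 1 + 1, 2 * (l : ℤ) + 1] +
        h ![2 * (i : ℤ) + 1, 2 * (j : ℤ) + 1, 2 * (k : ℤ) + 1 - 1, 2 * (l : ℤ) + 1])) +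
      (h ![2 * (i : ℤ) + 1, 2 * (j : ℤ) + 1, 2 * (k : ℤ) + 1, 2 * (l : ℤ) + 1 + 1] +
        h ![2 * (i : ℤ) + 1, 2 * (j : ℤ) + 1, 2 * (k : ℤ) + 1, 2 * (l : ℤ) + 1 - 1]) := by
    intro i j k l
    simp only [facetSum_vec, odd_two_mul_add_one_int, if_true]
  simp only [e]
  rw [Finset.sum_congr rfl fun l _ => Finset.sum_congr rfl fun k _ =>
      Finset.sum_congr rfl fun i _ => Finset.sum_add_distrib,
    Finset.sum_congr rfl fun l _ => Finset.sum_congr rfl fun k _ => Finset.sum_add_distrib,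
    Finset.sum_congr rfl fun l _ => Finset.sum_add_distrib, Finset.sum_add_distrib]
  congr 1
  · refine Finset.sum_congr rfl fun l _ => ?_
    rw [Finset.sum_congr rfl fun k _ => Finset.sum_congr rfl fun i _ => Finset.sum_add_distrib,
      Finset.sum_congr rfl fun k _ => Finset.sum_add_distrib, Finset.sum_add_distrib]
    congr 1
    · refine Finset.sum_congr rfl fun k _ => ?_
      rw [Finset.sum_congr rfl fun i _ => Finset.sum_add_distrib, Finset.sum_add_distrib]
      congr 1
      · rw [Finset.sum_comm]
        exact Finset.sum_congr rfl fun j _ =>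
          sum_range_facets (fun x => h ![x, 2 * (j : ℤ) + 1, 2 * (k : ℤ) + 1, 2 * (l : ℤ) + 1]) n
      · exact Finset.sum_congr rfl fun i _ =>
          sum_range_facets (fun x => h ![2 * (i : ℤ) + 1, x, 2 * (k : ℤ) + 1, 2 * (l : ℤ) + 1]) n
    · rw [Finset.sum_comm]
      refine Finset.sum_congr rfl fun i _ => ?_
      rw [Finset.sum_comm]
      exact Finset.sum_congr rfl fun j _ =>
        sum_range_facets (fun x => h ![2 * (i : ℤ) + 1, 2 * (j : ℤ) + 1, x, 2 * (l : ℤ) + 1]) n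
  · rw [Finset.sum_comm]
    refine Finset.sum_congr rfl fun k _ => ?_
    rw [Finset.sum_comm]
    refine Finset.sum_congr rfl fun i _ => ?_
    rw [Finset.sum_comm]
    exact Finset.sum_congr rfl fun j _ =>
      sum_range_facets (fun x => h ![2 * (i : ℤ) + 1, 2 * (j : ℤ) + 1, 2 * (k : ℤ) + 1, x]) n

/-- The combinatorial core of the argument: a sign pattern on the lattice points of a box of side
`4 * K` with the symmetry and boundary behaviour listed cannot exist. -/
theorem false_of_sign_pattern (a : ℕ → (Fin 4 → ℤ) → ZMod 2) (K : ℕ) (M : ℤ) (hM : M = 4 * K)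
    (A : ℕ → ℤ → ZMod 2)
    (hG : ∀ i < 4, ∀ p q r, 0 ≤ p → p ≤ M → 0 ≤ q → q ≤ M → 0 ≤ r → r ≤ M →
      a i ![M - q, p, M - r, M] = a i ![p, q, r, 0] + 1)
    (h4 : ∀ p q r s, 0 ≤ p → p ≤ M → 0 ≤ q → q ≤ M → 0 ≤ r → r ≤ M → 0 ≤ s → s ≤ M →
      zeroParity a 4 ![p, q, r, s] = 0)
    (hD : ∀ j, 2 ≤ j → j < 4 → ∀ p q r s, 0 ≤ p → p ≤ M → 0 ≤ q → q ≤ M → 0 ≤ r → r ≤ M → 0 ≤ s →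
      s ≤ M → (p = 0 ∨ p = M ∨ q = 0 ∨ q = M) → zeroParity a j ![p, q, r, s] = 0)
    (hL : ∀ p q r s, 0 ≤ p → p ≤ M → 0 ≤ q → q ≤ M → 0 ≤ s → s ≤ M → (r = 0 ∨ r = M) →
      zeroParity a 3 ![p, q, r, s] = 0)
    (hL0 : ∀ p q, 0 ≤ p → p ≤ M → 0 ≤ q → q ≤ M → a 2 ![p, q, 0, 0] = 0)
    (hL1 : ∀ p q, 0 ≤ p → p ≤ M → 0 ≤ q → q ≤ M → a 2 ![p, q, M, 0] = 1)
    (hA : ∀ j < 2, ∀ m, A j (m + 2 * M) = A j m + 1)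
    (e1 : ∀ j < 2, ∀ p, 0 ≤ p → p ≤ M → a j ![p, 0, 2 * (K : ℤ), 0] = A j p)
    (e2 : ∀ j < 2, ∀ q, 0 ≤ q → q ≤ M → a j ![0, q, 2 * (K : ℤ), 0] = A j (-q))
    (e3 : ∀ j < 2, ∀ p, 0 ≤ p → p ≤ M → a j ![p, M, 2 * (K : ℤ), 0] = A j (-M - p))
    (e4 : ∀ j < 2, ∀ q, 0 ≤ q → q ≤ M → a j ![M, q, 2 * (K : ℤ), 0] = A j (-(3 * M) + q)) :
    False := by
  set n := 2 * K with hn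
  have hMn : M = 2 * (n : ℤ) := by rw [hM, hn]; push_cast; ring
  have hM0 : 0 ≤ M := by omega
  have hMe : Even M := ⟨n, by omega⟩
  have hO := odd_two_mul_add_one_int
  have hz : ¬ Odd (0 : ℤ) := by decide
  have b : ∀ i ∈ Finset.range n, 0 ≤ 2 * (i : ℤ) + 1 ∧ 2 * (i : ℤ) + 1 ≤ M := by
    intro i hi
    have := Finset.mem_range.mp hi
    omega
  have hn0 : (0 : ℤ) ≤ 2 * n := by omega
  have hn1 : (2 * n : ℤ) ≤ M := by omega
  -- the bottom layer carries no zeros of the first three functions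
  have s1 : ∑ k ∈ Finset.range n, ∑ i ∈ Finset.range n, ∑ j ∈ Finset.range n,
      zeroParity a 3 ![2 * (i : ℤ) + 1, 2 * (j : ℤ) + 1, 2 * (k : ℤ) + 1, 0] = 0 := by
    have t1 := sum_facetSum_hypercube (fun y => zeroParity a 3 y * a 3 y) n
    rw [show (∑ l ∈ Finset.range n, ∑ k ∈ Finset.range n, ∑ i ∈ Finset.range n,
      ∑ j ∈ Finset.range n, facetSum (fun y => zeroParity a 3 y * a 3 y)
        ![2 * (i : ℤ) + 1, 2 * (j : ℤ) + 1, 2 * (k : ℤ) + 1, 2 * (l : ℤ) + 1]) = 0 from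
      Finset.sum_eq_zero fun l hl => Finset.sum_eq_zero fun k hk =>
      Finset.sum_eq_zero fun i hi => Finset.sum_eq_zero fun j hj =>
      h4 _ _ _ _ (b i hi).1 (b i hi).2 (b j hj).1 (b j hj).2 (b k hk).1 (b k hk).2
        (b l hl).1 (b l hl).2] at t1
    rw [Finset.sum_eq_zero (s := Finset.range n) (f := fun l : ℕ => _ + _) fun l hl => ?_,
      zero_add] at t1
    swap
    · obtain ⟨l1, l2⟩ := b l hl
      rw [Finset.sum_eq_zero fun k hk => ?_, Finset.sum_eq_zero fun i hi =>
        Finset.sum_eq_zero fun j hj => ?_, add_zero]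
      · obtain ⟨i1, i2⟩ := b i hi
        obtain ⟨j1, j2⟩ := b j hj
        rw [hL _ _ _ _ i1 i2 j1 j2 l1 l2 (Or.inr hMn.symm), hL _ _ _ _ i1 i2 j1 j2 l1 l2 (Or.inl rfl)]
        simp
      · obtain ⟨k1, k2⟩ := b k hk
        rw [Finset.sum_eq_zero fun j hj => ?_, Finset.sum_eq_zero fun i hi => ?_, add_zero]
        · obtain ⟨i1, i2⟩ := b i hi
          rw [hD 3 (by norm_num) (by norm_num) _ _ _ _ i1 i2 hn0 hn1 k1 k2 l1 l2 (by simp [hMn]),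
            hD 3 (by norm_num) (by norm_num) _ _ _ _ i1 i2 le_rfl hM0 k1 k2 l1 l2 (by simp)]
          simp
        · obtain ⟨i1, i2⟩ := b j hj
          rw [hD 3 (by norm_num) (by norm_num) _ _ _ _ hn0 hn1 i1 i2 k1 k2 l1 l2 (by simp [hMn]),
            hD 3 (by norm_num) (by norm_num) _ _ _ _ le_rfl hM0 i1 i2 k1 k2 l1 l2 (by simp)]
          simp
    have t2 : ∑ k ∈ Finset.range n, ∑ i ∈ Finset.range n, ∑ j ∈ Finset.range n,
        zeroParity a 3 ![2 * (i : ℤ) + 1, 2 * (j : ℤ) + 1, 2 * (k : ℤ) + 1, 2 * (n : ℤ)] *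
          a 3 ![2 * (i : ℤ) + 1, 2 * (j : ℤ) + 1, 2 * (k : ℤ) + 1, 2 * (n : ℤ)] =
        ∑ k ∈ Finset.range n, ∑ i ∈ Finset.range n, ∑ j ∈ Finset.range n,
        zeroParity a 3 ![2 * (i : ℤ) + 1, 2 * (j : ℤ) + 1, 2 * (k : ℤ) + 1, 0] *
          (a 3 ![2 * (i : ℤ) + 1, 2 * (j : ℤ) + 1, 2 * (k : ℤ) + 1, 0] + 1) := by
      rw [← sum_range_odd_reflect (fun x => ∑ i ∈ Finset.range n, ∑ j ∈ Finset.range n,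
        zeroParity a 3 ![2 * (i : ℤ) + 1, 2 * (j : ℤ) + 1, x, 2 * (n : ℤ)] *
          a 3 ![2 * (i : ℤ) + 1, 2 * (j : ℤ) + 1, x, 2 * (n : ℤ)])]
      refine Finset.sum_congr rfl fun k hk => ?_
      rw [← sum_range_odd_reflect (fun x => ∑ j ∈ Finset.range n,
        zeroParity a 3 ![x, 2 * (j : ℤ) + 1, 2 * n - (2 * (k : ℤ) + 1), 2 * (n : ℤ)] *
          a 3 ![x, 2 * (j : ℤ) + 1, 2 * n - (2 * (k : ℤ) + 1), 2 * (n : ℤ)]), Finset.sum_comm]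
      refine Finset.sum_congr rfl fun i hi => Finset.sum_congr rfl fun j hj => ?_
      obtain ⟨i1, i2⟩ := b i hi
      obtain ⟨j1, j2⟩ := b j hj
      obtain ⟨k1, k2⟩ := b k hk
      rw [← hMn, zeroParity_comp a M hMe 3 (fun i hi => hG i (by omega)) _ _ _ i1 i2 j1 j2 k1 k2,
        hG 3 (by norm_num) _ _ _ i1 i2 j1 j2 k1 k2]
    simp only [Finset.sum_add_distrib] at t1
    rw [t2] at t1
    simp only [mul_add, mul_one, Finset.sum_add_distrib] at t1
    set u := ∑ k ∈ Finset.range n, ∑ i ∈ Finset.range n, ∑ j ∈ Finset.range n,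
      zeroParity a 3 ![2 * (i : ℤ) + 1, 2 * (j : ℤ) + 1, 2 * (k : ℤ) + 1, 0] *
        a 3 ![2 * (i : ℤ) + 1, 2 * (j : ℤ) + 1, 2 * (k : ℤ) + 1, 0] with hu
    have := CharTwo.add_self_eq_zero u
    linear_combination -t1 - this
  set T : ℤ → ZMod 2 := fun r => ∑ i ∈ Finset.range n, ∑ j ∈ Finset.range n,
    zeroParity a 2 ![2 * (i : ℤ) + 1, 2 * (j : ℤ) + 1, r, 0] with hT
  have hD2 : ∀ r, 0 ≤ r → r ≤ M → ∀ h : (Fin 4 → ℤ) → ZMod 2,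
      (∑ j ∈ Finset.range n,
        (zeroParity a 2 ![2 * (n : ℤ), 2 * (j : ℤ) + 1, r, 0] * h ![2 * (n : ℤ), 2 * (j : ℤ) + 1, r, 0] +
        zeroParity a 2 ![0, 2 * (j : ℤ) + 1, r, 0] * h ![0, 2 * (j : ℤ) + 1, r, 0]) = 0) ∧
      ∑ i ∈ Finset.range n,
        (zeroParity a 2 ![2 * (i : ℤ) + 1, 2 * (n : ℤ), r, 0] * h ![2 * (i : ℤ) + 1, 2 * (n : ℤ), r, 0] +
        zeroParity a 2 ![2 * (i : ℤ) + 1, 0, r, 0] * h ![2 * (i : ℤ) + 1, 0, r, 0]) = 0 := by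
    intro r r1 r2 h
    constructor
    · refine Finset.sum_eq_zero fun j hj => ?_
      obtain ⟨i1, i2⟩ := b j hj
      rw [hD 2 le_rfl (by norm_num) _ _ _ _ hn0 hn1 i1 i2 r1 r2 le_rfl hM0 (by simp [hMn]),
        hD 2 le_rfl (by norm_num) _ _ _ _ le_rfl hM0 i1 i2 r1 r2 le_rfl hM0 (by simp)]
      simp
    · refine Finset.sum_eq_zero fun i hi => ?_
      obtain ⟨i1, i2⟩ := b i hi
      rw [hD 2 le_rfl (by norm_num) _ _ _ _ i1 i2 hn0 hn1 r1 r2 le_rfl hM0 (by simp [hMn]),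
        hD 2 le_rfl (by norm_num) _ _ _ _ i1 i2 le_rfl hM0 r1 r2 le_rfl hM0 (by simp)]
      simp
  have s2 : T (2 * n) = 0 := by
    have t1 := sum_facetSum_cube (fun y => zeroParity a 2 y * a 2 y) n 0 hz
    rw [show (∑ k ∈ Finset.range n, ∑ i ∈ Finset.range n, ∑ j ∈ Finset.range n,
      facetSum (fun y => zeroParity a 2 y * a 2 y)
        ![2 * (i : ℤ) + 1, 2 * (j : ℤ) + 1, 2 * (k : ℤ) + 1, 0]) = 0 from s1,
      Finset.sum_eq_zero (s := Finset.range n) (f := fun k : ℕ => _ + _) fun k hk => ?_, zero_add] at t1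
    · rw [hT, t1]
      refine Finset.sum_congr rfl fun i hi => Finset.sum_congr rfl fun j hj => ?_
      obtain ⟨i1, i2⟩ := b i hi
      obtain ⟨j1, j2⟩ := b j hj
      rw [← hMn, hL0 _ _ i1 i2 j1 j2, hL1 _ _ i1 i2 j1 j2]
      simp
    · obtain ⟨k1, k2⟩ := b k hk
      rw [(hD2 _ k1 k2 (a 2)).1, (hD2 _ k1 k2 (a 2)).2, add_zero]
  have s3 : ∀ k : ℕ, k ≤ n → T (2 * k) = T 0 := by
    intro k
    induction k with
    | zero => simp
    | succ k ih =>
      intro hk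
      rw [← ih (by omega)]
      obtain ⟨k1, k2⟩ := b k (Finset.mem_range.mpr (by omega))
      have t1 : ∑ i ∈ Finset.range n, ∑ j ∈ Finset.range n,
          (((zeroParity a 2 ![2 * (i : ℤ) + 1 + 1, 2 * (j : ℤ) + 1, 2 * (k : ℤ) + 1, 0] +
          zeroParity a 2 ![2 * (i : ℤ) + 1 - 1, 2 * (j : ℤ) + 1, 2 * (k : ℤ) + 1, 0]) +
          (zeroParity a 2 ![2 * (i : ℤ) + 1, 2 * (j : ℤ) + 1 + 1, 2 * (k : ℤ) + 1, 0] +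
          zeroParity a 2 ![2 * (i : ℤ) + 1, 2 * (j : ℤ) + 1 - 1, 2 * (k : ℤ) + 1, 0])) +
          (zeroParity a 2 ![2 * (i : ℤ) + 1, 2 * (j : ℤ) + 1, 2 * (k : ℤ) + 1 + 1, 0] +
          zeroParity a 2 ![2 * (i : ℤ) + 1, 2 * (j : ℤ) + 1, 2 * (k : ℤ) + 1 - 1, 0])) = 0 := by
        refine Finset.sum_eq_zero fun i _ => Finset.sum_eq_zero fun j _ => ?_
        have := facetSum_zeroParity a 2 ![2 * (i : ℤ) + 1, 2 * (j : ℤ) + 1, 2 * (k : ℤ) + 1, 0]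
        simpa only [facetSum_vec, hO, hz, if_true, if_false, add_zero] using this
      rw [Finset.sum_congr rfl fun i _ => Finset.sum_add_distrib, Finset.sum_add_distrib,
        Finset.sum_congr rfl fun i _ => Finset.sum_add_distrib, Finset.sum_add_distrib] at t1
      have t2 := (hD2 _ k1 k2 1).1
      have t3 := (hD2 _ k1 k2 1).2
      simp only [Pi.one_apply, mul_one] at t2 t3
      rw [Finset.sum_comm, Finset.sum_congr rfl fun (j : ℕ) _ => sum_range_facets (fun x =>
        zeroParity a 2 ![x, 2 * (j : ℤ) + 1, 2 * (k : ℤ) + 1, 0]) n, t2,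
        Finset.sum_congr rfl fun (i : ℕ) _ => sum_range_facets (fun x =>
        zeroParity a 2 ![2 * (i : ℤ) + 1, x, 2 * (k : ℤ) + 1, 0]) n, t3, add_zero, zero_add,
        show 2 * (k : ℤ) + 1 + 1 = 2 * ((k + 1 : ℕ) : ℤ) by push_cast; ring,
        show 2 * (k : ℤ) + 1 - 1 = 2 * (k : ℤ) by ring] at t1
      simp only [Finset.sum_add_distrib] at t1
      exact CharTwo.add_eq_zero.mp t1
  have s4 : T (2 * K) = 0 := by
    rw [s3 K (by omega), ← s3 n le_rfl, s2]
  have hK : ¬ Odd (2 * (K : ℤ)) := by simp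
  have t := sum_facetSum_square (fun y => zeroParity a 1 y * a 1 y) n (2 * (K : ℤ)) 0 hK hz
  rw [show (∑ i ∈ Finset.range n, ∑ j ∈ Finset.range n,
      facetSum (fun y => zeroParity a 1 y * a 1 y)
        ![2 * (i : ℤ) + 1, 2 * (j : ℤ) + 1, 2 * (K : ℤ), 0]) = 0 from s4] at t
  have S1 : ∀ x, zeroParity a 1 x = facetSum (a 0) x := by
    intro x
    simp [zeroParity]
  have hno : ¬ Odd M := by grind
  set E : ℤ → ZMod 2 := fun m => (A 0 (m + 1) + A 0 (m - 1)) * A 1 m with hE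
  have E1 : ∀ i ∈ Finset.range n, zeroParity a 1 ![2 * (i : ℤ) + 1, 0, 2 * (K : ℤ), 0] *
      a 1 ![2 * (i : ℤ) + 1, 0, 2 * (K : ℤ), 0] = E (2 * (i : ℤ) + 1) := by
    intro i hi
    obtain ⟨i1, i2⟩ := b i hi
    have := Finset.mem_range.mp hi
    rw [S1, facetSum_vec]
    simp only [hO, hz, hK, if_true, if_false, add_zero]
    rw [e1 0 (by norm_num) _ (by omega) (by omega), e1 0 (by norm_num) _ (by omega) (by omega),
      e1 1 (by norm_num) _ (by omega) (by omega)]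
  have E2 : ∀ i ∈ Finset.range n, zeroParity a 1 ![0, 2 * (i : ℤ) + 1, 2 * (K : ℤ), 0] *
      a 1 ![0, 2 * (i : ℤ) + 1, 2 * (K : ℤ), 0] = E (-(2 * (i : ℤ) + 1)) := by
    intro i hi
    obtain ⟨i1, i2⟩ := b i hi
    have := Finset.mem_range.mp hi
    rw [S1, facetSum_vec]
    simp only [hO, hz, hK, if_true, if_false, add_zero, zero_add]
    rw [e2 0 (by norm_num) _ (by omega) (by omega), e2 0 (by norm_num) _ (by omega) (by omega),
      e2 1 (by norm_num) _ (by omega) (by omega)]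
    simp only [hE]
    ring_nf
  have E3 : ∀ i ∈ Finset.range n, zeroParity a 1 ![2 * (i : ℤ) + 1, 2 * (n : ℤ), 2 * (K : ℤ), 0] *
      a 1 ![2 * (i : ℤ) + 1, 2 * (n : ℤ), 2 * (K : ℤ), 0] = E (-M - (2 * (i : ℤ) + 1)) := by
    intro i hi
    obtain ⟨i1, i2⟩ := b i hi
    have := Finset.mem_range.mp hi
    rw [S1, facetSum_vec, ← hMn]
    simp only [hO, hz, hK, hno, if_true, if_false, add_zero]
    rw [e3 0 (by norm_num) _ (by omega) (by omega), e3 0 (by norm_num) _ (by omega) (by omega),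
      e3 1 (by norm_num) _ (by omega) (by omega)]
    simp only [hE]
    ring_nf
  have E4 : ∀ i ∈ Finset.range n, zeroParity a 1 ![2 * (n : ℤ), 2 * (i : ℤ) + 1, 2 * (K : ℤ), 0] *
      a 1 ![2 * (n : ℤ), 2 * (i : ℤ) + 1, 2 * (K : ℤ), 0] = E (-(3 * M) + (2 * (i : ℤ) + 1)) := by
    intro i hi
    obtain ⟨i1, i2⟩ := b i hi
    have := Finset.mem_range.mp hi
    rw [S1, facetSum_vec, ← hMn]
    simp only [hO, hz, hK, hno, if_true, if_false, add_zero, zero_add]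
    rw [e4 0 (by norm_num) _ (by omega) (by omega), e4 0 (by norm_num) _ (by omega) (by omega),
      e4 1 (by norm_num) _ (by omega) (by omega)]
    simp only [hE]
    ring_nf
  simp only [Finset.sum_add_distrib] at t
  rw [Finset.sum_congr rfl E1, Finset.sum_congr rfl E2, Finset.sum_congr rfl E3,
    Finset.sum_congr rfl E4, ← sum_range_odd_reflect (fun x => E (-M - x)),
    ← sum_range_odd_reflect (fun x => E (-(3 * M) + x)), ← hMn] at t
  have hE2 : ∀ m, E m + E (m - 2 * M) = A 0 (m - 2 * M + 1) + A 0 (m - 2 * M - 1) := by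
    intro m
    have c1 := hA 1 (by norm_num) (m - 2 * M)
    have c2 := hA 0 (by norm_num) (m - 2 * M + 1)
    have c3 := hA 0 (by norm_num) (m - 2 * M - 1)
    have d := CharTwo.add_self_eq_zero (1 : ZMod 2)
    rw [sub_add_cancel] at c1
    rw [show m - 2 * M + 1 + 2 * M = m + 1 by ring] at c2
    rw [show m - 2 * M - 1 + 2 * M = m - 1 by ring] at c3
    simp only [hE]
    rw [c1, c2, c3]
    have d' := CharTwo.add_self_eq_zero ((A 0 (m - 2 * M + 1) + A 0 (m - 2 * M - 1)) * A 1 (m - 2 * M))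
    linear_combination d' + d * A 1 (m - 2 * M) + d
  have t' : ∑ i ∈ Finset.range n, ((A 0 (-(2 * M) + (2 * (i : ℤ) + 1 + 1)) +
      A 0 (-(2 * M) + (2 * (i : ℤ) + 1 - 1))) + (A 0 (-(2 * M) - (2 * (i : ℤ) + 1 + 1)) +
      A 0 (-(2 * M) - (2 * (i : ℤ) + 1 - 1)))) = 0 := by
    rw [t]
    simp only [← Finset.sum_add_distrib]
    refine Finset.sum_congr rfl fun i _ => ?_
    have c1 := hE2 (2 * (i : ℤ) + 1)
    have c2 := hE2 (-(2 * (i : ℤ) + 1))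
    ring_nf at c1 c2 ⊢
    linear_combination -c1 - c2
  rw [Finset.sum_add_distrib, sum_range_facets (fun x => A 0 (-(2 * M) + x)),
    sum_range_facets (fun x => A 0 (-(2 * M) - x)), ← hMn] at t'
  have c := hA 0 (by norm_num) (-(3 * M))
  rw [show -(2 * M) - M = -(3 * M) by ring] at t'
  rw [show -(3 * M) + 2 * M = -(2 * M) + M by ring] at c
  rw [c, add_zero, sub_zero] at t'
  have c1 := CharTwo.add_self_eq_zero (A 0 (-(3 * M)))
  have c2 := CharTwo.add_self_eq_zero (A 0 (-(2 * M)))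
  exact one_ne_zero (α := ZMod 2) (by linear_combination t' - c1 - c2)

/-- Sign bit of the `j`-th entry of `w`; for `j < 2` ties are broken by the other one of the first
two entries. -/
def SignBit (j : ℕ) (w : ℕ → ℝ) : Prop := w j < 0 ∨ (w j = 0 ∧ j < 2 ∧ w (1 - j) < 0)

theorem SignBit.nonpos {j : ℕ} {w : ℕ → ℝ} (h : SignBit j w) : w j ≤ 0 := by
  rcases h with h | h
  · exact h.le
  · exact h.1.le

theorem nonneg_of_not_signBit {j : ℕ} {w : ℕ → ℝ} (h : ¬ SignBit j w) : 0 ≤ w j := by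
  by_contra hc
  exact h (Or.inl (not_le.mp hc))

theorem signBit_neg {j : ℕ} (hj : j < 2) {w : ℕ → ℝ} (h : w 0 ≠ 0 ∨ w 1 ≠ 0) :
    SignBit j (-w) ↔ ¬ SignBit j w := by
  unfold SignBit
  interval_cases j
  · rcases lt_trichotomy (w 0) 0 with h0 | h0 | h0 <;>
      rcases lt_trichotomy (w 1) 0 with h1 | h1 | h1 <;> simp_all [le_of_lt, ne_of_gt]
  · rcases lt_trichotomy (w 0) 0 with h0 | h0 | h0 <;>
      rcases lt_trichotomy (w 1) 0 with h1 | h1 | h1 <;> simp_all [le_of_lt, ne_of_gt]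

theorem IsCompact.exists_pos_le {X : Type*} [TopologicalSpace X] {s : Set X} (hs : IsCompact s)
    {g : X → ℝ} (hg : Continuous g) (h : ∀ y ∈ s, 0 < g y) : ∃ δ > 0, ∀ y ∈ s, δ ≤ g y := by
  rcases s.eq_empty_or_nonempty with rfl | hne
  · exact ⟨1, one_pos, by simp⟩
  · obtain ⟨y, hy, hmin⟩ := hs.exists_isMinOn hne hg.continuousOn
    exact ⟨g y, h y hy, fun z hz => hmin hz⟩

open Classical in
/-- The sign pattern on the lattice points of the box of side `M` of the functions `f j`, the point
`x` standing for `x / M`; on the top layer ties are broken the opposite way. -/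
def signPattern (f : ℕ → (Fin 4 → ℝ) → ℝ) (M : ℤ) (j : ℕ) (x : Fin 4 → ℤ) : ZMod 2 :=
  if x 3 < M then if SignBit j (fun i => f i fun l => x l / M) then 1 else 0
  else if SignBit j (-fun i => f i fun l => x l / M) then 0 else 1

theorem signPattern_ne {f : ℕ → (Fin 4 → ℝ) → ℝ} {M : ℤ} {j : ℕ} {x y : Fin 4 → ℤ}
    (h : signPattern f M j x ≠ signPattern f M j y) :
    (f j (fun l => x l / M) ≤ 0 ∧ 0 ≤ f j (fun l => y l / M)) ∨
      (0 ≤ f j (fun l => x l / M) ∧ f j (fun l => y l / M) ≤ 0) := by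
  have k1 : ∀ x, signPattern f M j x = 1 → f j (fun l => x l / M) ≤ 0 := by
    intro x hx
    unfold signPattern at hx
    split_ifs at hx with h1 h2 h2
    · exact h2.nonpos
    · simp at hx
    · simp at hx
    · have := nonneg_of_not_signBit h2
      simpa using this
  have k0 : ∀ x, signPattern f M j x = 0 → 0 ≤ f j (fun l => x l / M) := by
    intro x hx
    unfold signPattern at hx
    split_ifs at hx with h1 h2 h2
    · simp at hx
    · exact nonneg_of_not_signBit h2
    · have := h2.nonpos
      simpa using this
    · simp at hx
  have c : ∀ t : ZMod 2, t = 0 ∨ t = 1 := by decide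
  rcases c (signPattern f M j x) with hx | hx <;> rcases c (signPattern f M j y) with hy | hy
  · exact absurd (hx.trans hy.symm) h
  · exact Or.inr ⟨k0 _ hx, k1 _ hy⟩
  · exact Or.inl ⟨k1 _ hx, k0 _ hy⟩
  · exact absurd (hx.trans hy.symm) h

/-- A common zero theorem for four functions on the cube that are odd under the gluing
`(y₀, y₁, y₂, 0) ↦ (1 - y₁, y₀, 1 - y₂, 1)` of its bottom to its top. -/
theorem exists_common_zero (f : ℕ → (Fin 4 → ℝ) → ℝ) (hf : ∀ i, Continuous (f i))
    (hg : ∀ i < 4, ∀ y₀ y₁ y₂ y₃, f i ![1 - y₁, y₀, 1 - y₂, y₃ + 1] = -f i ![y₀, y₁, y₂, y₃])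
    (hpos : ∀ y ∈ Set.Icc (0 : Fin 4 → ℝ) 1, y 2 = 0 → 0 < f 2 y)
    (hneg : ∀ y ∈ Set.Icc (0 : Fin 4 → ℝ) 1, y 2 = 1 → f 2 y < 0)
    (hD : ∀ y ∈ Set.Icc (0 : Fin 4 → ℝ) 1, (y 0 = 0 ∨ y 0 = 1 ∨ y 1 = 0 ∨ y 1 = 1) →
      f 0 y ≠ 0 ∨ f 1 y ≠ 0)
    (U : ℕ → ℝ → ℝ) (hU : ∀ j < 2, ∀ m, U j (m + 2) = -U j m)
    (e1 : ∀ j < 2, ∀ p, f j ![p, 0, 1 / 2, 0] = U j p)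
    (e2 : ∀ j < 2, ∀ q, f j ![0, q, 1 / 2, 0] = U j (-q))
    (e3 : ∀ j < 2, ∀ p, f j ![p, 1, 1 / 2, 0] = U j (-1 - p))
    (e4 : ∀ j < 2, ∀ q, f j ![1, q, 1 / 2, 0] = U j (-3 + q)) :
    ∃ y ∈ Set.Icc (0 : Fin 4 → ℝ) 1, ∀ i < 4, f i y = 0 := by
  by_contra! hcon
  have hc : IsCompact (Set.Icc (0 : Fin 4 → ℝ) 1) := isCompact_Icc
  obtain ⟨δ1, hδ1, hb1⟩ := hc.exists_pos_le
    (g := fun y => ∑ i : Fin 4, |f i y|) (by fun_prop) (by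
      intro y hy
      obtain ⟨i, hi, h⟩ := hcon y hy
      exact Finset.sum_pos' (fun _ _ => abs_nonneg _) ⟨⟨i, hi⟩, Finset.mem_univ _, abs_pos.mpr h⟩)
  obtain ⟨δ2, hδ2, hb2⟩ := (hc.inter_right (t := {y | y 0 = 0 ∨ y 0 = 1 ∨ y 1 = 0 ∨ y 1 = 1})
    (by
      refine IsClosed.union (isClosed_eq ?_ ?_) (IsClosed.union (isClosed_eq ?_ ?_)
        (IsClosed.union (isClosed_eq ?_ ?_) (isClosed_eq ?_ ?_))) <;> fun_prop)).exists_pos_le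
    (g := fun y => |f 0 y| + |f 1 y|) (by fun_prop) (by
      intro y hy
      rcases hD y hy.1 hy.2 with h | h
      · have := abs_pos.mpr h
        positivity
      · have := abs_pos.mpr h
        positivity)
  obtain ⟨δ3, hδ3, hb3⟩ := (hc.inter_right (t := {y | y 2 = 0 ∨ y 2 = 1})
    (by refine IsClosed.union (isClosed_eq ?_ ?_) (isClosed_eq ?_ ?_) <;> fun_prop)).exists_pos_le
    (g := fun y => |f 2 y|) (by fun_prop) (by
      intro y hy
      rcases hy.2 with h | h
      · exact abs_pos.mpr (hpos y hy.1 h).ne'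
      · exact abs_pos.mpr (hneg y hy.1 h).ne)
  obtain ⟨δ, hδ, h1, h2, h3⟩ : ∃ δ > 0, 4 * δ ≤ δ1 ∧ 4 * δ ≤ δ2 ∧ 4 * δ ≤ δ3 :=
    ⟨min δ1 (min δ2 δ3) / 4, by positivity, by
      have := min_le_left δ1 (min δ2 δ3); linarith, by
      have := (min_le_right δ1 (min δ2 δ3)).trans (min_le_left _ _); linarith, by
      have := (min_le_right δ1 (min δ2 δ3)).trans (min_le_right _ _); linarith⟩
  have huc := hc.uniformContinuousOn_of_continuous
    (f := fun (y : Fin 4 → ℝ) (i : Fin 4) => f i y) (by fun_prop)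
  obtain ⟨η, hη, hηδ⟩ := Metric.uniformContinuousOn_iff.mp huc δ hδ
  obtain ⟨K, hK⟩ := exists_nat_gt (1 / η)
  have hK0 : 0 < K := by
    have : (0 : ℝ) < K := lt_trans (by positivity) hK
    exact_mod_cast this
  set M : ℤ := 4 * K with hM
  have hM0 : 0 < M := by omega
  have hMR : (0 : ℝ) < M := by exact_mod_cast hM0
  have hMe : Even M := ⟨2 * K, by omega⟩
  have hMη : 4 / (M : ℝ) < η := by
    rw [div_lt_iff₀ hMR]
    rw [div_lt_iff₀ hη] at hK
    push_cast [hM]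
    linarith
  set pt : (Fin 4 → ℤ) → Fin 4 → ℝ := fun x l => x l / M with hpt
  have hmem : ∀ x : Fin 4 → ℤ, (∀ l, 0 ≤ x l ∧ x l ≤ M) → pt x ∈ Set.Icc (0 : Fin 4 → ℝ) 1 := by
    intro x hx
    refine ⟨fun l => ?_, fun l => ?_⟩
    · have : (0 : ℝ) ≤ x l := by exact_mod_cast (hx l).1
      exact div_nonneg this hMR.le
    · have : (x l : ℝ) ≤ M := by exact_mod_cast (hx l).2
      exact (div_le_one hMR).mpr this
  set a := signPattern f M with ha
  have hsmall : ∀ j ≤ 4, ∀ x : Fin 4 → ℤ, (∀ l, 0 ≤ x l ∧ x l ≤ M) → zeroParity a j x ≠ 0 →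
      ∀ i < j, |f i (pt x)| < δ := by
    intro j hj x hx hS i hi
    obtain ⟨y, y', hy, hy', hne⟩ := exists_sign_change a M hMe j x hx hS i hi
    have hd : ∀ y : Fin 4 → ℤ, (∀ l, 0 ≤ y l ∧ y l ≤ M ∧ |y l - x l| ≤ j) →
        |f i (pt y) - f i (pt x)| < δ := by
      intro y hy
      have hdist : dist (pt y) (pt x) < η := by
        refine lt_of_le_of_lt ((dist_pi_le_iff (by positivity)).mpr fun l => ?_) hMη
        rw [Real.dist_eq, hpt]
        simp only
        rw [← sub_div, abs_div, abs_of_pos hMR]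
        gcongr
        have := (hy l).2.2
        have : |y l - x l| ≤ 4 := by omega
        exact_mod_cast this
      have := hηδ _ (hmem y fun l => ⟨(hy l).1, (hy l).2.1⟩) _ (hmem x hx) hdist
      have := lt_of_le_of_lt (dist_le_pi_dist _ _ (⟨i, by omega⟩ : Fin 4)) this
      rwa [Real.dist_eq] at this
    have d1 := abs_lt.mp (hd y hy)
    have d2 := abs_lt.mp (hd y' hy')
    rw [abs_lt]
    rcases signPattern_ne hne with ⟨c1, c2⟩ | ⟨c1, c2⟩
    · constructor <;> linarith [d1.1, d1.2, d2.1, d2.2]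
    · constructor <;> linarith [d1.1, d1.2, d2.1, d2.2]
  have hbox : ∀ p q r s : ℤ, 0 ≤ p → p ≤ M → 0 ≤ q → q ≤ M → 0 ≤ r → r ≤ M → 0 ≤ s → s ≤ M →
      ∀ l, 0 ≤ (![p, q, r, s] : Fin 4 → ℤ) l ∧ (![p, q, r, s] : Fin 4 → ℤ) l ≤ M := by
    intro p q r s _ _ _ _ _ _ _ _ l
    fin_cases l <;> constructor <;> assumption
  have hptv : ∀ p q r s : ℤ, pt ![p, q, r, s] = ![(p : ℝ) / M, q / M, r / M, s / M] := by
    intro p q r s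
    ext l
    fin_cases l <;> rfl
  have hUne : ∀ m : ℝ, U 0 m ≠ 0 ∨ U 1 m ≠ 0 := by
    have hper : Function.Periodic (fun m => U 0 m ≠ 0 ∨ U 1 m ≠ 0) 2 := by
      intro m
      simp only [hU 0 (by norm_num), hU 1 (by norm_num), neg_ne_zero]
    intro m
    obtain ⟨y, ⟨hy1, hy2⟩, hy⟩ := hper.exists_mem_Ico (by norm_num) m (-1)
    rw [eq_iff_iff] at hy
    rw [hy]
    rcases le_total 0 y with h | h
    · rw [← e1 0 (by norm_num), ← e1 1 (by norm_num)]
      refine hD _ ⟨fun l => ?_, fun l => ?_⟩ (by simp)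
      · fin_cases l <;> simp [h]
      · fin_cases l <;> simp <;> linarith
    · rw [← neg_neg y, ← e2 0 (by norm_num), ← e2 1 (by norm_num)]
      refine hD _ ⟨fun l => ?_, fun l => ?_⟩ (by simp)
      · fin_cases l <;> simp [h]
      · fin_cases l <;> simp <;> linarith
  classical
  have ha0 : ∀ j p q r, a j ![p, q, r, 0] =
      if SignBit j (fun i => f i (pt ![p, q, r, 0])) then 1 else 0 := by
    intro j p q r
    rw [ha, signPattern, if_pos (by simpa using hM0)]
  have hK2 : (((2 * (K : ℤ) : ℤ) : ℝ)) / M = 1 / 2 := by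
    have : (K : ℝ) ≠ 0 := by positivity
    push_cast [hM]
    field_simp
    norm_num
  have hMM : (M : ℝ) / M = 1 := div_self hMR.ne'
  have hbit : ∀ j < 2, ∀ w w' : ℕ → ℝ, (∀ i < 2, w i = w' i) → (SignBit j w ↔ SignBit j w') := by
    intro j hj w w' h
    unfold SignBit
    rw [h j hj, h (1 - j) (by omega)]
  refine false_of_sign_pattern a K M hM
    (fun j m => if SignBit j (fun i => U i (m / M)) then 1 else 0)
    ?_ ?_ ?_ ?_ ?_ ?_ ?_ ?_ ?_ ?_ ?_
  · intro i hi p q r hp hp' hq hq' hr hr'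
    rw [ha0, ha, signPattern, if_neg (by simp)]
    have e : ∀ i < 4, (-fun i => f i fun l => ((![M - q, p, M - r, M] : Fin 4 → ℤ) l : ℝ) / M) i =
        f i (pt ![p, q, r, 0]) := by
      intro i hi
      have e' : (fun l => ((![M - q, p, M - r, M] : Fin 4 → ℤ) l : ℝ) / M) =
          ![1 - (q : ℝ) / M, p / M, 1 - r / M, 0 + 1] := by
        change pt _ = _
        rw [hptv]
        push_cast
        rw [sub_div, sub_div, hMM, zero_add]
      rw [Pi.neg_apply, e', hg i hi, neg_neg, hptv]
      simp
    have eb : SignBit i (-fun i => f i fun l => ((![M - q, p, M - r, M] : Fin 4 → ℤ) l : ℝ) / M) ↔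
        SignBit i (fun i => f i (pt ![p, q, r, 0])) := by
      unfold SignBit
      rw [e i hi, e (1 - i) (by omega)]
    simp only [eb]
    split_ifs
    · exact (CharTwo.add_self_eq_zero _).symm
    · simp
  · intro p q r s p1 p2 q1 q2 r1 r2 s1 s2
    by_contra hne
    have hx := hbox p q r s p1 p2 q1 q2 r1 r2 s1 s2
    have hs := hsmall 4 le_rfl _ hx hne
    have := hb1 _ (hmem _ hx)
    simp only [Fin.sum_univ_four] at this
    have s0 := hs 0 (by norm_num)
    have s1 := hs 1 (by norm_num)
    have s2 := hs 2 (by norm_num)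
    have s3 := hs 3 (by norm_num)
    simp at this
    linarith
  · intro j hj hj4 p q r s p1 p2 q1 q2 r1 r2 s1 s2 hface
    by_contra hne
    have hx := hbox p q r s p1 p2 q1 q2 r1 r2 s1 s2
    have hs := hsmall j hj4.le _ hx hne
    have := hb2 _ ⟨hmem _ hx, by
      rw [hptv]
      rcases hface with rfl | rfl | rfl | rfl <;> simp [hMM]⟩
    have s0 := hs 0 (by omega)
    have s1 := hs 1 (by omega)
    linarith
  · intro p q r s p1 p2 q1 q2 s1 s2 hface
    by_contra hne
    have hx := hbox p q r s p1 p2 q1 q2 (by omega) (by omega) s1 s2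
    have hs := hsmall 3 (by norm_num) _ hx hne
    have := hb3 _ ⟨hmem _ hx, by
      rw [hptv]
      rcases hface with rfl | rfl <;> simp [hMM]⟩
    have s0 := hs 2 (by omega)
    linarith
  · intro p q p1 p2 q1 q2
    have := hpos _ (hmem _ (hbox p q 0 0 p1 p2 q1 q2 le_rfl hM0.le le_rfl hM0.le)) (by simp [hptv])
    rw [ha0, if_neg]
    rintro (h | h)
    · linarith
    · exact absurd h.2.1 (by norm_num)
  · intro p q p1 p2 q1 q2
    have := hneg _ (hmem _ (hbox p q M 0 p1 p2 q1 q2 hM0.le le_rfl le_rfl hM0.le))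
      (by simp [hptv, hMM])
    rw [ha0, if_pos]
    exact Or.inl this
  · intro j hj m
    have : ∀ i < 2, U i (((m + 2 * M : ℤ) : ℝ) / M) = (-fun i => U i (m / M)) i := by
      intro i hi
      rw [Pi.neg_apply, ← hU i hi]
      congr 1
      push_cast
      field_simp
    rw [hbit j hj _ _ this, signBit_neg hj (hUne _)]
    split_ifs
    · exact (CharTwo.add_self_eq_zero _).symm
    · simp
  · intro j hj p p1 p2
    rw [ha0, hptv, hK2]
    simp only [Int.cast_zero, zero_div]
    rw [hbit j hj _ _ fun i hi => e1 i hi _]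
  · intro j hj q p1 p2
    rw [ha0, hptv, hK2]
    simp only [Int.cast_zero, zero_div]
    rw [hbit j hj _ _ fun i hi => e2 i hi _]
    simp [neg_div]
  · intro j hj p p1 p2
    rw [ha0, hptv, hK2, hMM]
    simp only [Int.cast_zero, zero_div]
    rw [hbit j hj _ _ fun i hi => e3 i hi _]
    have : (((-M - p : ℤ) : ℝ)) / M = -1 - p / M := by push_cast; field_simp
    rw [this]
  · intro j hj q p1 p2
    rw [ha0, hptv, hK2, hMM]
    simp only [Int.cast_zero, zero_div]
    rw [hbit j hj _ _ fun i hi => e4 i hi _]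
    have : (((-(3 * M) + q : ℤ) : ℝ)) / M = -3 + q / M := by push_cast; field_simp
    rw [this]

/-- The perturbation term: positive near `0`, negative near `1`, zero in between. -/
def endCutoff (ε A : ℝ) : ℝ := max 0 (ε - A) - max 0 (ε - (1 - A))

theorem endCutoff_one_sub (ε A : ℝ) : endCutoff ε (1 - A) = -endCutoff ε A := by
  simp [endCutoff]

theorem endCutoff_pos {ε A : ℝ} (hε : ε ≤ 1 / 4) (hA : A < ε) : 0 < endCutoff ε A := by
  unfold endCutoff
  rw [max_eq_right (by linarith), max_eq_left (by linarith)]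
  linarith

theorem endCutoff_neg {ε A : ℝ} (hε : ε ≤ 1 / 4) (hA : 1 - ε < A) : endCutoff ε A < 0 := by
  unfold endCutoff
  rw [max_eq_left (by linarith), max_eq_right (by linarith)]
  linarith

theorem endCutoff_eq_zero {ε A : ℝ} (hA : ε ≤ A) (hA' : A ≤ 1 - ε) : endCutoff ε A = 0 := by
  unfold endCutoff
  rw [max_eq_left (by linarith), max_eq_left (by linarith), sub_zero]

theorem continuous_endCutoff (ε : ℝ) : Continuous (endCutoff ε) := by
  unfold endCutoff
  fun_prop

/-- The four functions whose common zeros, for the quadruple of parameters `s` on the curve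
`(X, Y)`, are the inscribed squares; the third one is perturbed to get rid of degenerate zeros. -/
def squareTest (X Y : ℝ → ℝ) (ε : ℝ) (s : Fin 4 → ℝ) : ℕ → ℝ
  | 0 => X (s 0) - X (s 1) + X (s 2) - X (s 3)
  | 1 => Y (s 0) - Y (s 1) + Y (s 2) - Y (s 3)
  | 2 => (X (s 2) - X (s 0)) * (X (s 3) - X (s 1)) + (Y (s 2) - Y (s 0)) * (Y (s 3) - Y (s 1)) +
      endCutoff ε (s 2 - s 0) * endCutoff ε (s 3 - s 1)
  | 3 => (X (s 2) - X (s 0)) ^ 2 + (Y (s 2) - Y (s 0)) ^ 2 -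
      ((X (s 3) - X (s 1)) ^ 2 + (Y (s 3) - Y (s 1)) ^ 2)
  | _ => 0

/-- A parametrization of the cyclically ordered quadruples in `ℝ / ℤ`. -/
def cyclicQuadruple (l a b c : ℝ) : Fin 4 → ℝ :=
  ![(1 - l) * (c - a / 2) + l * (c - 1 / 4 - b / 2), (1 - l) * (c - a / 2) + l * (c - 1 / 4 + b / 2),
    (1 - l) * (c + a / 2) + l * (c - 1 / 4 + b / 2), (1 - l) * (c + a / 2) + l * (c + 3 / 4 - b / 2)]

theorem squareTest_rotate {X Y : ℝ → ℝ} (pX : ∀ t, X (t + 1) = X t) (pY : ∀ t, Y (t + 1) = Y t)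
    (ε s₁ s₂ s₃ s₄ : ℝ) (i : ℕ) :
    squareTest X Y ε ![s₂, s₃, s₄, s₁ + 1] i = -squareTest X Y ε ![s₁, s₂, s₃, s₄] i := by
  match i with
  | 0 => simp [squareTest, pX]; ring
  | 1 => simp [squareTest, pY]; ring
  | 2 =>
    have : s₁ + 1 - s₃ = 1 - (s₃ - s₁) := by ring
    simp [squareTest, pX, pY, this, endCutoff_one_sub]; ring
  | 3 => simp [squareTest, pX, pY]; ring
  | _ + 4 => simp [squareTest]

theorem squareTest_cyclicQuadruple_rotate {X Y : ℝ → ℝ} (pX : ∀ t, X (t + 1) = X t)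
    (pY : ∀ t, Y (t + 1) = Y t) (ε l a b c : ℝ) (i : ℕ) :
    squareTest X Y ε (cyclicQuadruple (1 - l) (1 - b) a (c + 1 / 4)) i =
      -squareTest X Y ε (cyclicQuadruple l a b c) i := by
  rw [cyclicQuadruple, cyclicQuadruple, ← squareTest_rotate pX pY]
  refine congrArg (fun s => squareTest X Y ε s i) (funext fun k => ?_)
  fin_cases k <;> simp <;> ring

theorem continuous_squareTest {X Y : ℝ → ℝ} (hX : Continuous X) (hY : Continuous Y) (ε : ℝ)
    (i : ℕ) : Continuous fun s => squareTest X Y ε s i := by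
  have := continuous_endCutoff ε
  match i with
  | 0 => simp only [squareTest]; fun_prop
  | 1 => simp only [squareTest]; fun_prop
  | 2 => simp only [squareTest]; fun_prop
  | 3 => simp only [squareTest]; fun_prop
  | _ + 4 => simp only [squareTest]; fun_prop

theorem eq_of_sub_add_sub_eq_zero {X Y : ℝ → ℝ} {w : ℝ}
    (hm : ∀ s, ∃ p q, StrictMonoOn (fun t => p * X t + q * Y t) (Set.Icc s (s + w)))
    {a b c d : ℝ} (hab : a ≤ b) (hbc : b ≤ c) (hcd : c ≤ d) (hd : d ≤ a + w)
    (hx : X a - X b + X c - X d = 0) (hy : Y a - Y b + Y c - Y d = 0) : a = b ∧ c = d := by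
  obtain ⟨p, q, hF⟩ := hm a
  have ma : a ∈ Set.Icc a (a + w) := ⟨le_rfl, by linarith⟩
  have mb : b ∈ Set.Icc a (a + w) := ⟨by linarith, by linarith⟩
  have mc : c ∈ Set.Icc a (a + w) := ⟨by linarith, by linarith⟩
  have md : d ∈ Set.Icc a (a + w) := ⟨by linarith, by linarith⟩
  have i1 := (hF.le_iff_le ma mb).mpr hab
  have i2 := (hF.le_iff_le mc md).mpr hcd
  have e : p * X b + q * Y b - (p * X a + q * Y a) + (p * X d + q * Y d - (p * X c + q * Y c)) = 0 := by
    linear_combination -p * hx - q * hy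
  refine ⟨hF.injOn ma mb ?_, hF.injOn mc md ?_⟩
  · linarith
  · linarith

/-- Zeros of the perturbed system are genuine squares. -/
theorem square_of_squareTest_eq_zero {X Y : ℝ → ℝ} (pX : ∀ t, X (t + 1) = X t)
    (pY : ∀ t, Y (t + 1) = Y t)
    (inj : ∀ s t, s ≤ t → t < s + 1 → X s = X t → Y s = Y t → s = t) {w ε : ℝ}
    (hm : ∀ s, ∃ p q, StrictMonoOn (fun t => p * X t + q * Y t) (Set.Icc s (s + w)))
    (hε : 0 < ε) (hε4 : ε ≤ 1 / 4) (hεw : 2 * ε ≤ w) {s₁ s₂ s₃ s₄ : ℝ} (h12 : s₁ ≤ s₂)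
    (h23 : s₂ ≤ s₃) (h34 : s₃ ≤ s₄) (h41 : s₄ ≤ s₁ + 1)
    (hz : ∀ i < 4, squareTest X Y ε ![s₁, s₂, s₃, s₄] i = 0) :
    X s₁ - X s₂ + X s₃ - X s₄ = 0 ∧ Y s₁ - Y s₂ + Y s₃ - Y s₄ = 0 ∧
      (X s₃ - X s₁) * (X s₄ - X s₂) + (Y s₃ - Y s₁) * (Y s₄ - Y s₂) = 0 ∧
      (X s₃ - X s₁) ^ 2 + (Y s₃ - Y s₁) ^ 2 = (X s₄ - X s₂) ^ 2 + (Y s₄ - Y s₂) ^ 2 ∧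
      ¬ (X s₁ = X s₃ ∧ Y s₁ = Y s₃) := by
  have z0 := hz 0 (by norm_num)
  have z1 := hz 1 (by norm_num)
  have z2 := hz 2 (by norm_num)
  have z3 := hz 3 (by norm_num)
  simp only [squareTest, Matrix.cons_val_zero, Matrix.cons_val_one, Matrix.cons_val] at z0 z1 z2 z3
  have qX : ∀ t, X (t - 1) = X t := fun t => by rw [← pX (t - 1), sub_add_cancel]
  have qY : ∀ t, Y (t - 1) = Y t := fun t => by rw [← pY (t - 1), sub_add_cancel]
  rcases lt_or_ge (s₃ - s₁) ε with hA | hA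
  · rcases lt_or_ge (s₄ - s₂) ε with hB | hB
    · exfalso
      obtain ⟨rfl, rfl⟩ := eq_of_sub_add_sub_eq_zero hm h12 h23 h34 (by linarith) z0 z1
      have := mul_pos (endCutoff_pos hε4 hA) (endCutoff_pos hε4 hB)
      nlinarith [sq_nonneg (X s₃ - X s₁), sq_nonneg (Y s₃ - Y s₁)]
    rcases lt_or_ge (1 - ε) (s₄ - s₂) with hB' | hB'
    · exfalso
      obtain ⟨e, rfl⟩ := eq_of_sub_add_sub_eq_zero hm (a := s₄ - 1) (by linarith) h12 h23
        (by linarith) (by rw [qX]; linarith) (by rw [qY]; linarith)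
      obtain rfl : s₄ = s₁ + 1 := by linarith
      have := mul_neg_of_pos_of_neg (endCutoff_pos hε4 hA) (endCutoff_neg hε4 hB')
      rw [pX, pY] at z2
      nlinarith [sq_nonneg (X s₂ - X s₁), sq_nonneg (Y s₂ - Y s₁)]
    · have hc := endCutoff_eq_zero hB hB'
      rw [hc, mul_zero, add_zero] at z2
      refine ⟨z0, z1, z2, by linarith, ?_⟩
      rintro ⟨hx, hy⟩
      rw [hx, hy] at z3
      have ex : X s₂ = X s₄ := by nlinarith [sq_nonneg (X s₄ - X s₂), sq_nonneg (Y s₄ - Y s₂)]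
      have ey : Y s₂ = Y s₄ := by nlinarith [sq_nonneg (X s₄ - X s₂), sq_nonneg (Y s₄ - Y s₂)]
      have := inj s₂ s₄ (by linarith) (by linarith) ex ey
      linarith
  rcases lt_or_ge (1 - ε) (s₃ - s₁) with hA' | hA'
  · rcases lt_or_ge (s₄ - s₂) ε with hB | hB
    · exfalso
      obtain ⟨rfl, e⟩ := eq_of_sub_add_sub_eq_zero hm (d := s₁ + 1) h23 h34 h41
        (by linarith) (by rw [pX]; linarith) (by rw [pY]; linarith)
      obtain rfl : s₄ = s₁ + 1 := by linarith
      have := mul_neg_of_neg_of_pos (endCutoff_neg hε4 hA') (endCutoff_pos hε4 hB)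
      rw [pX, pY] at z2
      nlinarith [sq_nonneg (X s₂ - X s₁), sq_nonneg (Y s₂ - Y s₁)]
    rcases lt_or_ge (1 - ε) (s₄ - s₂) with hB' | hB'
    · exfalso
      obtain ⟨rfl, e⟩ := eq_of_sub_add_sub_eq_zero hm (c := s₁ + 1) (d := s₂ + 1) h34 h41
        (by linarith) (by linarith) (by rw [pX, pX]; linarith) (by rw [pY, pY]; linarith)
      obtain rfl : s₁ = s₂ := by linarith
      have := mul_pos_of_neg_of_neg (endCutoff_neg hε4 hA') (endCutoff_neg hε4 hB')
      nlinarith [sq_nonneg (X s₃ - X s₁), sq_nonneg (Y s₃ - Y s₁)]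
    · have hc := endCutoff_eq_zero hB hB'
      rw [hc, mul_zero, add_zero] at z2
      refine ⟨z0, z1, z2, by linarith, ?_⟩
      rintro ⟨hx, hy⟩
      rw [hx, hy] at z3
      have ex : X s₂ = X s₄ := by nlinarith [sq_nonneg (X s₄ - X s₂), sq_nonneg (Y s₄ - Y s₂)]
      have ey : Y s₂ = Y s₄ := by nlinarith [sq_nonneg (X s₄ - X s₂), sq_nonneg (Y s₄ - Y s₂)]
      have := inj s₂ s₄ (by linarith) (by linarith) ex ey
      linarith
  · have hc := endCutoff_eq_zero hA hA'
    rw [hc, zero_mul, add_zero] at z2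
    refine ⟨z0, z1, z2, by linarith, ?_⟩
    rintro ⟨hx, hy⟩
    have := inj s₁ s₃ (by linarith) (by linarith) hx hy
    linarith

theorem squareTest_cyclicQuadruple_zero_pos {X Y : ℝ → ℝ}
    (inj : ∀ s t, s ≤ t → t < s + 1 → X s = X t → Y s = Y t → s = t) {ε : ℝ} (hε : 0 < ε)
    (hε4 : ε ≤ 1 / 4) (a b c : ℝ) : 0 < squareTest X Y ε (cyclicQuadruple 0 a b c) 2 := by
  have e : squareTest X Y ε (cyclicQuadruple 0 a b c) 2 = (X (c + a / 2) - X (c - a / 2)) ^ 2 +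
      (Y (c + a / 2) - Y (c - a / 2)) ^ 2 + endCutoff ε a ^ 2 := by
    simp only [squareTest, cyclicQuadruple, Matrix.cons_val_zero, Matrix.cons_val_one,
      Matrix.cons_val, sub_zero, one_mul, zero_mul, add_zero]
    rw [show c + a / 2 - (c - a / 2) = a by ring]
    ring
  rw [e]
  by_cases hc : endCutoff ε a = 0
  · have ha : ε ≤ a := by
      by_contra h
      exact (endCutoff_pos hε4 (not_le.mp h)).ne' hc
    have ha' : a ≤ 1 - ε := by
      by_contra h
      exact (endCutoff_neg hε4 (not_le.mp h)).ne hc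
    by_contra hcon
    have k1 := sq_nonneg (X (c + a / 2) - X (c - a / 2))
    have k2 := sq_nonneg (Y (c + a / 2) - Y (c - a / 2))
    have k3 := sq_nonneg (endCutoff ε a)
    have ex := pow_eq_zero_iff (two_ne_zero) |>.mp (by linarith : (X (c + a / 2) - X (c - a / 2)) ^ 2 = 0)
    have ey := pow_eq_zero_iff (two_ne_zero) |>.mp (by linarith : (Y (c + a / 2) - Y (c - a / 2)) ^ 2 = 0)
    have := inj (c - a / 2) (c + a / 2) (by linarith) (by linarith) (by linarith) (by linarith)
    linarith
  · positivity

theorem squareTest_cyclicQuadruple_ne_zero {X Y : ℝ → ℝ} (pX : ∀ t, X (t + 1) = X t)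
    (pY : ∀ t, Y (t + 1) = Y t)
    (inj : ∀ s t, s ≤ t → t < s + 1 → X s = X t → Y s = Y t → s = t) (ε : ℝ) {l a b c : ℝ}
    (hl : 0 < l) (hl' : l < 1) (h : a = 0 ∨ a = 1 ∨ b = 0 ∨ b = 1) :
    squareTest X Y ε (cyclicQuadruple l a b c) 0 ≠ 0 ∨
      squareTest X Y ε (cyclicQuadruple l a b c) 1 ≠ 0 := by
  by_contra! hcon
  obtain ⟨h0, h1⟩ := hcon
  simp only [squareTest, cyclicQuadruple, Matrix.cons_val_zero, Matrix.cons_val_one,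
    Matrix.cons_val] at h0 h1
  set s₁ := (1 - l) * (c - a / 2) + l * (c - 1 / 4 - b / 2) with e1
  set s₂ := (1 - l) * (c - a / 2) + l * (c - 1 / 4 + b / 2) with e2
  set s₃ := (1 - l) * (c + a / 2) + l * (c - 1 / 4 + b / 2) with e3
  set s₄ := (1 - l) * (c + a / 2) + l * (c + 3 / 4 - b / 2) with e4
  rcases h with rfl | rfl | rfl | rfl
  · have e : s₃ = s₂ := by rw [e2, e3]; ring
    have d : s₄ - s₁ = l := by rw [e1, e4]; ring
    rw [e] at h0 h1
    have := inj s₁ s₄ (by linarith) (by linarith) (by linarith) (by linarith)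
    linarith
  · have e : s₄ = s₁ + 1 := by rw [e1, e4]; ring
    have d : s₃ - s₂ = 1 - l := by rw [e2, e3]; ring
    rw [e, pX] at h0
    rw [e, pY] at h1
    have := inj s₂ s₃ (by linarith) (by linarith) (by linarith) (by linarith)
    linarith
  · have e : s₂ = s₁ := by rw [e1, e2]; ring
    have d : s₄ - s₃ = l := by rw [e3, e4]; ring
    rw [e] at h0 h1
    have := inj s₃ s₄ (by linarith) (by linarith) (by linarith) (by linarith)
    linarith
  · have e : s₄ = s₃ := by rw [e3, e4]; ring
    have d : s₂ - s₁ = l := by rw [e1, e2]; ring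
    rw [e] at h0 h1
    have := inj s₁ s₂ (by linarith) (by linarith) (by linarith) (by linarith)
    linarith

theorem alternatingSum_cyclicQuadruple {Z : ℝ → ℝ} (pZ : ∀ t, Z (t + 1) = Z t)
    {U : ℝ → ℝ} (hU : ∀ m, U m = Z (-1 / 8 + m / 4) - Z (3 / 8 + m / 4)) {S : (Fin 4 → ℝ) → ℝ}
    (hS : ∀ s, S s = Z (s 0) - Z (s 1) + Z (s 2) - Z (s 3)) :
    (∀ m, U (m + 2) = -U m) ∧ (∀ p, S (cyclicQuadruple (1 / 2) p 0 0) = U p) ∧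
      (∀ q, S (cyclicQuadruple (1 / 2) 0 q 0) = U (-q)) ∧
      (∀ p, S (cyclicQuadruple (1 / 2) p 1 0) = U (-1 - p)) ∧
      ∀ q, S (cyclicQuadruple (1 / 2) 1 q 0) = U (-3 + q) := by
  refine ⟨fun m => ?_, fun p => ?_, fun q => ?_, fun p => ?_, fun q => ?_⟩
  · rw [hU, hU, show 3 / 8 + (m + 2) / 4 = -1 / 8 + m / 4 + 1 by ring, pZ,
      show -1 / 8 + (m + 2) / 4 = 3 / 8 + m / 4 by ring]
    ring
  · rw [hS, hU]
    simp only [cyclicQuadruple, Matrix.cons_val_zero, Matrix.cons_val_one, Matrix.cons_val]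
    ring_nf
  · rw [hS, hU]
    simp only [cyclicQuadruple, Matrix.cons_val_zero, Matrix.cons_val_one, Matrix.cons_val]
    ring_nf
  · rw [hS, hU]
    simp only [cyclicQuadruple, Matrix.cons_val_zero, Matrix.cons_val_one, Matrix.cons_val]
    ring_nf
  · rw [hS, hU, ← pZ (-1 / 8 + (-3 + q) / 4), show cyclicQuadruple (1 / 2) 1 q 0 3 =
      cyclicQuadruple (1 / 2) 1 q 0 0 + 1 by simp [cyclicQuadruple]; ring, pZ]
    simp only [cyclicQuadruple, Matrix.cons_val_zero, Matrix.cons_val_one, Matrix.cons_val]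
    ring_nf

theorem continuous_squareTest_cyclicQuadruple {X Y : ℝ → ℝ} (hX : Continuous X)
    (hY : Continuous Y) (ε : ℝ) (i : ℕ) : Continuous fun z : ℝ × ℝ × ℝ × ℝ =>
      squareTest X Y ε (cyclicQuadruple z.1 z.2.1 z.2.2.1 (z.2.2.2 / 4)) i := by
  refine (continuous_squareTest hX hY ε i).comp (f := fun z : ℝ × ℝ × ℝ × ℝ =>
    cyclicQuadruple z.1 z.2.1 z.2.2.1 (z.2.2.2 / 4)) ?_
  refine continuous_pi fun k => ?_
  fin_cases k <;> simp [cyclicQuadruple] <;> fun_prop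

theorem exists_square_of_locally_monotone (X Y : ℝ → ℝ) (hX : Continuous X) (hY : Continuous Y)
    (pX : ∀ t, X (t + 1) = X t) (pY : ∀ t, Y (t + 1) = Y t)
    (inj : ∀ s t, s ≤ t → t < s + 1 → X s = X t → Y s = Y t → s = t) {w : ℝ} (hw : 0 < w)
    (hm : ∀ s, ∃ p q, StrictMonoOn (fun t => p * X t + q * Y t) (Set.Icc s (s + w))) :
    ∃ s₁ s₂ s₃ s₄, X s₁ - X s₂ + X s₃ - X s₄ = 0 ∧ Y s₁ - Y s₂ + Y s₃ - Y s₄ = 0 ∧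
      (X s₃ - X s₁) * (X s₄ - X s₂) + (Y s₃ - Y s₁) * (Y s₄ - Y s₂) = 0 ∧
      (X s₃ - X s₁) ^ 2 + (Y s₃ - Y s₁) ^ 2 = (X s₄ - X s₂) ^ 2 + (Y s₄ - Y s₂) ^ 2 ∧
      ¬ (X s₁ = X s₃ ∧ Y s₁ = Y s₃) := by
  obtain ⟨ε, hε, hε4, hεw⟩ : ∃ ε : ℝ, 0 < ε ∧ ε ≤ 1 / 4 ∧ 2 * ε ≤ w :=
    ⟨min (w / 2) (1 / 4), by positivity, min_le_right _ _, by
      have := min_le_left (w / 2) (1 / 4); linarith⟩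
  obtain ⟨G, hG⟩ : ∃ G : ℕ → ℝ → ℝ × ℝ × ℝ → ℝ, ∀ i l a b t,
      G i l (a, b, t) = squareTest X Y ε (cyclicQuadruple l a b (t / 4)) i :=
    ⟨fun i l y => squareTest X Y ε (cyclicQuadruple l y.1 y.2.1 (y.2.2 / 4)) i,
      fun _ _ _ _ _ => rfl⟩
  have hGc : ∀ i, Continuous fun z : ℝ × ℝ × ℝ × ℝ => G i z.1 z.2 := by
    intro i
    convert continuous_squareTest_cyclicQuadruple hX hY ε i using 2
    exact hG _ _ _ _ _
  have hGodd : ∀ i l a b t, G i (1 - l) (1 - b, a, t + 1) = -G i l (a, b, t) := by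
    intro i l a b t
    rw [hG, hG, ← squareTest_cyclicQuadruple_rotate pX pY, add_div]
  obtain ⟨l₀, hl0, hl1, hpos⟩ : ∃ l₀, 0 < l₀ ∧ l₀ < 1 / 2 ∧
      ∀ y ∈ Set.Icc (0 : ℝ) 1 ×ˢ Set.Icc (0 : ℝ) 1 ×ˢ Set.Icc (-1 : ℝ) 1, 0 < G 2 l₀ y := by
    have hev := (isCompact_Icc.prod (isCompact_Icc.prod isCompact_Icc) :
      IsCompact (Set.Icc (0 : ℝ) 1 ×ˢ Set.Icc (0 : ℝ) 1 ×ˢ Set.Icc (-1 : ℝ) 1)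
      ).eventually_forall_of_forall_eventually (x₀ := (0 : ℝ)) (P := fun l y => 0 < G 2 l y) (by
        rintro ⟨a, b, t⟩ _
        exact (hGc 2).continuousAt.eventually (lt_mem_nhds
          (by change 0 < G 2 0 (a, b, t); rw [hG]; exact squareTest_cyclicQuadruple_zero_pos inj hε hε4 _ _ _)))
    obtain ⟨r, hr, hball⟩ := Metric.eventually_nhds_iff.mp hev
    refine ⟨min (r / 2) (1 / 4), by positivity, ?_, ?_⟩
    · have := min_le_right (r / 2) (1 / 4); linarith
    · intro y hy
      refine hball ?_ y hy
      rw [Real.dist_eq, sub_zero, abs_of_pos (by positivity)]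
      have := min_le_left (r / 2) (1 / 4)
      linarith
  set L : ℝ → ℝ := fun t => l₀ + (1 - 2 * l₀) * t with hL
  have hLr : ∀ t, 0 ≤ t → t ≤ 1 → 0 < L t ∧ L t < 1 := by
    intro t h0 h1
    constructor
    · have : 0 ≤ (1 - 2 * l₀) * t := mul_nonneg (by linarith) h0
      simp only [hL]; linarith
    · have : (1 - 2 * l₀) * t ≤ (1 - 2 * l₀) * 1 := mul_le_mul_of_nonneg_left h1 (by linarith)
      simp only [hL]; linarith
  have hLh : L 2⁻¹ = 2⁻¹ := by simp only [hL]; ring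
  obtain ⟨U, hU⟩ : ∃ U : ℕ → ℝ → ℝ, U = fun j m => if j = 0 then
    X (-1 / 8 + m / 4) - X (3 / 8 + m / 4) else Y (-1 / 8 + m / 4) - Y (3 / 8 + m / 4) := ⟨_, rfl⟩
  have hloop : ∀ j < 2, (∀ m, U j (m + 2) = -U j m) ∧ (∀ p, G j (1 / 2) (p, 0, 0) = U j p) ∧
      (∀ q, G j (1 / 2) (0, q, 0) = U j (-q)) ∧ (∀ p, G j (1 / 2) (p, 1, 0) = U j (-1 - p)) ∧
      ∀ q, G j (1 / 2) (1, q, 0) = U j (-3 + q) := by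
    intro j hj
    simp only [hG, zero_div]
    interval_cases j
    · exact alternatingSum_cyclicQuadruple pX (S := fun s => squareTest X Y ε s 0)
        (fun m => by simp [hU]) fun s => rfl
    · exact alternatingSum_cyclicQuadruple pY (S := fun s => squareTest X Y ε s 1)
        (fun m => by simp [hU]) fun s => rfl
  suffices h : ∃ y ∈ Set.Icc (0 : Fin 4 → ℝ) 1, ∀ i < 4, G i (L (y 2)) (y 0, y 1, y 3) = 0 by
    obtain ⟨y, hy, hzero⟩ := h
    obtain ⟨k1, k2⟩ := hLr (y 2) (hy.1 2) (hy.2 2)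
    have a1 : 0 ≤ y 0 := hy.1 0
    have a2 : y 0 ≤ 1 := hy.2 0
    have b1 : 0 ≤ y 1 := hy.1 1
    have b2 : y 1 ≤ 1 := hy.2 1
    simp only [hG] at hzero
    refine ⟨_, _, _, _, square_of_squareTest_eq_zero pX pY inj hm hε hε4 hεw ?_ ?_ ?_ ?_ hzero⟩ <;>
      nlinarith
  refine exists_common_zero (fun i y => G i (L (y 2)) (y 0, y 1, y 3))
    (fun i => (hGc i).comp (f := fun y : Fin 4 → ℝ => (L (y 2), y 0, y 1, y 3))
      (by simp only [hL]; fun_prop)) ?_ ?_ ?_ ?_ U (fun j hj => (hloop j hj).1) ?_ ?_ ?_ ?_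
  · intro i hi y₀ y₁ y₂ y₃
    simp only [Matrix.cons_val_zero, Matrix.cons_val_one, Matrix.cons_val]
    rw [← hGodd]
    congr 1
    simp only [hL]; ring
  · intro y hy h
    have c1 : 0 ≤ y 3 := hy.1 3
    have : L 0 = l₀ := by simp [hL]
    simp only [h, this]
    exact hpos _ ⟨⟨hy.1 0, hy.2 0⟩, ⟨hy.1 1, hy.2 1⟩, ⟨by dsimp only; linarith, hy.2 3⟩⟩
  · intro y hy h
    have a1 : 0 ≤ y 0 := hy.1 0
    have a2 : y 0 ≤ 1 := hy.2 0
    have b1 : 0 ≤ y 1 := hy.1 1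
    have b2 : y 1 ≤ 1 := hy.2 1
    have c1 : 0 ≤ y 3 := hy.1 3
    have c2 : y 3 ≤ 1 := hy.2 3
    have := hpos (y 1, 1 - y 0, y 3 - 1) ⟨⟨b1, b2⟩, ⟨by dsimp only; linarith, by dsimp only; linarith⟩,
      ⟨by dsimp only; linarith, by dsimp only; linarith⟩⟩
    have e := hGodd 2 l₀ (y 1) (1 - y 0) (y 3 - 1)
    rw [sub_sub_cancel, sub_add_cancel] at e
    have hL1 : L 1 = 1 - l₀ := by simp only [hL]; ring
    simp only [h, hL1]
    rw [e]
    linarith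
  · intro y hy h
    obtain ⟨k1, k2⟩ := hLr (y 2) (hy.1 2) (hy.2 2)
    simp only [hG]
    exact squareTest_cyclicQuadruple_ne_zero pX pY inj ε k1 k2 h
  · intro j hj p
    simpa [hLh] using (hloop j hj).2.1 p
  · intro j hj p
    simpa [hLh] using (hloop j hj).2.2.1 p
  · intro j hj p
    simpa [hLh] using (hloop j hj).2.2.2.1 p
  · intro j hj p
    simpa [hLh] using (hloop j hj).2.2.2.2 p

/-- The closed polygonal path through the points `v i`, traversing one edge per unit of time. -/
def polygonPath {n : ℕ} (v : ZMod n → Pt) (τ : ℝ) : Pt :=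
  AffineMap.lineMap (v (⌊τ⌋ : ℤ)) (v ((⌊τ⌋ : ℤ) + 1)) (Int.fract τ)

theorem polygonPath_eq_lineMap {n : ℕ} (v : ZMod n → Pt) {i : ℤ} {τ : ℝ}
    (h : τ ∈ Set.Icc (i : ℝ) (i + 1)) :
    polygonPath v τ = AffineMap.lineMap (v i) (v (i + 1)) (τ - i) := by
  rcases h.2.lt_or_eq with h2 | rfl
  · have e : ⌊τ⌋ = i := Int.floor_eq_iff.mpr ⟨h.1, h2⟩
    rw [polygonPath, Int.fract, e]
  · simp [polygonPath]

theorem continuous_polygonPath {n : ℕ} (v : ZMod n → Pt) : Continuous (polygonPath v) := by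
  have hlf : LocallyFinite fun i : ℤ => Set.Icc (i : ℝ) (i + 1) := by
    intro x
    refine ⟨Set.Ioo (x - 1) (x + 1), Ioo_mem_nhds (by linarith) (by linarith),
      (Set.finite_Icc (⌊x⌋ - 2) (⌊x⌋ + 2)).subset ?_⟩
    rintro i ⟨y, hy, hy'⟩
    have h1 := Int.floor_le x
    have h2 := Int.lt_floor_add_one x
    have h3 : ((⌊x⌋ - 2 : ℤ) : ℝ) ≤ i := by push_cast; linarith [hy.2, hy'.1]
    have h4 : (i : ℝ) ≤ (⌊x⌋ + 2 : ℤ) := by push_cast; linarith [hy.1, hy'.2]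
    exact ⟨by exact_mod_cast h3, by exact_mod_cast h4⟩
  refine hlf.continuous (iUnion_Icc_intCast ℝ) (fun i => isClosed_Icc) fun i => ?_
  refine ContinuousOn.congr (f := fun τ : ℝ => AffineMap.lineMap (v i) (v (i + 1)) (τ - i)) ?_
    fun τ hτ => polygonPath_eq_lineMap v hτ
  exact ((AffineMap.lineMap_continuous).comp (by fun_prop)).continuousOn

theorem polygonPath_add_natCast {n : ℕ} (v : ZMod n → Pt) (τ : ℝ) :
    polygonPath v (τ + n) = polygonPath v τ := by
  simp [polygonPath]

theorem polygonPath_mem_segment {n : ℕ} (v : ZMod n → Pt) (τ : ℝ) :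
    polygonPath v τ ∈ segment ℝ (v (⌊τ⌋ : ℤ)) (v ((⌊τ⌋ : ℤ) + 1)) := by
  rw [segment_eq_image_lineMap]
  exact ⟨_, ⟨Int.fract_nonneg τ, (Int.fract_lt_one τ).le⟩, rfl⟩

theorem polygonPath_mem_polygonSet {n : ℕ} (v : ZMod n → Pt) (τ : ℝ) :
    polygonPath v τ ∈ polygonSet v :=
  Set.mem_iUnion.mpr ⟨_, polygonPath_mem_segment v τ⟩

theorem IsSimplePolygon.polygonPath_ne_of_floor {n : ℕ} {v : ZMod n → Pt} (hP : IsSimplePolygon v)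
    {σ τ : ℝ} (h : ((⌊σ⌋ : ℤ) : ZMod n) = (⌊τ⌋ : ℤ) + 1) : polygonPath v σ ≠ polygonPath v τ := by
  intro e
  have hσ := polygonPath_mem_segment v σ
  have hτ := polygonPath_mem_segment v τ
  rw [h, add_assoc, one_add_one_eq_two, e] at hσ
  have hmem := (hP.2.2.1 _).subset ⟨hτ, hσ⟩
  have h1 : polygonPath v τ =
      AffineMap.lineMap (v (⌊τ⌋ : ℤ)) (v ((⌊τ⌋ : ℤ) + 1)) (1 : ℝ) := by
    rw [AffineMap.lineMap_apply_one]; exact hmem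
  exact (Int.fract_lt_one τ).ne (AffineMap.lineMap_injective ℝ (hP.2.1 _) h1)

theorem IsSimplePolygon.polygonPath_injOn {n : ℕ} {v : ZMod n → Pt} (hP : IsSimplePolygon v)
    {σ τ : ℝ} (h1 : σ ≤ τ) (h2 : τ < σ + n) (e : polygonPath v σ = polygonPath v τ) : σ = τ := by
  by_cases hij : ((⌊σ⌋ : ℤ) : ZMod n) = (⌊τ⌋ : ℤ)
  · have hf : Int.fract σ = Int.fract τ := by
      refine AffineMap.lineMap_injective ℝ (hP.2.1 (⌊σ⌋ : ℤ)) ?_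
      rw [polygonPath, polygonPath, ← hij] at e
      exact e
    obtain ⟨k, hk⟩ := (ZMod.intCast_eq_intCast_iff_dvd_sub _ _ _).mp hij
    have hd : τ - σ = n * k := by
      rw [← Int.floor_add_fract σ, ← Int.floor_add_fract τ, hf]
      have : ((⌊τ⌋ - ⌊σ⌋ : ℤ) : ℝ) = ((n * k : ℤ) : ℝ) := by rw [hk]
      push_cast at this
      linarith
    have hn : (0 : ℝ) < n := by
      have := hP.1
      exact_mod_cast (by omega : 0 < n)
    have k0 : (0 : ℝ) ≤ k := by
      by_contra! hk0
      nlinarith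
    have k1 : (k : ℝ) < 1 := by
      by_contra! hk1
      nlinarith
    have : k = 0 := by
      have a : (0 : ℤ) ≤ k := by exact_mod_cast k0
      have b : k < 1 := by exact_mod_cast k1
      omega
    rw [this] at hd
    simp only [Int.cast_zero, mul_zero] at hd
    linarith
  · exfalso
    have a : ((⌊σ⌋ : ℤ) : ZMod n) ≠ (⌊τ⌋ : ℤ) + 1 := fun h => hP.polygonPath_ne_of_floor h e
    have b : ((⌊τ⌋ : ℤ) : ZMod n) ≠ (⌊σ⌋ : ℤ) + 1 := fun h => hP.polygonPath_ne_of_floor h e.symm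
    refine (hP.2.2.2 _ _ hij a b).subset ⟨polygonPath_mem_segment v σ, ?_⟩
    rw [e]
    exact polygonPath_mem_segment v τ

/-- Two vectors that are not opposite lie in a common open half-plane. -/
theorem exists_inner_pos_of_not_sameRay {p q : Pt} (h : ¬ SameRay ℝ (-p) q) :
    ∃ w : Pt, 0 < inner ℝ w p ∧ 0 < inner ℝ w q := by
  have hp : 0 < ‖p‖ := norm_pos_iff.mpr fun h0 => h (by simp [h0])
  have hq : 0 < ‖q‖ := norm_pos_iff.mpr fun h0 => h (by simp [h0])
  have hpq : 0 < inner ℝ p q + ‖p‖ * ‖q‖ := by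
    have h1 := real_inner_le_norm (-p) q
    have h2 : inner ℝ (-p) q ≠ ‖-p‖ * ‖q‖ := fun e =>
      h (sameRay_iff_norm_smul_eq.mpr (inner_eq_norm_mul_iff_real.mp e).symm)
    have h3 := lt_of_le_of_ne h1 h2
    rw [inner_neg_left, norm_neg] at h3
    linarith
  refine ⟨‖q‖ • p + ‖p‖ • q, ?_, ?_⟩
  · rw [inner_add_left, real_inner_smul_left, real_inner_smul_left, real_inner_self_eq_norm_sq,
      real_inner_comm]
    nlinarith [mul_pos hp hpq]
  · rw [inner_add_left, real_inner_smul_left, real_inner_smul_left, real_inner_self_eq_norm_sq]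
    nlinarith [mul_pos hq hpq]

theorem not_sameRay_of_segment_inter {a b c : Pt} (hab : a ≠ b) (hbc : b ≠ c)
    (h : segment ℝ a b ∩ segment ℝ b c = {b}) : ¬ SameRay ℝ (-(b - a)) (c - b) := by
  intro hs
  rw [neg_sub] at hs
  rcases wbtw_total_of_sameRay_vsub_left (x := b) (y := a) (z := c) hs with hw | hw
  · exact hab (h.subset ⟨left_mem_segment ℝ a b, mem_segment_iff_wbtw.mpr hw⟩)
  · refine hbc (h.subset ⟨?_, right_mem_segment ℝ b c⟩).symm
    exact mem_segment_iff_wbtw.mpr hw.symm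

theorem strictMonoOn_inner_polygonPath {n : ℕ} (v : ZMod n → Pt) {w : Pt} {i : ℤ}
    (h : 0 < inner ℝ w (v (i + 1) - v i)) :
    StrictMonoOn (fun τ => inner ℝ w (polygonPath v τ)) (Set.Icc (i : ℝ) (i + 1)) := by
  intro s hs t ht hst
  simp only [polygonPath_eq_lineMap v hs, polygonPath_eq_lineMap v ht, AffineMap.lineMap_apply,
    vsub_eq_sub, vadd_eq_add, inner_add_right, real_inner_smul_right]
  nlinarith

theorem IsSimplePolygon.exists_strictMonoOn {n : ℕ} {v : ZMod n → Pt} (hP : IsSimplePolygon v)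
    (s : ℝ) : ∃ w : Pt,
      StrictMonoOn (fun τ => inner ℝ w (polygonPath v τ)) (Set.Icc s (s + 1 / 2)) := by
  obtain ⟨i, hi⟩ : ∃ i : ℤ, i = ⌊s + 1 / 2⌋ - 1 := ⟨_, rfl⟩
  have h1 := Int.floor_le (s + 1 / 2)
  have h2 := Int.lt_floor_add_one (s + 1 / 2)
  have h3 : (⌊s + 1 / 2⌋ : ℝ) = i + 1 := by rw [hi]; push_cast; ring
  rw [h3] at h1 h2
  have hseg := hP.2.2.1 i
  have e2 : (i : ZMod n) + 2 = i + 1 + 1 := by ring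
  rw [e2] at hseg
  obtain ⟨w, hw1, hw2⟩ := exists_inner_pos_of_not_sameRay
    (not_sameRay_of_segment_inter (hP.2.1 i) (hP.2.1 (i + 1)) hseg)
  refine ⟨w, ?_⟩
  have m1 := strictMonoOn_inner_polygonPath v hw1
  have m2 := strictMonoOn_inner_polygonPath v (w := w) (i := i + 1) (by push_cast; exact hw2)
  push_cast at m2
  refine (m1.union m2 (isGreatest_Icc (by linarith)) (isLeast_Icc (by linarith))).mono ?_
  rw [Set.Icc_union_Icc_eq_Icc (by linarith) (by linarith)]
  exact Set.Icc_subset_Icc (by linarith) (by linarith)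

/-- Four points whose diagonals bisect each other, are orthogonal and equally long, and are
nonzero form, in one of the two orders, a square. -/
theorem inscribedSquare_of_diagonals {P : Set Pt} {a b c d : Pt} (ha : a ∈ P) (hb : b ∈ P)
    (hc : c ∈ P) (hd : d ∈ P) (h0 : a 0 - b 0 + c 0 - d 0 = 0) (h1 : a 1 - b 1 + c 1 - d 1 = 0)
    (hperp : (c 0 - a 0) * (d 0 - b 0) + (c 1 - a 1) * (d 1 - b 1) = 0)
    (hlen : (c 0 - a 0) ^ 2 + (c 1 - a 1) ^ 2 = (d 0 - b 0) ^ 2 + (d 1 - b 1) ^ 2)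
    (hne : ¬ (a 0 = c 0 ∧ a 1 = c 1)) :
    InscribedSquare P a b c d ∨ InscribedSquare P a d c b := by
  have sq0 : ∀ x y : ℝ, x ^ 2 + y ^ 2 = 0 → x = 0 ∧ y = 0 := fun x y h =>
    ⟨by nlinarith [sq_nonneg x, sq_nonneg y], by nlinarith [sq_nonneg x, sq_nonneg y]⟩
  have key : ∀ b d : Pt, b ∈ P → d ∈ P → a 0 - b 0 + c 0 - d 0 = 0 → a 1 - b 1 + c 1 - d 1 = 0 →
      d 0 - b 0 = -(c 1 - a 1) → d 1 - b 1 = c 0 - a 0 → InscribedSquare P a b c d := by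
    intro b d hb hd h0 h1 k0 k1
    have hpos : 0 < (c 0 - a 0) ^ 2 + (c 1 - a 1) ^ 2 := by
      by_contra! h
      obtain ⟨e0, e1⟩ := sq0 _ _ (le_antisymm h (by positivity))
      exact hne ⟨by linarith, by linarith⟩
    refine ⟨ha, hb, hc, hd, ?_, ?_, ?_, ?_, ?_, ?_, ?_, ?_⟩
    · ext i
      fin_cases i <;> simp <;> linarith
    · ext i
      fin_cases i <;> simp [rotCCW] <;> linarith
    all_goals
      rintro rfl
      nlinarith
  obtain ⟨s, hs⟩ : ∃ s, s = (c 0 - a 0) * (d 1 - b 1) - (c 1 - a 1) * (d 0 - b 0) := ⟨_, rfl⟩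
  have hsq : s ^ 2 = ((c 0 - a 0) ^ 2 + (c 1 - a 1) ^ 2) ^ 2 := by
    rw [hs]
    linear_combination (-(c 0 - a 0) * (d 0 - b 0) - (c 1 - a 1) * (d 1 - b 1)) * hperp -
      ((c 0 - a 0) ^ 2 + (c 1 - a 1) ^ 2) * hlen
  rcases sq_eq_sq_iff_eq_or_eq_neg.mp hsq with h | h
  · have hz : (d 0 - b 0 + (c 1 - a 1)) ^ 2 + (d 1 - b 1 - (c 0 - a 0)) ^ 2 = 0 := by
      linear_combination -hlen - 2 * h + 2 * hs
    obtain ⟨z0, z1⟩ := sq0 _ _ hz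
    exact Or.inl (key b d hb hd h0 h1
      (by linarith) (by linarith))
  · have hz : (b 0 - d 0 + (c 1 - a 1)) ^ 2 + (b 1 - d 1 - (c 0 - a 0)) ^ 2 = 0 := by
      linear_combination -hlen + 2 * h - 2 * hs
    obtain ⟨z0, z1⟩ := sq0 _ _ hz
    exact Or.inr (key d b hd hb (by linarith) (by linarith)
      (by linarith) (by linarith))

/-- Every simple polygon in the plane has an inscribed square. -/
theorem square_peg_for_simple_polygons {n : ℕ} (v : ZMod n → Pt)
    (hP : IsSimplePolygon v) :
    ∃ a₁ a₂ a₃ a₄ : Pt, InscribedSquare (polygonSet v) a₁ a₂ a₃ a₄ := by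
  have hn : (0 : ℝ) < n := by
    have := hP.1
    exact_mod_cast (by omega : 0 < n)
  have hcont : Continuous fun s : ℝ => polygonPath v (n * s) :=
    (continuous_polygonPath v).comp (by fun_prop)
  have hper : ∀ s : ℝ, polygonPath v (n * (s + 1)) = polygonPath v (n * s) := fun s => by
    rw [mul_add, mul_one, polygonPath_add_natCast]
  obtain ⟨s₁, s₂, s₃, s₄, h0, h1, hperp, hlen, hne⟩ := exists_square_of_locally_monotone
    (fun s => polygonPath v (n * s) 0) (fun s => polygonPath v (n * s) 1)
    (by fun_prop) (by fun_prop) (fun s => by rw [hper]) (fun s => by rw [hper])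
    (fun s t h1 h2 e0 e1 => by
      have : n * s = n * t := hP.polygonPath_injOn (by nlinarith) (by nlinarith) (by
        ext i
        fin_cases i
        exacts [e0, e1])
      exact mul_left_cancel₀ hn.ne' this)
    (w := 1 / (2 * n)) (by positivity) (fun s => by
      obtain ⟨w, hw⟩ := hP.exists_strictMonoOn (n * s)
      refine ⟨w 0, w 1, fun x hx y hy hxy => ?_⟩
      have hI : ∀ z ∈ Set.Icc s (s + 1 / (2 * n)), n * z ∈ Set.Icc (n * s) (n * s + 1 / 2) := by
        intro z hz
        have e : (n : ℝ) * (s + 1 / (2 * n)) = n * s + 1 / 2 := by field_simp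
        exact ⟨by nlinarith [hz.1], by nlinarith [hz.2]⟩
      have := hw (hI x hx) (hI y hy) (by nlinarith)
      simpa [PiLp.inner_apply, Fin.sum_univ_two, mul_comm] using this)
  have hmem := polygonPath_mem_polygonSet v
  rcases inscribedSquare_of_diagonals (hmem _) (hmem _) (hmem _) (hmem _) h0 h1 hperp hlen hne
    with h | h
  exacts [⟨_, _, _, _, h⟩, ⟨_, _, _, _, h⟩]
end
end

section
/- Every simple polygon all of whose interior angles lie strictly between π/2 and 3π/2 has an inscribed square: there exist four distinct points on the polygon that are the vertices of a nondegenerate square. -/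
open scoped RealInnerProductSpace

noncomputable section

/-- All interior angles of the polygon lie strictly between `π/2` and `3π/2`:
at every vertex `vᵢ` the inner product `⟪vᵢ₋₁ - vᵢ, vᵢ₊₁ - vᵢ⟫` is negative. -/
def ObtuseAngles {n : ℕ} (v : ZMod n → Pt) : Prop :=
  ∀ i : ZMod n, ⟪v (i - 1) - v i, v (i + 1) - v i⟫ < 0

/-- The winding number around `q` of the closed polygonal curve `z 0, z 1, …, z N = z 0`,
measured as a sum of angles. -/
def windingReal (N : ℕ) (z : ℕ → ℂ) (q : ℂ) : ℝ :=
  (∑ l ∈ Finset.range N, Complex.arg ((z (l + 1) - q) / (z l - q))) / (2 * Real.pi)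

/-- The winding number rounded down to an integer; this changes nothing off the vertices. -/
def winding (N : ℕ) (z : ℕ → ℂ) (q : ℂ) : ℤ := ⌊windingReal N z q⌋

/-- The algebraic number of crossings of the segments `[q₁, q₂]` and `[a, b]`. -/
def crossing (q₁ q₂ a b : ℂ) : ℝ :=
  (Complex.arg ((b - q₂) / (a - q₂)) - Complex.arg ((b - q₁) / (a - q₁))
    - Complex.arg ((q₂ - b) / (q₁ - b)) + Complex.arg ((q₂ - a) / (q₁ - a))) / (2 * Real.pi)

theorem crossing_swap (q₁ q₂ a b : ℂ) : crossing q₁ q₂ a b = -crossing a b q₁ q₂ := by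
  unfold crossing
  ring

theorem crossing_affine {s : ℂ} (hs : s ≠ 0) (t q₁ q₂ a b : ℂ) :
    crossing (t + s * q₁) (t + s * q₂) (t + s * a) (t + s * b) = crossing q₁ q₂ a b := by
  have key : ∀ x y w : ℂ, ((t + s * x) - (t + s * y)) / ((t + s * w) - (t + s * y))
      = (x - y) / (w - y) := by
    intro x y w
    rw [add_sub_add_left_eq_sub, add_sub_add_left_eq_sub, ← mul_sub, ← mul_sub,
      mul_div_mul_left _ _ hs]
  simp only [crossing, key]

theorem windingReal_sub {N : ℕ} {z : ℕ → ℂ} (hz : z N = z 0) (q₁ q₂ : ℂ) :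
    windingReal N z q₂ - windingReal N z q₁
      = ∑ l ∈ Finset.range N, crossing q₁ q₂ (z l) (z (l + 1)) := by
  have h := Finset.sum_range_sub (fun l => Complex.arg ((q₂ - z l) / (q₁ - z l))) N
  simp only [hz, sub_self] at h
  simp only [windingReal, crossing, ← Finset.sum_div, ← sub_div]
  congr 1
  rw [← Finset.sum_sub_distrib, ← sub_zero (Finset.sum _ _), ← h, ← Finset.sum_sub_distrib]
  refine Finset.sum_congr rfl fun l _ => ?_
  ring

theorem crossing_integral {q₁ q₂ a b : ℂ} (h₁ : a ≠ q₁) (h₂ : a ≠ q₂) (h₃ : b ≠ q₁)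
    (h₄ : b ≠ q₂) : ∃ k : ℤ, crossing q₁ q₂ a b = k := by
  have h : ((Complex.arg ((b - q₂) / (a - q₂)) - Complex.arg ((b - q₁) / (a - q₁))
    - Complex.arg ((q₂ - b) / (q₁ - b)) + Complex.arg ((q₂ - a) / (q₁ - a)) : ℝ) :
      Real.Angle) = 0 := by
    have n : ∀ {x y : ℂ}, x ≠ y →
        (Complex.arg (y - x) : Real.Angle) = Complex.arg (x - y) + (Real.pi : ℝ) := by
      intro x y hxy
      rw [← Complex.arg_neg_coe_angle (sub_ne_zero.2 hxy), neg_sub]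
    simp only [Real.Angle.coe_add, Real.Angle.coe_sub]
    rw [Complex.arg_div_coe_angle (sub_ne_zero.2 h₄) (sub_ne_zero.2 h₂),
      Complex.arg_div_coe_angle (sub_ne_zero.2 h₃) (sub_ne_zero.2 h₁),
      Complex.arg_div_coe_angle (sub_ne_zero.2 h₄.symm) (sub_ne_zero.2 h₃.symm),
      Complex.arg_div_coe_angle (sub_ne_zero.2 h₂.symm) (sub_ne_zero.2 h₁.symm),
      n h₁, n h₂, n h₃, n h₄]
    abel
  obtain ⟨k, hk⟩ := Real.Angle.coe_eq_zero_iff.1 h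
  refine ⟨k, ?_⟩
  rw [crossing, ← hk, zsmul_eq_mul, mul_div_assoc, div_self Real.two_pi_pos.ne', mul_one]

theorem abs_arg_div_lt {x y : ℂ} {h : ℝ} (hx : ‖x - y‖ ≤ h) (hy : h < ‖y‖) :
    |Complex.arg (x / y)| < Real.pi / 2 := by
  have h0 : 0 ≤ h := (norm_nonneg _).trans hx
  have hy0 : y ≠ 0 := norm_pos_iff.1 (h0.trans_lt hy)
  rw [Complex.abs_arg_lt_pi_div_two_iff]
  left
  have e : x / y = 1 + (x - y) / y := by field_simp; ring
  have : ‖(x - y) / y‖ < 1 := by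
    rw [norm_div, div_lt_one (h0.trans_lt hy)]
    exact hx.trans_lt hy
  rw [e, Complex.add_re, Complex.one_re]
  have := (abs_lt.1 ((Complex.abs_re_le_norm _).trans_lt this)).1
  linarith

theorem crossing_eq_zero_of_far {q₁ q₂ a b : ℂ} {h : ℝ} (hq : ‖q₂ - q₁‖ ≤ h) (hab : ‖b - a‖ ≤ h)
    (hd : 3 * h < ‖q₁ - a‖) : crossing q₁ q₂ a b = 0 := by
  have h0 : 0 ≤ h := (norm_nonneg _).trans hq
  have d11 : h < ‖a - q₁‖ := by rw [norm_sub_rev]; linarith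
  have d12 : h < ‖a - q₂‖ := by
    have t := norm_add_le (a - q₂) (q₂ - q₁)
    rw [sub_add_sub_cancel, norm_sub_rev a q₁] at t
    linarith
  have d21 : h < ‖q₁ - b‖ := by
    have t := norm_add_le (q₁ - b) (b - a)
    rw [sub_add_sub_cancel] at t
    linarith
  have d22 : h < ‖q₂ - b‖ := by
    have t := norm_add_le (q₂ - b) (b - a)
    have t' := norm_add_le (q₁ - q₂) (q₂ - a)
    rw [sub_add_sub_cancel] at t t'
    rw [norm_sub_rev] at hq
    linarith
  have ne : ∀ {x y : ℂ}, h < ‖x - y‖ → x ≠ y := fun hxy e => by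
    rw [e, sub_self, norm_zero] at hxy
    linarith
  obtain ⟨k, hk⟩ := crossing_integral (ne d11) (ne d12) (ne d21).symm (ne d22).symm
  have a1 := abs_arg_div_lt (x := b - q₂) (y := a - q₂) (by simpa using hab) d12
  have a2 := abs_arg_div_lt (x := b - q₁) (y := a - q₁) (by simpa using hab) d11
  have a3 := abs_arg_div_lt (x := q₂ - b) (y := q₁ - b) (by simpa using hq) d21
  have a4 := abs_arg_div_lt (x := q₂ - a) (y := q₁ - a) (by simpa using hq)
    (by rw [norm_sub_rev]; exact d11)
  rw [abs_lt] at a1 a2 a3 a4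
  have hpi := Real.two_pi_pos
  have l1 : crossing q₁ q₂ a b < 1 := by
    rw [crossing, div_lt_one hpi]; linarith
  have l2 : -1 < crossing q₁ q₂ a b := by
    rw [crossing, lt_div_iff₀ hpi]; linarith
  rw [hk] at l1 l2 ⊢
  have u1 : k < 1 := by exact_mod_cast l1
  have u2 : -1 < k := by exact_mod_cast l2
  have : k = 0 := by omega
  simp [this]

theorem winding_cast {N : ℕ} {z : ℕ → ℂ} {q : ℂ} (hz : z N = z 0) (hq : ∀ l ≤ N, z l ≠ q) :
    (winding N z q : ℝ) = windingReal N z q := by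
  have h : ((∑ l ∈ Finset.range N, Complex.arg ((z (l + 1) - q) / (z l - q)) : ℝ) : Real.Angle)
      = 0 := by
    have := Finset.sum_range_sub (fun l => (Complex.arg (z l - q) : Real.Angle)) N
    rw [hz, sub_self] at this
    rw [← this, ← Real.Angle.coe_coeHom, map_sum]
    refine Finset.sum_congr rfl fun l hl => ?_
    have hl := Finset.mem_range.1 hl
    exact Complex.arg_div_coe_angle (sub_ne_zero.2 (hq _ hl)) (sub_ne_zero.2 (hq _ hl.le))
  obtain ⟨k, hk⟩ := Real.Angle.coe_eq_zero_iff.1 h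
  have : windingReal N z q = k := by
    rw [windingReal, ← hk, zsmul_eq_mul, mul_div_assoc, div_self Real.two_pi_pos.ne', mul_one]
  rw [winding, this, Int.floor_intCast]

theorem continuousAt_arg_div {a b q : ℂ} (hq : q ∉ segment ℝ a b) :
    ContinuousAt (fun x => Complex.arg ((b - x) / (a - x))) q := by
  have ha : a - q ≠ 0 := fun h => hq (by rw [← sub_eq_zero.1 h]; exact left_mem_segment ℝ a b)
  have hb : b - q ≠ 0 := fun h => hq (by rw [← sub_eq_zero.1 h]; exact right_mem_segment ℝ a b)
  have hs : (b - q) / (a - q) ∈ Complex.slitPlane := by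
    by_contra hs
    rw [Complex.mem_slitPlane_iff_not_le_zero, not_not] at hs
    obtain ⟨hre, him⟩ := Complex.le_def.1 hs
    simp only [Complex.zero_re, Complex.zero_im] at hre him
    set r := ((b - q) / (a - q)).re with hr
    have e : (b - q) / (a - q) = (r : ℂ) := Complex.ext (by simp [hr]) (by simp [him])
    rw [div_eq_iff ha] at e
    have h1 : 0 < 1 - r := by linarith
    apply hq
    refine ⟨-r / (1 - r), 1 / (1 - r), by apply div_nonneg <;> linarith, by positivity, ?_, ?_⟩
    · field_simp; ring
    · have : (1 - r : ℂ) ≠ 0 := by exact_mod_cast h1.ne'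
      have hb' : b = q + r * (a - q) := by rw [← e]; ring
      rw [hb']
      simp only [Complex.real_smul]
      push_cast
      field_simp
      ring
  refine ContinuousAt.comp (g := Complex.arg) (Complex.continuousAt_arg hs) ?_
  exact ContinuousAt.div (by fun_prop) (by fun_prop) ha

theorem winding_eq_of_preconnected {N : ℕ} {z : ℕ → ℂ} (hz : z N = z 0) {S : Set ℂ}
    (hS : IsPreconnected S) (hd : ∀ q ∈ S, ∀ l < N, q ∉ segment ℝ (z l) (z (l + 1)))
    {q₁ q₂ : ℂ} (h₁ : q₁ ∈ S) (h₂ : q₂ ∈ S) : winding N z q₁ = winding N z q₂ := by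
  rcases Nat.eq_zero_or_pos N with rfl | hN
  · simp [winding, windingReal]
  have hv : ∀ q ∈ S, ∀ l ≤ N, z l ≠ q := by
    rintro q hq l hl rfl
    rcases hl.lt_or_eq with hl | rfl
    · exact hd _ hq l hl (left_mem_segment ℝ _ _)
    · exact hd _ hq 0 hN (by rw [hz]; exact left_mem_segment ℝ _ _)
  have hc : ContinuousOn (windingReal N z) S := by
    intro q hq
    apply ContinuousAt.continuousWithinAt
    unfold windingReal
    refine ContinuousAt.div_const ?_ _
    exact tendsto_finsetSum _ fun l hl => continuousAt_arg_div (hd q hq l (Finset.mem_range.1 hl))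
  have hc' : ContinuousOn (winding N z) S := by
    rw [Int.isClosedEmbedding_coe_real.isEmbedding.continuousOn_iff]
    exact hc.congr fun q hq => winding_cast hz (hv q hq)
  exact hS.constant hc' h₁ h₂

theorem winding_jump {N : ℕ} {z : ℕ → ℂ} (hN : 0 < N) {p e : ℂ} {t : ℝ} (ht : 0 < t) (he : e ≠ 0)
    (h0 : z 0 = p - t * e) (h1 : z 1 = p + t * e)
    (hp : ∀ l < N, l ≠ 0 → p ∉ segment ℝ (z l) (z (l + 1))) :
    Filter.Tendsto (fun s : ℝ => windingReal N z (p + Complex.I * s * e)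
      - windingReal N z (p - Complex.I * s * e)) (nhdsWithin 0 (Set.Ioi 0)) (nhds 1) := by
  obtain ⟨N, rfl⟩ : ∃ K, N = K + 1 := ⟨N - 1, by omega⟩
  have e1 : ∀ s : ℝ, windingReal (N + 1) z (p + Complex.I * s * e)
      - windingReal (N + 1) z (p - Complex.I * s * e) =
      (∑ l ∈ Finset.range N, (Complex.arg ((z (l + 2) - (p + Complex.I * s * e)) /
          (z (l + 1) - (p + Complex.I * s * e))) -
        Complex.arg ((z (l + 2) - (p - Complex.I * s * e)) /
          (z (l + 1) - (p - Complex.I * s * e)))) +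
        (Complex.arg ((t - Complex.I * s) / (-t - Complex.I * s)) -
        Complex.arg ((t + Complex.I * s) / (-t + Complex.I * s)))) / (2 * Real.pi) := by
    intro s
    simp only [windingReal, Finset.sum_range_succ', Finset.sum_sub_distrib, h0, zero_add, h1]
    have r1 : (p + t * e - (p + Complex.I * s * e)) / (p - t * e - (p + Complex.I * s * e))
      = (t - Complex.I * s) / (-t - Complex.I * s) := by
      rw [← mul_div_mul_right _ (-t - Complex.I * s) he]; congr 1 <;> ring
    have r2 : (p + t * e - (p - Complex.I * s * e)) / (p - t * e - (p - Complex.I * s * e))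
      = (t + Complex.I * s) / (-t + Complex.I * s) := by
      rw [← mul_div_mul_right _ (-t + Complex.I * s) he]; congr 1 <;> ring
    rw [r1, r2]
    ring
  simp only [e1]
  have e2 : (1 : ℝ) = (∑ l ∈ Finset.range N, (Complex.arg ((z (l + 2) - p) / (z (l + 1) - p)) -
        Complex.arg ((z (l + 2) - p) / (z (l + 1) - p))) + (Real.pi - -Real.pi)) /
        (2 * Real.pi) := by
    simp only [sub_self, Finset.sum_const_zero]
    field_simp
    norm_num
  rw [e2]
  refine Filter.Tendsto.div_const (Filter.Tendsto.add ?_ (Filter.Tendsto.sub ?_ ?_)) _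
  · refine tendsto_finsetSum _ fun l hl => ?_
    have hc := continuousAt_arg_div (hp (l + 1) (by have := Finset.mem_range.1 hl; omega)
      (by omega))
    refine Filter.Tendsto.sub ?_ ?_
    · refine Filter.Tendsto.comp hc (Filter.Tendsto.mono_left ?_ nhdsWithin_le_nhds)
      have : Continuous fun s : ℝ => p + Complex.I * s * e := by fun_prop
      simpa using this.tendsto 0
    · refine Filter.Tendsto.comp hc (Filter.Tendsto.mono_left ?_ nhdsWithin_le_nhds)
      have : Continuous fun s : ℝ => p - Complex.I * s * e := by fun_prop
      simpa using this.tendsto 0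
  · have hc := Complex.continuousWithinAt_arg_of_re_neg_of_im_zero (z := -1) (by simp) (by simp)
    rw [ContinuousWithinAt, Complex.arg_neg_one] at hc
    refine hc.comp (tendsto_nhdsWithin_iff.2 ⟨?_, ?_⟩)
    · have : ContinuousAt (fun s : ℝ => ((t : ℂ) - Complex.I * s) / (-t - Complex.I * s)) 0 := by
        apply ContinuousAt.div <;> first | fun_prop | simp [ht.ne']
      have := this.tendsto
      simp only [Complex.ofReal_zero, mul_zero, sub_zero] at this
      rw [div_neg, div_self (by exact_mod_cast ht.ne')] at this
      exact this.mono_left nhdsWithin_le_nhds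
    · filter_upwards [self_mem_nhdsWithin] with s hs
      have hs : 0 < s := hs
      simp only [Complex.div_im]
      simp
      have := Complex.normSq_nonneg (-t - Complex.I * s)
      rw [← sub_nonneg]
      ring_nf
      positivity
  · have hc := Complex.tendsto_arg_nhdsWithin_im_neg_of_re_neg_of_im_zero (z := -1)
      (by simp) (by simp)
    refine hc.comp (tendsto_nhdsWithin_iff.2 ⟨?_, ?_⟩)
    · have : ContinuousAt (fun s : ℝ => ((t : ℂ) + Complex.I * s) / (-t + Complex.I * s)) 0 := by
        apply ContinuousAt.div <;> first | fun_prop | simp [ht.ne']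
      have := this.tendsto
      simp only [Complex.ofReal_zero, mul_zero, add_zero] at this
      rw [div_neg, div_self (by exact_mod_cast ht.ne')] at this
      exact this.mono_left nhdsWithin_le_nhds
    · filter_upwards [self_mem_nhdsWithin] with s hs
      have hs : 0 < s := hs
      simp only [Complex.div_im]
      have hn : 0 < Complex.normSq (-t + Complex.I * s) := by
        rw [Complex.normSq_pos]
        intro h0
        have := congrArg Complex.re h0
        simp at this
        exact ht.ne' this
      simp
      rw [← sub_neg, ← sub_div, div_neg_iff]
      right
      refine ⟨by nlinarith, hn⟩

theorem winding_eq_of_infDist {N : ℕ} {z : ℕ → ℂ} (hz : z N = z 0) {P : Set ℂ}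
    (hseg : ∀ l < N, segment ℝ (z l) (z (l + 1)) ⊆ P) {η : ℝ} {q₁ q₂ : ℂ}
    (h₁ : η ≤ Metric.infDist q₁ P) (h₂ : ‖q₁ - q₂‖ < η) : winding N z q₁ = winding N z q₂ := by
  refine winding_eq_of_preconnected hz (S := Metric.ball q₁ η) (convex_ball q₁ η).isPreconnected
    (fun q hq l hl hql => ?_) (Metric.mem_ball_self ((norm_nonneg _).trans_lt h₂)) ?_
  · have := Metric.infDist_le_dist_of_mem (x := q₁) (hseg l hl hql)
    rw [Metric.mem_ball, dist_comm] at hq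
    linarith
  · rwa [Metric.mem_ball, dist_comm, dist_eq_norm]

theorem sum_boundary_eq {N : ℕ} {A B : ℕ → ℕ → ℤ}
    (h : ∀ j < N, ∀ k < N,
      (A (j + 1) k = A j k ∧ A j (k + 1) = A j k ∧ A (j + 1) (k + 1) = A j k) ∨
      (B (j + 1) k = B j k ∧ B j (k + 1) = B j k ∧ B (j + 1) (k + 1) = B j k)) :
    ∑ k ∈ Finset.range N, (A 0 (k + 1) - A 0 k) * B 0 k
      + ∑ j ∈ Finset.range N, (A (j + 1) N - A j N) * B j N
    = ∑ j ∈ Finset.range N, (A (j + 1) 0 - A j 0) * B j 0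
      + ∑ k ∈ Finset.range N, (A N (k + 1) - A N k) * B N k := by
  set V : ℕ → ℕ → ℤ := fun j k => (A j (k + 1) - A j k) * B j k with hV
  set H : ℕ → ℕ → ℤ := fun j k => (A (j + 1) k - A j k) * B j k with hH
  have e : ∑ j ∈ Finset.range N, ∑ k ∈ Finset.range N, (H j (k + 1) - H j k)
      = ∑ j ∈ Finset.range N, ∑ k ∈ Finset.range N, (V (j + 1) k - V j k) := by
    refine Finset.sum_congr rfl fun j hj => Finset.sum_congr rfl fun k hk => ?_
    rcases h j (Finset.mem_range.1 hj) k (Finset.mem_range.1 hk) with ⟨h1, h2, h3⟩ | ⟨h1, h2, h3⟩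
    · simp only [hV, hH, h1, h2, h3]; ring
    · simp only [hV, hH, h1, h2]; ring
  rw [Finset.sum_comm (f := fun j k => V (j + 1) k - V j k)] at e
  simp only [fun j => Finset.sum_range_sub (H j) N,
    fun k => Finset.sum_range_sub (fun j => V j k) N, Finset.sum_sub_distrib] at e
  simp only [hV, hH] at e
  linarith

theorem sum_succ_mul_sub_eq {m n : ℕ} (hmn : m ≤ n) {a b c : ℕ → ℝ}
    (h : ∀ k ∈ Finset.Ico m n, b k = c k ∨ a (k + 1) = a k) (hm : b m = c m) (hn : b n = c n) :
    ∑ k ∈ Finset.Ico m n, a (k + 1) * (b (k + 1) - b k)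
      = ∑ k ∈ Finset.Ico m n, a (k + 1) * (c (k + 1) - c k) := by
  have e := Finset.sum_Ico_sub (fun k => a k * (b k - c k)) hmn
  simp only [hm, hn, sub_self, mul_zero] at e
  rw [← sub_eq_zero, ← Finset.sum_sub_distrib, ← e]
  refine Finset.sum_congr rfl fun k hk => ?_
  rcases h k hk with h | h
  · rw [h]; ring
  · rw [h]; ring

theorem sum_mul_sub_eq {m n : ℕ} (hmn : m ≤ n) {a b c : ℕ → ℝ}
    (h : ∀ k ∈ Finset.Ico m n, b (k + 1) = c (k + 1) ∨ a (k + 1) = a k) (hm : b m = c m)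
    (hn : b n = c n) :
    ∑ k ∈ Finset.Ico m n, (b (k + 1) - b k) * a k
      = ∑ k ∈ Finset.Ico m n, (c (k + 1) - c k) * a k := by
  have e := Finset.sum_Ico_sub (fun k => a k * (b k - c k)) hmn
  simp only [hm, hn, sub_self, mul_zero] at e
  rw [← sub_eq_zero, ← Finset.sum_sub_distrib, ← e]
  refine Finset.sum_congr rfl fun k hk => ?_
  rcases h k hk with h | h
  · rw [h]; ring
  · rw [h]; ring

theorem sum_range_eq_sum_Ico {N m n : ℕ} (hn : n ≤ N) {f : ℕ → ℤ}
    (h : ∀ k < N, k < m ∨ n ≤ k → f k = 0) :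
    ∑ k ∈ Finset.range N, f k = ∑ k ∈ Finset.Ico m n, f k := by
  symm
  refine Finset.sum_subset (fun k hk => ?_) fun k hk hk' => h k (Finset.mem_range.1 hk) ?_
  · rw [Finset.mem_Ico] at hk
    exact Finset.mem_range.2 (by omega)
  · rw [Finset.mem_Ico] at hk'
    omega

/-- The square on the side `[y, x]`, taken to the left of `y → x`, has the further vertices
`farVertex y x` (next to `x`) and `nearVertex y x` (next to `y`). -/
def farVertex (y x : ℂ) : ℂ := x + Complex.I * (x - y)

/-- The vertex next to `y` of the square on the left of the side `y → x`. -/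
def nearVertex (y x : ℂ) : ℂ := y + Complex.I * (x - y)

theorem norm_farVertex_sub_le {h : ℝ} {x y x' y' : ℂ} (hx : ‖x - x'‖ ≤ h) (hy : ‖y - y'‖ ≤ h) :
    ‖farVertex y x - farVertex y' x'‖ ≤ 3 * h := by
  have e : farVertex y x - farVertex y' x'
      = (x - x') + (Complex.I * (x - x') - Complex.I * (y - y')) := by
    unfold farVertex; ring
  have t1 := norm_add_le (x - x') (Complex.I * (x - x') - Complex.I * (y - y'))
  have t2 := norm_sub_le (Complex.I * (x - x')) (Complex.I * (y - y'))
  simp only [norm_mul, Complex.norm_I, one_mul] at t2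
  rw [e]
  linarith

theorem norm_nearVertex_sub_le {h : ℝ} {x y x' y' : ℂ} (hx : ‖x - x'‖ ≤ h) (hy : ‖y - y'‖ ≤ h) :
    ‖nearVertex y x - nearVertex y' x'‖ ≤ 3 * h := by
  have e : nearVertex y x - nearVertex y' x'
      = (y - y') + (Complex.I * (x - x') - Complex.I * (y - y')) := by
    unfold nearVertex; ring
  have t1 := norm_add_le (y - y') (Complex.I * (x - x') - Complex.I * (y - y'))
  have t2 := norm_sub_le (Complex.I * (x - x')) (Complex.I * (y - y'))
  simp only [norm_mul, Complex.norm_I, one_mul] at t2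
  rw [e]
  linarith

/-- The integer `f j k`, replaced by `L` near the diagonal `k = j` and by `R` near `k = j + N`. -/
def cutoff (m N : ℕ) (L R : ℤ) (f : ℕ → ℕ → ℤ) (j k : ℕ) : ℤ :=
  if k ≤ j + m then L else if j + N ≤ k + m then R else f j k

theorem discrete_contradiction {N m : ℕ} (hm : 1 ≤ m) (hmN : 2 * m + 2 ≤ N) {z : ℕ → ℂ}
    (hz : z N = z 0) {P : Set ℂ} (hseg : ∀ l < N, segment ℝ (z l) (z (l + 1)) ⊆ P) {h η : ℝ}
    (hη : 6 * h < η) (hh : ∀ l < N, ‖z (l + 1) - z l‖ ≤ h)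
    (hmid : ∀ j ≤ N, ∀ k ≤ N, j + m ≤ k + 1 → k + m ≤ j + N + 1 →
      η ≤ Metric.infDist (farVertex (z j) (z k)) P ∨
      η ≤ Metric.infDist (nearVertex (z j) (z k)) P)
    (hbot : ∀ j ≤ N, ∀ k ≤ N, j + m ≤ k + 1 → k ≤ j + m + 1 →
      η ≤ Metric.infDist (farVertex (z j) (z k)) P ∧
      η ≤ Metric.infDist (nearVertex (z j) (z k)) P)
    (htop : ∀ j ≤ N, ∀ k ≤ N, j + N ≤ k + m + 1 → k + m ≤ j + N + 1 →
      η ≤ Metric.infDist (farVertex (z j) (z k)) P ∧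
      η ≤ Metric.infDist (nearVertex (z j) (z k)) P)
    (hsep : ∀ k < N, ∀ l < N, ¬ (k ∈ Finset.Ico m (N - m) ↔ l ∈ Finset.Ico m (N - m)) →
      3 * h < ‖nearVertex (z 0) (z k) - z l‖)
    {L R : ℤ} (hL : winding N z (farVertex (z 0) (z m)) = L)
    (hL' : winding N z (nearVertex (z 0) (z m)) = L)
    (hR : winding N z (farVertex (z 0) (z (N - m))) = R)
    (hR' : winding N z (nearVertex (z 0) (z (N - m))) = R) (hodd : Odd (L - R)) : False := by
  have h0 : 0 ≤ h := (norm_nonneg _).trans (hh 0 (by omega))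
  have hvP : ∀ l ≤ N, z l ∈ P := by
    intro l hl
    rcases hl.lt_or_eq with hl | rfl
    · exact hseg l hl (left_mem_segment ℝ _ _)
    · rw [hz]; exact hseg 0 (by omega) (left_mem_segment ℝ _ _)
  have hclear : ∀ {q₁ q₂ : ℂ}, η ≤ Metric.infDist q₁ P → ‖q₁ - q₂‖ ≤ 6 * h →
      winding N z q₁ = winding N z q₂ :=
    fun h₁ h₂ => winding_eq_of_infDist hz hseg h₁ (h₂.trans_lt hη)
  have hreal : ∀ {q : ℂ}, η ≤ Metric.infDist q P → windingReal N z q = (winding N z q : ℝ) := by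
    intro q hq
    refine (winding_cast hz fun l hl e => ?_).symm
    have := Metric.infDist_zero_of_mem (hvP l hl)
    rw [e] at this
    linarith
  have hstep : ∀ j j' : ℕ, j ≤ N → j' ≤ N → (j = j' ∨ j' = j + 1 ∨ j = j' + 1) →
      ‖z j - z j'‖ ≤ h := by
    rintro j j' hj hj' (rfl | rfl | rfl)
    · simpa using h0
    · rw [norm_sub_rev]; exact hh _ (by omega)
    · exact hh _ (by omega)
  have hfar : ∀ j j' k k' : ℕ, j ≤ N → j' ≤ N → k ≤ N → k' ≤ N →
      (j = j' ∨ j' = j + 1 ∨ j = j' + 1) → (k = k' ∨ k' = k + 1 ∨ k = k' + 1) →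
      η ≤ Metric.infDist (farVertex (z j) (z k)) P →
      winding N z (farVertex (z j') (z k')) = winding N z (farVertex (z j) (z k)) := by
    intro j j' k k' hj hj' hk hk' hjj hkk hc
    exact (hclear hc ((norm_farVertex_sub_le (hstep k k' hk hk' hkk)
      (hstep j j' hj hj' hjj)).trans (by linarith))).symm
  have hnear : ∀ j j' k k' : ℕ, j ≤ N → j' ≤ N → k ≤ N → k' ≤ N →
      (j = j' ∨ j' = j + 1 ∨ j = j' + 1) → (k = k' ∨ k' = k + 1 ∨ k = k' + 1) →
      η ≤ Metric.infDist (nearVertex (z j) (z k)) P →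
      winding N z (nearVertex (z j') (z k')) = winding N z (nearVertex (z j) (z k)) := by
    intro j j' k k' hj hj' hk hk' hjj hkk hc
    exact (hclear hc ((norm_nearVertex_sub_le (hstep k k' hk hk' hkk)
      (hstep j j' hj hj' hjj)).trans (by linarith))).symm
  have hbotL : ∀ j k : ℕ, k ≤ N → j + m ≤ k + 1 → k ≤ j + m + 1 →
      winding N z (farVertex (z j) (z k)) = L ∧ winding N z (nearVertex (z j) (z k)) = L := by
    intro j
    induction j with
    | zero =>
      intro k hk h1 h2
      have hc := hbot 0 (by omega) m (by omega) (by omega) (by omega)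
      exact ⟨(hfar 0 0 m k (by omega) (by omega) (by omega) hk (by omega) (by omega) hc.1).trans hL,
        (hnear 0 0 m k (by omega) (by omega) (by omega) hk (by omega) (by omega) hc.2).trans hL'⟩
    | succ j ih =>
      intro k hk h1 h2
      obtain ⟨k, rfl⟩ : ∃ i, k = i + 1 := ⟨k - 1, by omega⟩
      have hc := hbot j (by omega) k (by omega) (by omega) (by omega)
      have := ih k (by omega) (by omega) (by omega)
      exact ⟨(hfar j (j + 1) k (k + 1) (by omega) (by omega) (by omega) hk (by omega) (by omega)
        hc.1).trans this.1, (hnear j (j + 1) k (k + 1) (by omega) (by omega) (by omega) hk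
        (by omega) (by omega) hc.2).trans this.2⟩
  have htopR : ∀ j k : ℕ, k ≤ N → j + N ≤ k + m + 1 → k + m ≤ j + N + 1 →
      winding N z (farVertex (z j) (z k)) = R ∧ winding N z (nearVertex (z j) (z k)) = R := by
    intro j
    induction j with
    | zero =>
      intro k hk h1 h2
      have hc := htop 0 (by omega) (N - m) (by omega) (by omega) (by omega)
      exact ⟨(hfar 0 0 (N - m) k (by omega) (by omega) (by omega) hk (by omega) (by omega)
        hc.1).trans hR, (hnear 0 0 (N - m) k (by omega) (by omega) (by omega) hk (by omega)
        (by omega) hc.2).trans hR'⟩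
    | succ j ih =>
      intro k hk h1 h2
      obtain ⟨k, rfl⟩ : ∃ i, k = i + 1 := ⟨k - 1, by omega⟩
      have hc := htop j (by omega) k (by omega) (by omega) (by omega)
      have := ih k (by omega) (by omega) (by omega)
      exact ⟨(hfar j (j + 1) k (k + 1) (by omega) (by omega) (by omega) hk (by omega) (by omega)
        hc.1).trans this.1, (hnear j (j + 1) k (k + 1) (by omega) (by omega) (by omega) hk
        (by omega) (by omega) hc.2).trans this.2⟩
  set A := cutoff m N L R fun j k => winding N z (farVertex (z j) (z k)) with hA
  set B := cutoff m N L R fun j k => winding N z (nearVertex (z j) (z k)) with hB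
  have lowA : ∀ j k, k ≤ j + m → A j k = L := fun j k hk => by rw [hA, cutoff, if_pos hk]
  have lowB : ∀ j k, k ≤ j + m → B j k = L := fun j k hk => by rw [hB, cutoff, if_pos hk]
  have highA : ∀ j k, j + N ≤ k + m → A j k = R := fun j k hk => by
    rw [hA, cutoff, if_neg (by omega), if_pos hk]
  have highB : ∀ j k, j + N ≤ k + m → B j k = R := fun j k hk => by
    rw [hB, cutoff, if_neg (by omega), if_pos hk]
  have eqA : ∀ j k, k ≤ N → j + m ≤ k + 1 → k + m ≤ j + N + 1 →
      A j k = winding N z (farVertex (z j) (z k)) := by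
    intro j k hk h1 h2
    by_cases c1 : k ≤ j + m
    · rw [lowA j k c1, (hbotL j k hk h1 (by omega)).1]
    by_cases c2 : j + N ≤ k + m
    · rw [highA j k c2, (htopR j k hk (by omega) h2).1]
    rw [hA, cutoff, if_neg c1, if_neg c2]
  have eqB : ∀ j k, k ≤ N → j + m ≤ k + 1 → k + m ≤ j + N + 1 →
      B j k = winding N z (nearVertex (z j) (z k)) := by
    intro j k hk h1 h2
    by_cases c1 : k ≤ j + m
    · rw [lowB j k c1, (hbotL j k hk h1 (by omega)).2]
    by_cases c2 : j + N ≤ k + m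
    · rw [highB j k c2, (htopR j k hk (by omega) h2).2]
    rw [hB, cutoff, if_neg c1, if_neg c2]
  have hstokes := sum_boundary_eq (N := N) (A := A) (B := B) (by
    intro j hj k hk
    by_cases c1 : k + 1 ≤ j + m
    · left
      simp only [lowA j k (by omega), lowA (j + 1) k (by omega), lowA j (k + 1) (by omega),
        lowA (j + 1) (k + 1) (by omega), and_self]
    by_cases c2 : j + 1 + N ≤ k + m
    · left
      simp only [highA j k (by omega), highA (j + 1) k (by omega), highA j (k + 1) (by omega),
        highA (j + 1) (k + 1) (by omega), and_self]
    rcases hmid j (by omega) k (by omega) (by omega) (by omega) with hc | hc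
    · left
      rw [eqA j k (by omega) (by omega) (by omega), eqA (j + 1) k (by omega) (by omega) (by omega),
        eqA j (k + 1) (by omega) (by omega) (by omega),
        eqA (j + 1) (k + 1) (by omega) (by omega) (by omega)]
      refine ⟨hfar _ _ _ _ ?_ ?_ ?_ ?_ ?_ ?_ hc, hfar _ _ _ _ ?_ ?_ ?_ ?_ ?_ ?_ hc,
        hfar _ _ _ _ ?_ ?_ ?_ ?_ ?_ ?_ hc⟩ <;> omega
    · right
      rw [eqB j k (by omega) (by omega) (by omega), eqB (j + 1) k (by omega) (by omega) (by omega),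
        eqB j (k + 1) (by omega) (by omega) (by omega),
        eqB (j + 1) (k + 1) (by omega) (by omega) (by omega)]
      refine ⟨hnear _ _ _ _ ?_ ?_ ?_ ?_ ?_ ?_ hc, hnear _ _ _ _ ?_ ?_ ?_ ?_ ?_ ?_ hc,
        hnear _ _ _ _ ?_ ?_ ?_ ?_ ?_ ?_ hc⟩ <;> omega)
  have hr1 : ∑ j ∈ Finset.range N, (A (j + 1) 0 - A j 0) * B j 0 = 0 :=
    Finset.sum_eq_zero fun j _ => by
      rw [lowA j 0 (by omega), lowA (j + 1) 0 (by omega), sub_self, zero_mul]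
  have hr2 : ∑ k ∈ Finset.range N, (A N (k + 1) - A N k) * B N k = 0 :=
    Finset.sum_eq_zero fun k hk => by
      have := Finset.mem_range.1 hk
      rw [lowA N k (by omega), lowA N (k + 1) (by omega), sub_self, zero_mul]
  rw [hr1, hr2, add_zero] at hstokes
  have hparts : ∑ k ∈ Finset.range N, (A 0 (k + 1) - A 0 k) * B 0 k
      + ∑ k ∈ Finset.range N, A 0 (k + 1) * (B 0 (k + 1) - B 0 k) = R * R - L * L := by
    have e := Finset.sum_range_sub (fun k => A 0 k * B 0 k) N
    rw [highA 0 N (by omega), highB 0 N (by omega), lowA 0 0 (by omega), lowB 0 0 (by omega)] at e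
    rw [← e, ← Finset.sum_add_distrib]
    exact Finset.sum_congr rfl fun k _ => by ring
  have hsum : ∑ k ∈ Finset.range N, A 0 (k + 1) * (B 0 (k + 1) - B 0 k)
      + ∑ j ∈ Finset.range N, (A (j + 1) N - A j N) * B j N = 0 := by
    have e1 : ∑ k ∈ Finset.range N, A 0 (k + 1) * (B 0 (k + 1) - B 0 k)
        = ∑ k ∈ Finset.Ico m (N - m), A 0 (k + 1) * (B 0 (k + 1) - B 0 k) := by
      refine sum_range_eq_sum_Ico (by omega) fun k hk hk' => ?_
      rcases hk' with hk' | hk'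
      · rw [lowB 0 k (by omega), lowB 0 (k + 1) (by omega), sub_self, mul_zero]
      · rw [highB 0 k (by omega), highB 0 (k + 1) (by omega), sub_self, mul_zero]
    have e2 : ∑ j ∈ Finset.range N, (A (j + 1) N - A j N) * B j N
        = ∑ j ∈ Finset.Ico m (N - m), (A (j + 1) N - A j N) * B j N := by
      refine sum_range_eq_sum_Ico (by omega) fun k hk hk' => ?_
      rcases hk' with hk' | hk'
      · rw [highA k N (by omega), highA (k + 1) N (by omega), sub_self, zero_mul]
      · rw [lowA k N (by omega), lowA (k + 1) N (by omega), sub_self, zero_mul]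
    rw [e1, e2]
    set c : ℕ → ℕ → ℝ := fun k l => crossing (nearVertex (z 0) (z k)) (nearVertex (z 0) (z (k + 1)))
      (z l) (z (l + 1)) with hc
    have hc0 : ∀ k < N, ∀ l < N, 3 * h < ‖nearVertex (z 0) (z k) - z l‖ → c k l = 0 := by
      intro k hk l hl hkl
      refine crossing_eq_zero_of_far ?_ (hh l hl) hkl
      have e : nearVertex (z 0) (z (k + 1)) - nearVertex (z 0) (z k)
          = Complex.I * (z (k + 1) - z k) := by
        unfold nearVertex; ring
      rw [e, norm_mul, Complex.norm_I, one_mul]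
      exact hh k hk
    have f1 : ((∑ k ∈ Finset.Ico m (N - m), A 0 (k + 1) * (B 0 (k + 1) - B 0 k) : ℤ) : ℝ)
        = ∑ k ∈ Finset.Ico m (N - m), ∑ l ∈ Finset.Ico m (N - m), (A 0 (k + 1) : ℝ) * c k l := by
      push_cast
      refine (sum_succ_mul_sub_eq (a := fun k => (A 0 k : ℝ))
        (b := fun k => windingReal N z (nearVertex (z 0) (z k)))
        (c := fun k => (B 0 k : ℝ)) (by omega) ?_ ?_ ?_).symm.trans ?_
      rotate_left 3
      · refine Finset.sum_congr rfl fun k hk => ?_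
        have hk' := Finset.mem_Ico.1 hk
        rw [windingReal_sub hz, Finset.mul_sum]
        symm
        refine Finset.sum_subset (fun l hl => ?_) fun l hl hl' => ?_
        · rw [Finset.mem_Ico] at hl
          exact Finset.mem_range.2 (by omega)
        · have hl := Finset.mem_range.1 hl
          rw [hc0 k (by omega) l hl (hsep k (by omega) l hl (by tauto)), mul_zero]
      · intro k hk
        have hk' := Finset.mem_Ico.1 hk
        rcases hmid 0 (by omega) k (by omega) (by omega) (by omega) with hcl | hcl
        · right
          rw [eqA 0 k (by omega) (by omega) (by omega),
            eqA 0 (k + 1) (by omega) (by omega) (by omega)]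
          exact_mod_cast hfar 0 0 k (k + 1) (by omega) (by omega) (by omega) (by omega) (by omega)
            (by omega) hcl
        · left
          rw [eqB 0 k (by omega) (by omega) (by omega)]
          exact hreal hcl
      · rw [eqB 0 m (by omega) (by omega) (by omega)]
        exact hreal (hbot 0 (by omega) m (by omega) (by omega) (by omega)).2
      · rw [eqB 0 (N - m) (by omega) (by omega) (by omega)]
        exact hreal (htop 0 (by omega) (N - m) (by omega) (by omega) (by omega)).2
    have f2 : ((∑ j ∈ Finset.Ico m (N - m), (A (j + 1) N - A j N) * B j N : ℤ) : ℝ)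
        = ∑ j ∈ Finset.Ico m (N - m), ∑ l ∈ Finset.Ico m (N - m), -c l j * (B j N : ℝ) := by
      push_cast
      refine (sum_mul_sub_eq (a := fun k => (B k N : ℝ))
        (b := fun k => windingReal N z (farVertex (z k) (z N)))
        (c := fun k => (A k N : ℝ)) (by omega) ?_ ?_ ?_).symm.trans ?_
      rotate_left 3
      · refine Finset.sum_congr rfl fun k hk => ?_
        have hk' := Finset.mem_Ico.1 hk
        rw [windingReal_sub hz, Finset.sum_mul]
        symm
        have hcr : ∀ l, crossing (farVertex (z k) (z N)) (farVertex (z (k + 1)) (z N)) (z l)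
            (z (l + 1)) = -c l k := by
          intro l
          rw [← crossing_affine Complex.I_ne_zero (z 0 - Complex.I * z 0), crossing_swap]
          have ef : ∀ x, z 0 - Complex.I * z 0 + Complex.I * farVertex x (z N) = x := by
            intro x
            rw [farVertex, hz]
            linear_combination (z 0 - x) * Complex.I_mul_I
          have en : ∀ x, z 0 - Complex.I * z 0 + Complex.I * x = nearVertex (z 0) x := by
            intro x
            rw [nearVertex]; ring
          rw [ef, ef, en, en]
        simp only [hcr]
        refine Finset.sum_subset (fun l hl => ?_) fun l hl hl' => ?_
        · rw [Finset.mem_Ico] at hl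
          exact Finset.mem_range.2 (by omega)
        · have hl := Finset.mem_range.1 hl
          rw [hc0 l hl k (by omega) (hsep l hl k (by omega) (by tauto)), neg_zero, zero_mul]
      · intro k hk
        have hk' := Finset.mem_Ico.1 hk
        rcases hmid (k + 1) (by omega) N le_rfl (by omega) (by omega) with hcl | hcl
        · left
          rw [eqA (k + 1) N (by omega) (by omega) (by omega)]
          exact hreal hcl
        · right
          rw [eqB k N (by omega) (by omega) (by omega),
            eqB (k + 1) N (by omega) (by omega) (by omega)]
          exact_mod_cast (hnear (k + 1) k N N (by omega) (by omega) (by omega) (by omega) (by omega)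
            (by omega) hcl).symm
      · rw [eqA m N (by omega) (by omega) (by omega)]
        exact hreal (htop m (by omega) N (by omega) (by omega) (by omega)).1
      · rw [eqA (N - m) N (by omega) (by omega) (by omega)]
        exact hreal (hbot (N - m) (by omega) N (by omega) (by omega) (by omega)).1
    have f3 : ((∑ k ∈ Finset.Ico m (N - m), A 0 (k + 1) * (B 0 (k + 1) - B 0 k)
        + ∑ j ∈ Finset.Ico m (N - m), (A (j + 1) N - A j N) * B j N : ℤ) : ℝ) = 0 := by
      rw [Int.cast_add, f1, f2, Finset.sum_comm, ← Finset.sum_add_distrib]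
      refine Finset.sum_eq_zero fun l hl => ?_
      rw [← Finset.sum_add_distrib]
      refine Finset.sum_eq_zero fun k hk => ?_
      have hl' := Finset.mem_Ico.1 hl
      have hk' := Finset.mem_Ico.1 hk
      by_cases hd : 3 * h < ‖nearVertex (z 0) (z k) - z l‖
      · rw [hc0 k (by omega) l (by omega) hd]; simp
      have hAB : A 0 (k + 1) = B l N := by
        rw [eqA 0 (k + 1) (by omega) (by omega) (by omega),
          eqB l N (by omega) (by omega) (by omega)]
        rcases hmid 0 (by omega) k (by omega) (by omega) (by omega) with hcl | hcl
        · rw [hfar 0 0 k (k + 1) (by omega) (by omega) (by omega) (by omega) (by omega)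
            (by omega) hcl]
          refine hclear hcl ?_
          set δ := nearVertex (z 0) (z k) - z l with hδ
          have e : farVertex (z 0) (z k) - nearVertex (z l) (z N) = δ - Complex.I * δ := by
            rw [hδ, farVertex, nearVertex, nearVertex, hz]
            linear_combination (z k - z 0) * Complex.I_mul_I
          have t := norm_sub_le δ (Complex.I * δ)
          rw [norm_mul, Complex.norm_I, one_mul] at t
          rw [e]
          linarith
        · have := Metric.infDist_le_dist_of_mem (x := nearVertex (z 0) (z k))
            (hvP l (by omega))
          rw [dist_eq_norm] at this
          linarith
      rw [hAB]
      ring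
    exact_mod_cast f3
  obtain ⟨r, hr⟩ := hodd
  have e1 : 2 * ∑ k ∈ Finset.range N, A 0 (k + 1) * (B 0 (k + 1) - B 0 k) = R * R - L * L := by
    linarith
  have e2 : L = R + (2 * r + 1) := by linarith
  rw [e2] at e1
  have e3 : R * R - (R + (2 * r + 1)) * (R + (2 * r + 1))
      = 2 * (-(2 * r * R) - R - 2 * r * r - 2 * r) - 1 := by ring
  omega

theorem winding_sub_eq_one {N : ℕ} {z : ℕ → ℂ} (hz : z N = z 0) (hN : 0 < N) {P : Set ℂ}
    (hseg : ∀ l < N, segment ℝ (z l) (z (l + 1)) ⊆ P) {p e : ℂ} (he : e ≠ 0) {r : ℝ}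
    (hloc : ∀ q ∈ P, ‖q - p‖ < r → ∃ x : ℝ, q = p + x * e) {t : ℝ} (ht : 0 < t)
    (htr : t * ‖e‖ < r) (h0 : z 0 = p) (h1 : z 1 = p + (2 * t : ℝ) * e)
    (hp : ∀ l < N, l ≠ 0 → p + t * e ∉ segment ℝ (z l) (z (l + 1))) {w w' : ℂ}
    (hw : 0 < w.im) (hwr : ‖w * e‖ < r) (hw' : w'.im < 0) (hwr' : ‖w' * e‖ < r) :
    winding N z (p + w * e) - winding N z (p + w' * e) = 1 := by
  have hz0P : ∀ l ≤ N, z l ∈ P := by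
    intro l hl
    rcases hl.lt_or_eq with hl | rfl
    · exact hseg l hl (left_mem_segment ℝ _ _)
    · rw [hz]; exact hseg 0 hN (left_mem_segment ℝ _ _)
  have hmiss : ∀ w : ℂ, w.im ≠ 0 → ‖w * e‖ < r → p + w * e ∉ P := by
    intro w hw hwr hq
    obtain ⟨x, hx⟩ := hloc _ hq (by simpa using hwr)
    have hx : w = x := mul_right_cancel₀ he (add_left_cancel hx)
    exact hw (by simp [hx])
  have hball : Convex ℝ {w : ℂ | ‖w * e‖ < r} := by
    have hpre : {w : ℂ | ‖w * e‖ < r} = (fun w => w * e) ⁻¹' Metric.ball 0 r := by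
      ext v
      rw [Set.mem_preimage, mem_ball_zero_iff]
      rfl
    rw [hpre]
    exact (convex_ball (0 : ℂ) r).is_linear_preimage
      (IsLinearMap.mk (fun x y => by ring) (fun c x => by simp [mul_assoc]))
  have hconst : ∀ T : Set ℂ, Convex ℝ T → (∀ w ∈ T, w.im ≠ 0 ∧ ‖w * e‖ < r) → ∀ w₁ ∈ T, ∀ w₂ ∈ T,
      winding N z (p + w₁ * e) = winding N z (p + w₂ * e) := by
    intro T hT hTm w₁ h₁ w₂ h₂
    refine winding_eq_of_preconnected hz (S := (fun w => p + w * e) '' T)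
      (hT.isPreconnected.image _ (by fun_prop)) ?_ ⟨_, h₁, rfl⟩ ⟨_, h₂, rfl⟩
    rintro _ ⟨w, hw, rfl⟩ l hl hq
    exact hmiss w (hTm w hw).1 (hTm w hw).2 (hseg l hl hq)
  have hup : ∀ w₁ : ℂ, 0 < w₁.im → ‖w₁ * e‖ < r →
      winding N z (p + w₁ * e) = winding N z (p + w * e) := fun w₁ h₁ h₂ =>
    hconst ({w | 0 < w.im} ∩ {w | ‖w * e‖ < r}) ((convex_halfSpace_im_gt 0).inter hball)
      (fun v hv => ⟨hv.1.ne', hv.2⟩) _ ⟨h₁, h₂⟩ _ ⟨hw, hwr⟩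
  have hdown : ∀ w₁ : ℂ, w₁.im < 0 → ‖w₁ * e‖ < r →
      winding N z (p + w₁ * e) = winding N z (p + w' * e) := fun w₁ h₁ h₂ =>
    hconst ({w | w.im < 0} ∩ {w | ‖w * e‖ < r}) ((convex_halfSpace_im_lt 0).inter hball)
      (fun v hv => ⟨hv.1.ne, hv.2⟩) _ ⟨h₁, h₂⟩ _ ⟨hw', hwr'⟩
  have hcast : ∀ w : ℂ, w.im ≠ 0 → ‖w * e‖ < r →
      windingReal N z (p + w * e) = winding N z (p + w * e) := fun w h₁ h₂ =>
    (winding_cast hz fun l hl h => hmiss w h₁ h₂ (by rw [← h]; exact hz0P l hl)).symm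
  have hjump := winding_jump (z := z) hN (p := p + t * e) ht he (by rw [h0]; ring)
    (by rw [h1]; push_cast; ring) hp
  have hsmall : ∀ σ : ℝ, ∀ᶠ s : ℝ in nhdsWithin 0 (Set.Ioi 0),
      ‖((t : ℂ) + σ * (Complex.I * s)) * e‖ < r := by
    intro σ
    refine Filter.Tendsto.eventually_lt_const (v := ‖((t : ℂ) + σ * (Complex.I * (0 : ℝ))) * e‖)
      (by simpa [abs_of_pos ht] using htr) ?_
    exact (Continuous.tendsto (by fun_prop) 0).mono_left nhdsWithin_le_nhds
  have hev : ∀ᶠ s : ℝ in nhdsWithin 0 (Set.Ioi 0),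
      windingReal N z (p + t * e + Complex.I * s * e) -
        windingReal N z (p + t * e - Complex.I * s * e) =
      ((winding N z (p + w * e) - winding N z (p + w' * e) : ℤ) : ℝ) := by
    filter_upwards [hsmall 1, hsmall (-1), self_mem_nhdsWithin] with s h₁ h₂ hs
    have hs : 0 < s := hs
    have i₁ : 0 < ((t : ℂ) + (1 : ℝ) * (Complex.I * s)).im := by simpa using hs
    have i₂ : ((t : ℂ) + (-1 : ℝ) * (Complex.I * s)).im < 0 := by simpa using hs
    have e₁ : p + t * e + Complex.I * s * e = p + ((t : ℂ) + (1 : ℝ) * (Complex.I * s)) * e := by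
      push_cast; ring
    have e₂ : p + t * e - Complex.I * s * e = p + ((t : ℂ) + (-1 : ℝ) * (Complex.I * s)) * e := by
      push_cast; ring
    rw [e₁, e₂, hcast _ i₁.ne' h₁, hcast _ i₂.ne h₂, hup _ i₁ h₁, hdown _ i₂ h₂]
    push_cast; rfl
  have := tendsto_nhds_unique (hjump.congr' hev) tendsto_const_nhds
  exact_mod_cast this.symm

set_option maxHeartbeats 2000000 in
theorem exists_square_of_closed_curve {γ : ℝ → ℂ} (hγ : Continuous γ) {n : ℕ} (hn : 2 ≤ n)
    (hper : Function.Periodic γ n)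
    (hinj : ∀ s t : ℝ, 0 ≤ s → s < t → t ≤ n → γ s = γ t → s = 0 ∧ t = n)
    (hseg : ∀ M l : ℕ, 0 < M → segment ℝ (γ ((l : ℝ) / (2 * M))) (γ (((l + 1 : ℕ) : ℝ) / (2 * M))) ⊆
      γ '' Set.Icc ((l : ℝ) / (2 * M)) (((l + 1 : ℕ) : ℝ) / (2 * M)))
    {δ : ℝ} (hδ : 0 < δ)
    (hsmall : ∀ s t : ℝ, γ s ≠ γ t → ‖γ s - γ t‖ < δ →
      farVertex (γ s) (γ t) ∉ Set.range γ ∧ nearVertex (γ s) (γ t) ∉ Set.range γ)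
    {e : ℂ} (he : e ≠ 0) (hlin : ∀ t : ℝ, |t| ≤ 1 / 2 → γ t = γ 0 + t * e) :
    ∃ s t : ℝ, γ s ≠ γ t ∧ farVertex (γ s) (γ t) ∈ Set.range γ ∧
      nearVertex (γ s) (γ t) ∈ Set.range γ := by
  by_contra! hno
  have hn2 : (2 : ℝ) ≤ n := by exact_mod_cast hn
  have hPc : IsCompact (Set.range γ) := hper.compact_of_continuous (by positivity) hγ
  have hne : (Set.range γ).Nonempty := Set.range_nonempty γ
  have hpos : ∀ q, q ∉ Set.range γ → 0 < Metric.infDist q (Set.range γ) := fun q hq =>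
    (hPc.isClosed.notMem_iff_infDist_pos hne).1 hq
  have hdist : ∀ s t : ℝ, 0 ≤ s → t ≤ n → s < t → t < s + n → γ s ≠ γ t := by
    intro s t hs ht hst hts h
    obtain ⟨rfl, rfl⟩ := hinj s t hs hst ht h
    linarith
  obtain ⟨r, hr, hloc⟩ : ∃ r > 0, ∀ t : ℝ, 0 ≤ t → t ≤ n → ‖γ t - γ 0‖ < r →
      ∃ x : ℝ, |x| ≤ 1 / 2 ∧ γ t = γ 0 + x * e ∧ (t = x ∨ t = x + n) := by
    obtain ⟨r, hr, h⟩ := (isCompact_Icc (a := (1 / 2 : ℝ)) (b := n - 1 / 2)).exists_forall_le'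
      (f := fun t => ‖γ t - γ 0‖) (a := 0) (by fun_prop) (by
        intro t ht
        refine norm_pos_iff.2 (sub_ne_zero.2 (hdist 0 t le_rfl ?_ ?_ ?_).symm) <;>
          linarith [ht.1, ht.2])
    refine ⟨r, hr, fun t h0 h1 htr => ?_⟩
    by_cases h2 : t ≤ 1 / 2
    · have ha : |t| ≤ 1 / 2 := by rwa [abs_of_nonneg h0]
      exact ⟨t, ha, hlin t ha, Or.inl rfl⟩
    by_cases h3 : n - 1 / 2 ≤ t
    · have ha : |t - n| ≤ 1 / 2 := by rw [abs_le]; constructor <;> linarith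
      refine ⟨t - n, ha, ?_, Or.inr (by ring)⟩
      rw [← hlin _ ha, hper.sub_eq]
    · exact absurd (h t ⟨by linarith, by linarith⟩) (by linarith)
  have hunif : ∀ ρ > 0, ∃ ω > 0, ∀ s ∈ Set.Icc (0 : ℝ) (2 * n), ∀ t ∈ Set.Icc (0 : ℝ) (2 * n),
      |s - t| < ω → ‖γ s - γ t‖ < ρ := by
    have := (isCompact_Icc (a := (0 : ℝ)) (b := 2 * n)).uniformContinuousOn_of_continuous
      hγ.continuousOn
    intro ρ hρ
    obtain ⟨ω, hω, h⟩ := Metric.uniformContinuousOn_iff.1 this ρ hρ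
    refine ⟨ω, hω, fun s hs t ht hst => ?_⟩
    simpa [dist_eq_norm] using h s hs t ht (by simpa [Real.dist_eq] using hst)
  have hbound : ∀ f : ℝ × ℝ → ℝ, Continuous f → ∀ a b : ℝ,
      (∀ s t : ℝ, 0 ≤ s → s ≤ n → 0 ≤ t → t ≤ n → a ≤ t - s → t - s ≤ b → 0 < f (s, t)) →
      ∃ η > 0, ∀ s t : ℝ, 0 ≤ s → s ≤ n → 0 ≤ t → t ≤ n → a ≤ t - s → t - s ≤ b →
        η ≤ f (s, t) := by
    intro f hf a b h
    have hK : IsCompact ((Set.Icc (0 : ℝ) n ×ˢ Set.Icc (0 : ℝ) n) ∩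
        (fun p : ℝ × ℝ => p.2 - p.1) ⁻¹' Set.Icc a b) :=
      (isCompact_Icc.prod isCompact_Icc).inter_right (isClosed_Icc.preimage (by fun_prop))
    obtain ⟨η, hη, h'⟩ := hK.exists_forall_le' hf.continuousOn (a := 0) (by
      rintro ⟨s, t⟩ ⟨⟨h₁, h₂⟩, h₃⟩
      exact h s t h₁.1 h₁.2 h₂.1 h₂.2 h₃.1 h₃.2)
    exact ⟨η, hη, fun s t h₁ h₂ h₃ h₄ h₅ h₆ => h' (s, t) ⟨⟨⟨h₁, h₂⟩, ⟨h₃, h₄⟩⟩, ⟨h₅, h₆⟩⟩⟩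
  have he0 : 0 < ‖e‖ := norm_pos_iff.2 he
  obtain ⟨ω, hω, hδω⟩ := hunif δ hδ
  obtain ⟨E, hE⟩ := exists_nat_gt (4 + 2 / ω + 3 * ‖e‖ / r)
  have hω0 : 0 < 2 / ω := by positivity
  have hr0 : 0 < 3 * ‖e‖ / r := by positivity
  have hE4 : (4 : ℝ) < E := by linarith
  have hE0 : (0 : ℝ) < E := by linarith
  have hEω : 2 / (E : ℝ) < ω := by
    rw [div_lt_iff₀ hE0, mul_comm, ← div_lt_iff₀ hω]; linarith
  have hEr : 3 * ‖e‖ / E < r := by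
    rw [div_lt_iff₀ hE0, mul_comm r, ← div_lt_iff₀ hr]; linarith
  have h2E : 2 / (E : ℝ) = 1 / E + 1 / E := by ring
  have hE14 : 1 / (E : ℝ) ≤ 1 / 4 := by
    apply one_div_le_one_div_of_le <;> linarith
  have hE1 : 0 < 1 / (E : ℝ) := by positivity
  have hFc : Continuous fun p : ℝ × ℝ =>
      Metric.infDist (farVertex (γ p.1) (γ p.2)) (Set.range γ) :=
    (Metric.continuous_infDist_pt _).comp (by unfold farVertex; fun_prop)
  have hGc : Continuous fun p : ℝ × ℝ =>
      Metric.infDist (nearVertex (γ p.1) (γ p.2)) (Set.range γ) :=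
    (Metric.continuous_infDist_pt _).comp (by unfold nearVertex; fun_prop)
  obtain ⟨η₁, hη₁, hmid⟩ := hbound _ (hFc.max hGc) (1 / E) (n - 1 / E) (by
    intro s t h₁ h₂ h₃ h₄ h₅ h₆
    by_cases hF : farVertex (γ s) (γ t) ∈ Set.range γ
    · exact lt_max_of_lt_right (hpos _ (hno s t (hdist s t h₁ h₄ (by linarith) (by linarith)) hF))
    · exact lt_max_of_lt_left (hpos _ hF))
  obtain ⟨η₂, hη₂, hbot⟩ := hbound _ (hFc.min hGc) (1 / E) (2 / E) (by
    intro s t h₁ h₂ h₃ h₄ h₅ h₆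
    have := hsmall s t (hdist s t h₁ h₄ (by linarith) (by linarith))
      (hδω s ⟨h₁, by linarith⟩ t ⟨h₃, by linarith⟩ (by
        rw [abs_lt]; constructor <;> linarith))
    exact lt_min (hpos _ this.1) (hpos _ this.2))
  obtain ⟨η₃, hη₃, htop⟩ := hbound _ (hFc.min hGc) (n - 2 / E) (n - 1 / E) (by
    intro s t h₁ h₂ h₃ h₄ h₅ h₆
    have := hsmall s t (hdist s t h₁ h₄ (by linarith) (by linarith))
      (by
        rw [← hper s]
        exact hδω (s + n) ⟨by linarith, by linarith⟩ t ⟨h₃, by linarith⟩ (by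
          rw [abs_lt]; constructor <;> linarith))
    exact lt_min (hpos _ this.1) (hpos _ this.2))
  obtain ⟨h, hh0, hhη₁, hhη₂, hhη₃, hhe⟩ : ∃ h > 0, 6 * h < η₁ ∧ 6 * h < η₂ ∧ 6 * h < η₃ ∧
      3 * h < 3 / (2 * E) * ‖e‖ := by
    have hσ : 0 < 3 / (2 * E) * ‖e‖ := by positivity
    refine ⟨min (min η₁ η₂) (min η₃ (3 / (2 * E) * ‖e‖)) / 7, by positivity, ?_⟩
    have m1 := min_le_left (min η₁ η₂) (min η₃ (3 / (2 * E) * ‖e‖))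
    have m2 := min_le_right (min η₁ η₂) (min η₃ (3 / (2 * E) * ‖e‖))
    have m3 := min_le_left η₁ η₂
    have m4 := min_le_right η₁ η₂
    have m5 := min_le_left η₃ (3 / (2 * E) * ‖e‖)
    have m6 := min_le_right η₃ (3 / (2 * E) * ‖e‖)
    refine ⟨?_, ?_, ?_, ?_⟩ <;> linarith
  obtain ⟨ω', hω', hhω⟩ := hunif h hh0
  obtain ⟨Q, hQ⟩ := exists_nat_gt (1 + 1 / ω')
  have hω'0 : 0 < 1 / ω' := by positivity
  have hQ1 : (1 : ℝ) ≤ Q := by linarith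
  have hQn : 1 ≤ Q := by exact_mod_cast hQ1
  have hEn : 4 < E := by exact_mod_cast hE4
  have hEQ : 0 < E * Q := Nat.mul_pos (by omega) (by omega)
  obtain ⟨μ, hμ⟩ : ∃ μ : ℝ, μ = 2 * ((E * Q : ℕ) : ℝ) := ⟨_, rfl⟩
  have hμ' : μ = 2 * E * Q := by rw [hμ]; push_cast; ring
  have hμ0 : 0 < μ := by rw [hμ']; positivity
  have e1 : 1 / (E : ℝ) = 2 * Q / μ := by rw [hμ']; field_simp
  have e2 : 2 / (E : ℝ) = 4 * Q / μ := by rw [hμ']; field_simp; norm_num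
  have e3 : 3 / (2 * E : ℝ) = 3 * Q / μ := by rw [hμ']; field_simp
  have en : (n : ℝ) = n * μ / μ := by field_simp
  obtain ⟨N, hN⟩ : ∃ N : ℕ, N = n * (2 * (E * Q)) := ⟨_, rfl⟩
  have hNμ : (N : ℝ) = n * μ := by rw [hN, hμ]; push_cast; ring
  have hNn : (N : ℝ) / μ = n := by rw [hNμ]; field_simp
  have hmono : ∀ {a b : ℝ}, a ≤ b → a / μ ≤ b / μ := fun hab => by gcongr
  have hmN : 2 * (3 * Q) + 2 ≤ N := by
    have : 2 * (2 * (5 * 1)) ≤ n * (2 * (E * 1)) := by gcongr; omega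
    have : 2 * (2 * (5 * Q)) ≤ n * (2 * (E * Q)) := by gcongr; omega
    omega
  have hrange : ∀ k ≤ N, 0 ≤ (k : ℝ) / μ ∧ (k : ℝ) / μ ≤ n := fun k hk =>
    ⟨by positivity, by rw [← hNn]; exact hmono (by exact_mod_cast hk)⟩
  obtain ⟨z, hzdef⟩ : ∃ z : ℕ → ℂ, ∀ k, z k = γ (k / μ) := ⟨_, fun _ => rfl⟩
  have hz0 : z 0 = γ 0 := by simp [hzdef]
  have hz : z N = z 0 := by rw [hz0, hzdef, hNn, ← zero_add (n : ℝ), hper]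
  have hzseg : ∀ l < N, segment ℝ (z l) (z (l + 1)) ⊆
      γ '' Set.Icc ((l : ℝ) / μ) (((l + 1 : ℕ) : ℝ) / μ) := fun l _ => by
    rw [hzdef, hzdef, hμ]; exact hseg (E * Q) l hEQ
  have hzP : ∀ l < N, segment ℝ (z l) (z (l + 1)) ⊆ Set.range γ := fun l hl =>
    (hzseg l hl).trans (Set.image_subset_range _ _)
  have hzh : ∀ l < N, ‖z (l + 1) - z l‖ ≤ h := by
    intro l hl
    have h₁ := hrange l hl.le
    have h₂ := hrange (l + 1) hl
    rw [hzdef, hzdef]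
    refine (hhω _ ⟨h₂.1, by linarith⟩ _ ⟨h₁.1, by linarith⟩ ?_).le
    rw [← sub_div, Nat.cast_succ, add_sub_cancel_left, abs_of_pos (by positivity), div_lt_iff₀ hμ0,
      mul_comm, ← div_lt_iff₀ hω']
    have : (Q : ℝ) ≤ μ := by rw [hμ', ← one_mul (Q : ℝ), ← mul_assoc]; gcongr; linarith
    linarith
  obtain ⟨τ, hτ⟩ : ∃ τ : ℝ, τ = 3 / (2 * E) := ⟨_, rfl⟩
  have hτE : τ = 3 / 2 * (1 / E) := by rw [hτ]; field_simp
  have hτ0 : 0 < τ := by rw [hτE]; positivity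
  have hτ2 : τ ≤ 1 / 2 := by rw [hτE]; linarith
  have hτr : 2 * τ * ‖e‖ < r := by
    have : 2 * τ * ‖e‖ = 3 * ‖e‖ / E := by rw [hτ]; field_simp
    rwa [this]
  rw [← hτ] at hhe e3
  have hμτ : 1 / μ ≤ τ := by rw [e3]; exact hmono (by linarith)
  have hz1 : z 1 = γ 0 + (1 / μ : ℝ) * e := by
    rw [hzdef, Nat.cast_one]
    exact hlin _ (by rw [abs_of_pos (by positivity)]; linarith)
  have hμ2 : 1 / (2 * μ) = 1 / μ / 2 := by field_simp
  have hμ1 : 0 < 1 / μ := by positivity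
  have hW : ∀ w w' : ℂ, 0 < w.im → ‖w * e‖ < r → w'.im < 0 → ‖w' * e‖ < r →
      winding N z (γ 0 + w * e) - winding N z (γ 0 + w' * e) = 1 := by
    intro w w' h₁ h₂ h₃ h₄
    refine winding_sub_eq_one hz (by omega) hzP he (r := r) (t := 1 / (2 * μ)) ?_ (by positivity) ?_
      hz0 ?_ ?_ h₁ h₂ h₃ h₄
    · rintro q hq hqr
      rw [← hper.image_Icc (by linarith) 0, zero_add] at hq
      obtain ⟨t, ht, rfl⟩ := hq
      obtain ⟨x, -, hx, -⟩ := hloc t ht.1 ht.2 hqr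
      exact ⟨x, hx⟩
    · calc 1 / (2 * μ) * ‖e‖ ≤ 2 * τ * ‖e‖ := by gcongr; linarith
        _ < r := hτr
    · rw [hz1, hμ2]; congr 3; ring
    · intro l hl hl0 hmem
      rw [← hlin (1 / (2 * μ)) (by rw [hμ2, abs_of_pos (by positivity)]; linarith)] at hmem
      obtain ⟨t, ht, hte⟩ := hzseg l hl hmem
      have h₁ : 1 / μ ≤ t := le_trans (hmono (by exact_mod_cast Nat.one_le_iff_ne_zero.2 hl0)) ht.1
      have h₂ : t ≤ n := ht.2.trans (hrange (l + 1) hl).2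
      exact hdist (1 / (2 * μ)) t (by positivity) h₂ (by linarith) (by linarith) hte.symm
  have hfar : ∀ x : ℝ, farVertex (γ 0) (γ 0 + x * e) = γ 0 + (x + Complex.I * x) * e := fun x => by
    unfold farVertex; ring
  have hnear : ∀ x : ℝ, nearVertex (γ 0) (γ 0 + x * e) = γ 0 + (Complex.I * x) * e := fun x => by
    unfold nearVertex; ring
  have hfn : ∀ x : ℝ, |x| ≤ τ → ‖(x + Complex.I * x) * e‖ < r := fun x hx => by
    have : ‖(x + Complex.I * x : ℂ)‖ ≤ 2 * τ := (norm_add_le _ _).trans (by simp; linarith)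
    rw [norm_mul]
    exact (by gcongr : _ ≤ 2 * τ * ‖e‖).trans_lt hτr
  have hnn : ∀ x : ℝ, |x| ≤ τ → ‖(Complex.I * x) * e‖ < r := fun x hx => by
    have : ‖(Complex.I * x : ℂ)‖ ≤ 2 * τ := by simp; linarith
    rw [norm_mul]
    exact (by gcongr : _ ≤ 2 * τ * ‖e‖).trans_lt hτr
  have hzm : z (3 * Q) = γ 0 + τ * e := by
    rw [hzdef, ← hlin τ (by rwa [abs_of_pos hτ0]), e3]; push_cast; rfl
  have hzNm : z (N - 3 * Q) = γ 0 + (-τ : ℝ) * e := by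
    rw [hzdef, ← hlin (-τ) (by rwa [abs_neg, abs_of_pos hτ0]), Nat.cast_sub (by omega), sub_div, hNn,
      ← hper (-τ), e3]
    congr 1; push_cast; ring
  have hcτ : |τ| ≤ τ := (abs_of_pos hτ0).le
  have hcτ' : |-τ| ≤ τ := by rwa [abs_neg]
  have iτ₁ : 0 < (τ + Complex.I * τ : ℂ).im := by simpa using hτ0
  have iτ₂ : 0 < (Complex.I * τ : ℂ).im := by simpa using hτ0
  have iτ₃ : ((-τ : ℝ) + Complex.I * (-τ : ℝ) : ℂ).im < 0 := by simpa using hτ0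
  have iτ₄ : (Complex.I * (-τ : ℝ) : ℂ).im < 0 := by simpa using hτ0
  have w₁ := hW _ _ iτ₁ (hfn τ hcτ) iτ₃ (hfn (-τ) hcτ')
  have w₂ := hW _ _ iτ₂ (hnn τ hcτ) iτ₃ (hfn (-τ) hcτ')
  have w₃ := hW _ _ iτ₁ (hfn τ hcτ) iτ₄ (hnn (-τ) hcτ')
  have hcast : ∀ {a b : ℕ}, a ≤ b → (a : ℝ) ≤ b := fun h => by exact_mod_cast h
  have hlow : ∀ {j k : ℕ}, j + 3 * Q ≤ k + 1 → 1 / (E : ℝ) ≤ (k : ℝ) / μ - j / μ := by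
    intro j k hjk
    have := hcast hjk
    push_cast at this
    rw [e1, ← sub_div]; exact hmono (by linarith)
  have hhigh : ∀ {j k : ℕ}, k + 3 * Q ≤ j + N + 1 → (k : ℝ) / μ - j / μ ≤ n - 1 / (E : ℝ) := by
    intro j k hjk
    have := hcast hjk
    push_cast at this
    rw [e1, en, ← sub_div, ← sub_div]; exact hmono (by linarith)
  refine discrete_contradiction (N := N) (m := 3 * Q) (by omega) hmN hz hzP
    (η := min η₁ (min η₂ η₃)) (by simp [hhη₁, hhη₂, hhη₃]) hzh ?_ ?_ ?_ ?_ rfl ?_ rfl ?_ ?_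
  · intro j hj k hk h₁ h₂
    have := hmid _ _ (hrange j hj).1 (hrange j hj).2 (hrange k hk).1 (hrange k hk).2 (hlow h₁)
      (hhigh h₂)
    rw [hzdef, hzdef]
    exact (le_max_iff.1 this).imp (min_le_left _ _).trans (min_le_left _ _).trans
  · intro j hj k hk h₁ h₂
    have := hbot _ _ (hrange j hj).1 (hrange j hj).2 (hrange k hk).1 (hrange k hk).2 (hlow h₁) (by
      have := hcast h₂
      push_cast at this
      rw [e2, ← sub_div]; exact hmono (by linarith))
    rw [hzdef, hzdef]
    have hη : min η₁ (min η₂ η₃) ≤ η₂ := (min_le_right _ _).trans (min_le_left _ _)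
    exact (le_min_iff.1 this).imp hη.trans hη.trans
  · intro j hj k hk h₁ h₂
    have := htop _ _ (hrange j hj).1 (hrange j hj).2 (hrange k hk).1 (hrange k hk).2 (by
      have := hcast h₁
      push_cast at this
      rw [e2, en, ← sub_div, ← sub_div]; exact hmono (by linarith)) (hhigh h₂)
    rw [hzdef, hzdef]
    have hη : min η₁ (min η₂ η₃) ≤ η₃ := (min_le_right _ _).trans (min_le_right _ _)
    exact (le_min_iff.1 this).imp hη.trans hη.trans
  · intro k hk l hl hkl
    by_contra! hle
    have hin : ∀ j < N, j ∈ Finset.Ico (3 * Q) (N - 3 * Q) → ‖z j - γ 0‖ < r →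
        ∃ x : ℝ, z j = γ 0 + x * e ∧ τ ≤ |x| := by
      intro j hj hjm hjr
      obtain ⟨hj₁, hj₂⟩ := Finset.mem_Ico.1 hjm
      rw [hzdef] at hjr ⊢
      obtain ⟨x, -, hx, hx'⟩ := hloc _ (hrange j hj.le).1 (hrange j hj.le).2 hjr
      refine ⟨x, hx, le_abs.2 ?_⟩
      have b₁ : τ ≤ (j : ℝ) / μ := by
        rw [e3]; exact hmono (by exact_mod_cast hj₁)
      have b₂ : (j : ℝ) / μ ≤ n - τ := by
        have := hcast (show j + 3 * Q ≤ N by omega)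
        push_cast at this
        rw [e3, en, ← sub_div]; exact hmono (by linarith)
      rcases hx' with hx' | hx'
      · left; linarith
      · right; linarith
    have hout : ∀ j < N, j ∉ Finset.Ico (3 * Q) (N - 3 * Q) →
        ∃ x : ℝ, z j = γ 0 + x * e ∧ |x| ≤ τ := by
      intro j hj hjm
      rw [hzdef]
      by_cases hj₁ : j < 3 * Q
      · have b₁ : |(j : ℝ) / μ| ≤ τ := by
          rw [abs_of_nonneg (by positivity), e3]; exact hmono (by exact_mod_cast hj₁.le)
        exact ⟨_, hlin _ (b₁.trans hτ2), b₁⟩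
      · have hj₂ : N ≤ j + 3 * Q := by
          by_contra! hc
          exact hjm (Finset.mem_Ico.2 ⟨by omega, by omega⟩)
        have b₁ : |(j : ℝ) / μ - n| ≤ τ := by
          rw [abs_of_nonpos (by linarith [(hrange j hj.le).2]), e3, en, ← sub_div, ← neg_div]
          have := hcast hj₂
          push_cast at this
          exact hmono (by linarith)
        refine ⟨_, ?_, b₁⟩
        rw [← hlin _ (b₁.trans hτ2), hper.sub_eq]
    have key : ∀ x y : ℝ, |x| ≤ ‖(Complex.I * x + y : ℂ)‖ := fun x y => by
      simpa using Complex.abs_im_le_norm (Complex.I * x + y)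
    have key' : ∀ x y : ℝ, |y| ≤ ‖(Complex.I * x + y : ℂ)‖ := fun x y => by
      simpa using Complex.abs_re_le_norm (Complex.I * x + y)
    by_cases hkm : k ∈ Finset.Ico (3 * Q) (N - 3 * Q)
    · have hlm : l ∉ Finset.Ico (3 * Q) (N - 3 * Q) := fun h => hkl (by simp [hkm, h])
      obtain ⟨y, hy, hyτ⟩ := hout l hl hlm
      have hkr : ‖z k - γ 0‖ < r := by
        have e₁ : Complex.I * (z k - γ 0) = (nearVertex (z 0) (z k) - z l) + y * e := by
          rw [hy, hz0]; unfold nearVertex; ring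
        have e₂ : ‖z k - γ 0‖ = ‖Complex.I * (z k - γ 0)‖ := by simp
        have e₄ : ‖(y : ℂ) * e‖ ≤ τ * ‖e‖ := by
          rw [norm_mul, Complex.norm_real, Real.norm_eq_abs]; gcongr
        rw [e₂, e₁]
        exact (norm_add_le _ _).trans_lt (by linarith)
      obtain ⟨x, hx, hxτ⟩ := hin k hk hkm hkr
      have e₅ : nearVertex (z 0) (z k) - z l = (Complex.I * x + (-y : ℝ)) * e := by
        rw [hx, hy, hz0, hnear]; push_cast; ring
      rw [e₅, norm_mul] at hle
      have := mul_le_mul_of_nonneg_right (hxτ.trans (key x (-y))) he0.le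
      linarith
    · have hlm : l ∈ Finset.Ico (3 * Q) (N - 3 * Q) := by
        by_contra h
        exact hkl (by simp [hkm, h])
      obtain ⟨x, hx, hxτ⟩ := hout k hk hkm
      have hlr : ‖z l - γ 0‖ < r := by
        have e₁ : z l - γ 0 = -(nearVertex (z 0) (z k) - z l) + Complex.I * x * e := by
          rw [hx, hz0]; unfold nearVertex; ring
        have e₄ : ‖Complex.I * x * e‖ ≤ τ * ‖e‖ := by
          rw [norm_mul, norm_mul, Complex.norm_I, one_mul, Complex.norm_real, Real.norm_eq_abs]
          gcongr
        rw [e₁]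
        refine (norm_add_le _ _).trans_lt ?_
        rw [norm_neg]
        linarith
      obtain ⟨y, hy, hyτ⟩ := hin l hl hlm hlr
      have e₅ : nearVertex (z 0) (z k) - z l = (Complex.I * x + (-y : ℝ)) * e := by
        rw [hx, hy, hz0, hnear]; push_cast; ring
      rw [e₅, norm_mul] at hle
      have h₁ := key' x (-y)
      rw [abs_neg] at h₁
      have := mul_le_mul_of_nonneg_right (hyτ.trans h₁) he0.le
      linarith
  · rw [hzm, hz0, hfar, hnear]; linarith
  · rw [hzNm, hz0, hfar, hnear]; linarith
  · rw [hzm, hzNm, hz0, hfar, hfar, w₁]; exact odd_one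

theorem eq_or_eq_of_inner_eq_zero {V : Type*} [NormedAddCommGroup V] [InnerProductSpace ℝ V]
    {α β : V} (hαβ : ⟪α, β⟫ < 0) {u w : V} {b : ℝ} (hb : 0 ≤ b)
    (hu : (∃ a : ℝ, 0 ≤ a ∧ u = a • α) ∨ ∃ a : ℝ, 0 ≤ a ∧ u = a • β)
    (hw : (∃ a : ℝ, 0 ≤ a ∧ w = a • α) ∨ ∃ a : ℝ, 0 ≤ a ∧ w = a • β)
    (h : ⟪u - b • α, w - b • α⟫ = 0) : u = b • α ∨ w = b • α := by
  have hα : 0 < ⟪α, α⟫ := real_inner_self_pos.2 (by rintro rfl; simp at hαβ)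
  have hβ : 0 < ⟪β, β⟫ := real_inner_self_pos.2 (by rintro rfl; simp at hαβ)
  have hβα : ⟪β, α⟫ = ⟪α, β⟫ := real_inner_comm _ _
  have mixed : ∀ a c : ℝ, 0 ≤ c → (a - b) * (c * ⟪α, β⟫ - b * ⟪α, α⟫) = 0 →
      a • α = b • α ∨ c • β = b • α := by
    intro a c hc h
    rcases mul_eq_zero.1 h with h | h
    · left; rw [sub_eq_zero.1 h]
    · have h₁ := mul_nonneg hb hα.le
      have h₂ := mul_nonpos_of_nonneg_of_nonpos hc hαβ.le
      have hb0 : b = 0 := by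
        have : b * ⟪α, α⟫ = 0 := by linarith
        exact (mul_eq_zero.1 this).resolve_right hα.ne'
      have hc0 : c = 0 := by
        have : c * ⟪α, β⟫ = 0 := by linarith
        exact (mul_eq_zero.1 this).resolve_right hαβ.ne
      right; rw [hb0, hc0, zero_smul, zero_smul]
  rcases hu with ⟨a, ha, rfl⟩ | ⟨a, ha, rfl⟩ <;> rcases hw with ⟨c, hc, rfl⟩ | ⟨c, hc, rfl⟩ <;>
    simp only [inner_sub_left, inner_sub_right, real_inner_smul_left, real_inner_smul_right,
      hβα] at h
  · have : (a - b) * (c - b) = 0 := by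
      refine (mul_eq_zero.1 (?_ : _ * ⟪α, α⟫ = 0)).resolve_right hα.ne'
      linarith
    exact (mul_eq_zero.1 this).imp (fun h => by rw [sub_eq_zero.1 h])
      (fun h => by rw [sub_eq_zero.1 h])
  · exact mixed a c hc (by linarith)
  · exact (mixed c a ha (by linarith)).symm
  · have h₁ := mul_nonneg (mul_nonneg ha hc) hβ.le
    have h₂ := mul_nonneg (mul_nonneg hb hb) hα.le
    have h₃ := mul_nonneg (mul_nonneg ha hb) (neg_nonneg.2 hαβ.le)
    have h₄ := mul_nonneg (mul_nonneg hc hb) (neg_nonneg.2 hαβ.le)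
    have hb0 : b = 0 := by
      have : b * b * ⟪α, α⟫ = 0 := by linarith
      exact mul_self_eq_zero.1 ((mul_eq_zero.1 this).resolve_right hα.ne')
    have hac : a * c = 0 := by
      have : a * c * ⟪β, β⟫ = 0 := by linarith
      exact (mul_eq_zero.1 this).resolve_right hβ.ne'
    exact (mul_eq_zero.1 hac).imp (fun h => by rw [hb0, h, zero_smul, zero_smul])
      (fun h => by rw [hb0, h, zero_smul, zero_smul])

theorem exists_rays {n : ℕ} [NeZero n] {c : ZMod n → ℂ} (hne : ∀ i, c i ≠ c (i + 1))
    (hadj : ∀ i, segment ℝ (c i) (c (i + 1)) ∩ segment ℝ (c (i + 1)) (c (i + 2)) = {c (i + 1)})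
    (hdis : ∀ i j, i ≠ j → i ≠ j + 1 → j ≠ i + 1 →
      segment ℝ (c i) (c (i + 1)) ∩ segment ℝ (c j) (c (j + 1)) = ∅)
    (hang : ∀ i, ⟪c (i - 1) - c i, c (i + 1) - c i⟫ < 0) {q : ℂ}
    (hq : q ∈ ⋃ i, segment ℝ (c i) (c (i + 1))) :
    ∃ α β : ℂ, ⟪α, β⟫ < 0 ∧ ∃ ρ > 0, ∀ x ∈ ⋃ i, segment ℝ (c i) (c (i + 1)), dist x q < ρ →
      (∃ a : ℝ, 0 ≤ a ∧ x - q = a • α) ∨ ∃ a : ℝ, 0 ≤ a ∧ x - q = a • β := by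
  have hshare : ∀ i j x, x ∈ segment ℝ (c i) (c (i + 1)) → x ∈ segment ℝ (c j) (c (j + 1)) →
      i = j ∨ (i = j + 1 ∧ x = c i) ∨ (j = i + 1 ∧ x = c j) := by
    intro i j x hi hj
    by_contra! hc
    by_cases h₁ : i = j + 1
    · refine hc.2.1 h₁ ?_
      subst h₁
      have := (hadj j).le ⟨hj, by rwa [add_assoc, one_add_one_eq_two] at hi⟩
      exact this
    by_cases h₂ : j = i + 1
    · refine hc.2.2 h₂ ?_
      subst h₂
      have := (hadj i).le ⟨hi, by rwa [add_assoc, one_add_one_eq_two] at hj⟩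
      exact this
    · exact (hdis i j hc.1 h₁ h₂).le ⟨hi, hj⟩
  obtain ⟨ρ, hρ, hfar⟩ : ∃ ρ > 0, ∀ x, dist x q < ρ → ∀ i, q ∉ segment ℝ (c i) (c (i + 1)) →
      x ∉ segment ℝ (c i) (c (i + 1)) := by
    refine Metric.eventually_nhds_iff.1 (Filter.eventually_all.2 fun i => ?_)
    by_cases hi : q ∈ segment ℝ (c i) (c (i + 1))
    · simp [hi]
    · have hcl : IsClosed (segment ℝ (c i) (c (i + 1))) := by
        rw [segment_eq_image']
        exact (isCompact_Icc.image (by fun_prop)).isClosed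
      filter_upwards [hcl.isOpen_compl.mem_nhds hi] with x hx _ using hx
  have hnear : ∀ x ∈ ⋃ i, segment ℝ (c i) (c (i + 1)), dist x q < ρ →
      ∃ i, q ∈ segment ℝ (c i) (c (i + 1)) ∧ x ∈ segment ℝ (c i) (c (i + 1)) := by
    intro x hx hxq
    obtain ⟨i, hi⟩ := Set.mem_iUnion.1 hx
    refine ⟨i, ?_, hi⟩
    by_contra hqi
    exact hfar x hxq i hqi hi
  by_cases hv : ∃ j, q = c j
  · obtain ⟨j, rfl⟩ := hv
    refine ⟨c (j - 1) - c j, c (j + 1) - c j, hang j, ρ, hρ, fun x hx hxq => ?_⟩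
    obtain ⟨i, hqi, hxi⟩ := hnear x hx hxq
    rcases hshare i j _ hqi (left_mem_segment ℝ _ _) with rfl | ⟨rfl, h⟩ | ⟨rfl, -⟩
    · right
      rw [segment_eq_image'] at hxi
      obtain ⟨θ, hθ, rfl⟩ := hxi
      exact ⟨θ, hθ.1, by simp⟩
    · exact absurd h (hne j)
    · left
      rw [segment_symm, segment_eq_image'] at hxi
      obtain ⟨θ, hθ, rfl⟩ := hxi
      exact ⟨θ, hθ.1, by simp⟩
  · obtain ⟨j, hj⟩ := Set.mem_iUnion.1 hq
    have hd : c (j + 1) - c j ≠ 0 := sub_ne_zero.2 (hne j).symm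
    refine ⟨c (j + 1) - c j, -(c (j + 1) - c j), ?_, ρ, hρ, fun x hx hxq => ?_⟩
    · rw [inner_neg_right]
      exact neg_neg_of_pos (real_inner_self_pos.2 hd)
    obtain ⟨i, hqi, hxi⟩ := hnear x hx hxq
    rcases hshare i j _ hqi hj with rfl | ⟨-, h⟩ | ⟨-, h⟩
    · rw [segment_eq_image'] at hqi hxi
      obtain ⟨θ, -, rfl⟩ := hqi
      obtain ⟨φ, -, rfl⟩ := hxi
      rcases le_total θ φ with h | h
      · exact Or.inl ⟨φ - θ, by linarith, by dsimp only; module⟩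
      · exact Or.inr ⟨θ - φ, by linarith, by dsimp only; module⟩
    · exact absurd ⟨i, h⟩ hv
    · exact absurd ⟨j, h⟩ hv

theorem exists_small_squares_missing {n : ℕ} [NeZero n] {c : ZMod n → ℂ}
    (hne : ∀ i, c i ≠ c (i + 1))
    (hadj : ∀ i, segment ℝ (c i) (c (i + 1)) ∩ segment ℝ (c (i + 1)) (c (i + 2)) = {c (i + 1)})
    (hdis : ∀ i j, i ≠ j → i ≠ j + 1 → j ≠ i + 1 →
      segment ℝ (c i) (c (i + 1)) ∩ segment ℝ (c j) (c (j + 1)) = ∅)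
    (hang : ∀ i, ⟪c (i - 1) - c i, c (i + 1) - c i⟫ < 0) {P : Set ℂ}
    (hP : P = ⋃ i, segment ℝ (c i) (c (i + 1))) :
    ∃ δ > 0, ∀ x ∈ P, ∀ y ∈ P, x ≠ y → ‖x - y‖ < δ → farVertex x y ∉ P ∧ nearVertex x y ∉ P := by
  have hPc : IsCompact P := by
    rw [hP]
    refine isCompact_iUnion fun i => ?_
    rw [segment_eq_image']
    exact isCompact_Icc.image (by fun_prop)
  have hray : ∀ q : P, ∃ α β : ℂ, ⟪α, β⟫ < 0 ∧ ∃ ρ > 0, ∀ x ∈ P, dist x q < ρ →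
      (∃ a : ℝ, 0 ≤ a ∧ x - q = a • α) ∨ ∃ a : ℝ, 0 ≤ a ∧ x - q = a • β := by
    rintro ⟨q, hq⟩
    subst hP
    exact exists_rays hne hadj hdis hang hq
  choose α β hαβ ρ hρ hcone using hray
  obtain ⟨δ, hδ, hleb⟩ := lebesgue_number_lemma_of_metric hPc
    (c := fun q : P => Metric.ball (q : ℂ) (ρ q)) (fun _ => Metric.isOpen_ball)
    (fun x hx => Set.mem_iUnion.2 ⟨⟨x, hx⟩, Metric.mem_ball_self (hρ _)⟩)
  have key : ∀ u ∈ P, ∀ v ∈ P, ∀ w ∈ P, dist u v < δ → dist w v < δ → ⟪u - v, w - v⟫ = 0 →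
      u = v ∨ w = v := by
    intro u hu v hv w hw huv hwv h
    obtain ⟨q, hq⟩ := hleb v hv
    have hu' := hcone q u hu (hq huv)
    have hv' := hcone q v hv (hq (Metric.mem_ball_self hδ))
    have hw' := hcone q w hw (hq hwv)
    have hsub : ∀ x y : ℂ, x - y = (x - q) - (y - q) := fun x y => by ring
    rw [hsub u, hsub w] at h
    have : u - q = v - q ∨ w - q = v - q := by
      rcases hv' with ⟨b, hb, hv'⟩ | ⟨b, hb, hv'⟩
      · rw [hv'] at h ⊢
        exact eq_or_eq_of_inner_eq_zero (hαβ q) hb hu' hw' h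
      · rw [hv'] at h ⊢
        exact eq_or_eq_of_inner_eq_zero (by rw [real_inner_comm]; exact hαβ q) hb hu'.symm
          hw'.symm h
    exact this.imp sub_left_injective.eq_iff.1 sub_left_injective.eq_iff.1
  have hperp : ∀ d : ℂ, ⟪d, Complex.I * d⟫ = 0 := fun d => by
    rw [Complex.inner]; simp; ring
  refine ⟨δ, hδ, fun x hx y hy hxy hd => ⟨fun h => ?_, fun h => ?_⟩⟩
  · have e : farVertex x y - y = -(Complex.I * (x - y)) := by unfold farVertex; ring
    rcases key x hx y hy _ h (by rwa [dist_eq_norm]) (by rw [dist_eq_norm, e]; simpa using hd)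
      (by rw [e, inner_neg_right, hperp, neg_zero]) with h | h
    · exact hxy h
    · rw [← sub_eq_zero, e] at h
      simp [sub_eq_zero, hxy] at h
  · have e : nearVertex x y - x = Complex.I * (y - x) := by unfold nearVertex; ring
    rcases key y hy x hx _ h (by rwa [dist_comm, dist_eq_norm])
      (by rw [dist_eq_norm, e, norm_mul, norm_sub_rev]; simpa using hd)
      (by rw [e, hperp]) with h | h
    · exact hxy h.symm
    · rw [← sub_eq_zero, e] at h
      simp [sub_eq_zero, hxy.symm] at h

/-- The piecewise linear path through the points `c k`, passing through `c k` at time `k`. -/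
def polyPath {n : ℕ} (c : ZMod n → ℂ) (x : ℝ) : ℂ :=
  c (⌊x⌋ : ℤ) + Int.fract x * (c ((⌊x⌋ : ℤ) + 1) - c (⌊x⌋ : ℤ))

theorem polyPath_eq {n : ℕ} (c : ZMod n → ℂ) {k : ℤ} {x : ℝ} (hk : k ≤ x) (hx : x ≤ k + 1) :
    polyPath c x = c k + (x - k : ℝ) * (c (k + 1) - c k) := by
  rcases hx.lt_or_eq with hx | rfl
  · have : ⌊x⌋ = k := Int.floor_eq_iff.2 ⟨hk, hx⟩
    rw [polyPath, Int.fract, this]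
  · simp [polyPath]

theorem polyPath_mem_segment {n : ℕ} (c : ZMod n → ℂ) (x : ℝ) :
    polyPath c x ∈ segment ℝ (c (⌊x⌋ : ℤ)) (c ((⌊x⌋ : ℤ) + 1)) := by
  rw [segment_eq_image']
  exact ⟨Int.fract x, ⟨Int.fract_nonneg x, (Int.fract_lt_one x).le⟩, by simp [polyPath]⟩

theorem polyPath_periodic {n : ℕ} (c : ZMod n → ℂ) : Function.Periodic (polyPath c) n := by
  intro x
  simp [polyPath]

theorem continuous_polyPath {n : ℕ} (c : ZMod n → ℂ) : Continuous (polyPath c) := by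
  refine continuous_iff_continuousAt.2 fun x => ?_
  obtain ⟨k, hk⟩ : ∃ k : ℤ, k = ⌊x⌋ := ⟨_, rfl⟩
  have h₁ : (k : ℝ) ≤ x := hk ▸ Int.floor_le x
  have h₂ : x < k + 1 := hk ▸ Int.lt_floor_add_one x
  have hcont : Continuous fun t : ℝ => if t ≤ k
      then c (k - 1 : ℤ) + (t - (k - 1 : ℤ) : ℝ) * (c ((k - 1 : ℤ) + 1) - c (k - 1 : ℤ))
      else c k + (t - k : ℝ) * (c (k + 1) - c k) := by
    refine Continuous.if_le (by fun_prop) (by fun_prop) continuous_id continuous_const ?_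
    rintro t rfl
    simp
  refine hcont.continuousAt.congr ?_
  filter_upwards [Ioo_mem_nhds (show (k : ℝ) - 1 < x by linarith) h₂] with t ht
  split_ifs with h
  · exact (polyPath_eq c (by push_cast; exact ht.1.le) (by push_cast; linarith)).symm
  · exact (polyPath_eq c (not_le.1 h).le ht.2.le).symm

theorem segment_subset_polyPath {n : ℕ} (c : ZMod n → ℂ) {k : ℤ} {a b : ℝ} (hk : k ≤ a)
    (hab : a ≤ b) (hb : b ≤ k + 1) :
    segment ℝ (polyPath c a) (polyPath c b) ⊆ polyPath c '' Set.Icc a b := by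
  rw [segment_eq_image']
  rintro _ ⟨θ, ⟨h₀, h₁⟩, rfl⟩
  have h₂ : a ≤ a + θ * (b - a) := by nlinarith
  have h₃ : a + θ * (b - a) ≤ b := by nlinarith
  refine ⟨a + θ * (b - a), ⟨h₂, h₃⟩, ?_⟩
  rw [polyPath_eq c (hk.trans h₂) (h₃.trans hb), polyPath_eq c hk (hab.trans hb),
    polyPath_eq c (hk.trans hab) hb]
  dsimp only
  rw [Complex.real_smul]
  push_cast
  ring

theorem polyPath_injective {n : ℕ} {c : ZMod n → ℂ} (hne : ∀ i, c i ≠ c (i + 1))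
    (hadj : ∀ i, segment ℝ (c i) (c (i + 1)) ∩ segment ℝ (c (i + 1)) (c (i + 2)) = {c (i + 1)})
    (hdis : ∀ i j, i ≠ j → i ≠ j + 1 → j ≠ i + 1 →
      segment ℝ (c i) (c (i + 1)) ∩ segment ℝ (c j) (c (j + 1)) = ∅)
    {a b : ℝ} (hab : a < b) (hba : b ≤ a + n) (h : polyPath c a = polyPath c b) : b = a + n := by
  have hend : ∀ x, polyPath c x ≠ c ((⌊x⌋ : ℤ) + 1) := by
    intro x hx
    have : (((Int.fract x : ℝ) : ℂ) - 1) * (c ((⌊x⌋ : ℤ) + 1) - c (⌊x⌋ : ℤ)) = 0 := by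
      rw [polyPath] at hx
      linear_combination hx
    rcases mul_eq_zero.1 this with h | h
    · have := Int.fract_lt_one x
      have h' : Int.fract x = 1 := by exact_mod_cast sub_eq_zero.1 h
      linarith
    · exact hne _ (sub_eq_zero.1 h).symm
  have ha := polyPath_mem_segment c a
  have hb := polyPath_mem_segment c b
  by_cases h₁ : ((⌊a⌋ : ℤ) : ZMod n) = (⌊b⌋ : ℤ)
  · have hfr : Int.fract a = Int.fract b := by
      rw [polyPath, polyPath, h₁] at h
      have := mul_right_cancel₀ (sub_ne_zero.2 (hne _).symm) (add_left_cancel h)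
      exact_mod_cast this
    obtain ⟨d, hd⟩ := (ZMod.intCast_eq_intCast_iff_dvd_sub _ _ _).1 h₁
    have hd' : b - a = n * d := by
      have : ((⌊b⌋ - ⌊a⌋ : ℤ) : ℝ) = n * d := by rw [hd]; push_cast; rfl
      rw [← this]
      push_cast
      linarith [Int.floor_add_fract a, Int.floor_add_fract b]
    have hn : (0 : ℝ) ≤ n := n.cast_nonneg
    have hd0 : 0 < d := by
      by_contra! hd0
      have : (d : ℝ) ≤ 0 := by exact_mod_cast hd0
      nlinarith
    have : (1 : ℝ) ≤ d := by exact_mod_cast hd0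
    nlinarith
  rw [← h] at hb
  exfalso
  by_cases h₂ : ((⌊a⌋ : ℤ) : ZMod n) = (⌊b⌋ : ℤ) + 1
  · rw [h₂, add_assoc, one_add_one_eq_two] at ha
    exact hend b (h ▸ (hadj _).le ⟨hb, ha⟩)
  by_cases h₃ : ((⌊b⌋ : ℤ) : ZMod n) = (⌊a⌋ : ℤ) + 1
  · rw [h₃, add_assoc, one_add_one_eq_two] at hb
    exact hend a ((hadj _).le ⟨ha, hb⟩)
  · exact (hdis _ _ h₁ h₂ h₃).le ⟨ha, hb⟩

theorem exists_complex_square {n : ℕ} (hn : 3 ≤ n) {c : ZMod n → ℂ} (hne : ∀ i, c i ≠ c (i + 1))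
    (hadj : ∀ i, segment ℝ (c i) (c (i + 1)) ∩ segment ℝ (c (i + 1)) (c (i + 2)) = {c (i + 1)})
    (hdis : ∀ i j, i ≠ j → i ≠ j + 1 → j ≠ i + 1 →
      segment ℝ (c i) (c (i + 1)) ∩ segment ℝ (c j) (c (j + 1)) = ∅)
    (hang : ∀ i, ⟪c (i - 1) - c i, c (i + 1) - c i⟫ < 0) {P : Set ℂ}
    (hP : P = ⋃ i, segment ℝ (c i) (c (i + 1))) :
    ∃ x ∈ P, ∃ y ∈ P, x ≠ y ∧ farVertex x y ∈ P ∧ nearVertex x y ∈ P := by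
  have : NeZero n := ⟨by omega⟩
  have hmem : ∀ x, polyPath c x ∈ P := fun x => by
    rw [hP]; exact Set.mem_iUnion.2 ⟨_, polyPath_mem_segment c x⟩
  have hrange : Set.range (fun x => polyPath c (x + 1 / 2)) ⊆ P := by
    rintro _ ⟨x, rfl⟩; exact hmem _
  obtain ⟨δ, hδ, hsmall⟩ := exists_small_squares_missing hne hadj hdis hang hP
  obtain ⟨s, t, hst, hF, hG⟩ := exists_square_of_closed_curve (n := n)
    (γ := fun x => polyPath c (x + 1 / 2)) (e := c (0 + 1) - c 0)
    ((continuous_polyPath c).comp (by fun_prop)) (by omega)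
    (fun x => by
      have := polyPath_periodic c (x + 1 / 2)
      dsimp only
      rw [← this, add_right_comm])
    (fun s t hs hst ht h => by
      have := polyPath_injective hne hadj hdis (a := s + 1 / 2) (b := t + 1 / 2) (by linarith)
        (by linarith) h
      constructor <;> linarith)
    (fun M l hM => by
      have hM' : (0 : ℝ) < 2 * M := by positivity
      obtain ⟨k, hk⟩ : ∃ k : ℕ, k = (l + M) / (2 * M) := ⟨_, rfl⟩
      have hk₁ : (k : ℝ) * (2 * M) ≤ l + M := by
        exact_mod_cast hk ▸ Nat.div_mul_le_self (l + M) (2 * M)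
      have hk₂ : ((l + 1 : ℕ) : ℝ) + M ≤ (k + 1) * (2 * M) := by
        have := Nat.lt_mul_div_succ (l + M) (show 0 < 2 * M by omega)
        rw [← hk, mul_comm] at this
        have : l + 1 + M ≤ (k + 1) * (2 * M) := by omega
        exact_mod_cast this
      have hhalf : ∀ a : ℝ, a / (2 * M) + 1 / 2 = (a + M) / (2 * M) := fun a => by field_simp
      have := segment_subset_polyPath c (k := k) (a := (l : ℝ) / (2 * M) + 1 / 2)
        (b := ((l + 1 : ℕ) : ℝ) / (2 * M) + 1 / 2)
        (by rw [hhalf, le_div_iff₀ hM']; exact_mod_cast hk₁)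
        (by push_cast; gcongr; linarith)
        (by rw [hhalf, div_le_iff₀ hM']; exact_mod_cast hk₂)
      refine this.trans ?_
      rintro _ ⟨u, hu, rfl⟩
      exact ⟨u - 1 / 2, ⟨by linarith [hu.1], by linarith [hu.2]⟩, by simp⟩)
    hδ
    (fun s t hst hd => by
      have := hsmall _ (hmem _) _ (hmem _) hst hd
      exact ⟨fun h => this.1 (hrange h), fun h => this.2 (hrange h)⟩)
    (sub_ne_zero.2 (hne 0).symm)
    (fun t ht => by
      obtain ⟨h₁, h₂⟩ := abs_le.1 ht
      have h₃ := polyPath_eq c (k := 0) (x := t + 1 / 2) (by push_cast; linarith)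
        (by push_cast; linarith)
      have h₄ := polyPath_eq c (k := 0) (x := 0 + 1 / 2) (by norm_num) (by norm_num)
      rw [h₃, h₄]
      push_cast
      ring)
  exact ⟨_, hmem _, _, hmem _, hst, hrange hF, hrange hG⟩

theorem rotCCW_eq (w : Pt) : Complex.orthonormalBasisOneI.repr.symm (rotCCW w) =
    Complex.I * Complex.orthonormalBasisOneI.repr.symm w := by
  apply Complex.ext <;> simp [rotCCW, Complex.orthonormalBasisOneI_repr_symm_apply]

/-- Every simple polygon all of whose interior angles lie strictly between `π/2`
and `3π/2` has an inscribed square. -/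
theorem square_peg_for_obtuse_polygons {n : ℕ} (v : ZMod n → Pt)
    (hP : IsSimplePolygon v) (hA : ObtuseAngles v) :
    ∃ a₁ a₂ a₃ a₄ : Pt, InscribedSquare (polygonSet v) a₁ a₂ a₃ a₄ := by
  obtain ⟨hn, hne, hadj, hdis⟩ := hP
  have : NeZero n := ⟨by omega⟩
  let φ : Pt ≃ₗᵢ[ℝ] ℂ := Complex.orthonormalBasisOneI.repr.symm
  have hφseg : ∀ x y, segment ℝ (φ x) (φ y) = φ '' segment ℝ x y := fun x y =>
    (image_segment ℝ φ.toLinearEquiv.toLinearMap.toAffineMap x y).symm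
  have hrot : ∀ w, φ (rotCCW w) = Complex.I * φ w := rotCCW_eq
  obtain ⟨x, hx, y, hy, hxy, hF, hG⟩ := exists_complex_square hn (c := fun i => φ (v i))
    (fun i h => hne i (φ.injective h))
    (fun i => by
      rw [hφseg, hφseg, ← Set.image_inter φ.injective, hadj, Set.image_singleton])
    (fun i j h₁ h₂ h₃ => by
      rw [hφseg, hφseg, ← Set.image_inter φ.injective, hdis i j h₁ h₂ h₃, Set.image_empty])
    (fun i => by
      rw [← map_sub, ← map_sub, φ.inner_map_map]
      exact hA i)
    (P := φ '' polygonSet v) (by rw [polygonSet, Set.image_iUnion]; simp only [hφseg])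
  obtain ⟨a, ha, rfl⟩ := hx
  obtain ⟨b, hb, rfl⟩ := hy
  obtain ⟨f, hf, hf'⟩ := hF
  obtain ⟨g, hg, hg'⟩ := hG
  have hfb : f - b = rotCCW (b - a) := φ.injective (by
    rw [map_sub, hrot, map_sub, hf']; unfold farVertex; ring)
  have hga : g - a = rotCCW (b - a) := φ.injective (by
    rw [map_sub, hrot, map_sub, hg']; unfold nearVertex; ring)
  have hab : a ≠ b := fun h => hxy (by rw [h])
  have hd : φ b - φ a ≠ 0 := sub_ne_zero.2 hxy.symm
  have hne' : ∀ (p q : Pt) (κ : ℂ), φ q - φ p = κ * (φ b - φ a) → κ ≠ 0 → p ≠ q := by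
    rintro p q κ h hκ rfl
    rw [sub_self] at h
    exact mul_ne_zero hκ hd h.symm
  refine ⟨a, b, f, g, ha, hb, hf, hg, ?_, hfb, hab, hne' _ _ (1 + Complex.I) ?_ ?_,
    hne' _ _ Complex.I ?_ Complex.I_ne_zero, hne' _ _ Complex.I ?_ Complex.I_ne_zero,
    hne' _ _ (Complex.I - 1) ?_ ?_, hne' _ _ (-1) ?_ (by simp)⟩
  · have := hfb.trans hga.symm
    rw [sub_eq_sub_iff_add_eq_add] at this ⊢
    rw [add_comm b g, this.symm, add_comm]
  · rw [hf']; unfold farVertex; ring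
  · intro h; simpa using congrArg Complex.re h
  · rw [hg']; unfold nearVertex; ring
  · rw [hf']; unfold farVertex; ring
  · rw [hg']; unfold nearVertex; ring
  · intro h; simpa using congrArg Complex.im h
  · rw [hg', hf']; unfold nearVertex farVertex; ring
end
end
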